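/- Let I ⊂ ℝ be a compact interval, f = (f₁,…,f_n) : I → ℝⁿ a C^(n) map whose Wronskian w(f₁',…,f_n')(x) = det(f_i^(j)(x))_{1≤i,j≤n} is nonzero for every x ∈ I, let ψ be an approximation function and λ ∈ C²(I). Then for any 0 < s ≤ 1, if the series ∑_{q=1}^∞ (ψ(q)/q)^s · q^n diverges, then H^s(A_n(ψ,λ)) = H^s(I). -/

import Mathlib

open MeasureTheory Filter Set

/-- Distance from a real number to the nearest integer. -/
noncomputable def nearestIntDist (x : ℝ) : ℝ := |x - round x|

theorem exists_separated_seq {g : ℝ} (hg : 0 < g) (N : ℕ) : ∀ E : Set ℝ, BddBelow E →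
    ENNReal.ofReal (2 * g * N) < volume E →
    ∃ x : ℕ → ℝ, (∀ l ≤ N, x l ∈ E) ∧ ∀ l < N, x l + g ≤ x (l + 1) := by
  induction N with
  | zero =>
    intro E _ hE
    obtain ⟨y, hy⟩ : E.Nonempty := by
      by_contra h
      rw [not_nonempty_iff_eq_empty] at h
      simp [h] at hE
    exact ⟨fun _ => y, fun _ _ => hy, fun l hl => absurd hl (by simp)⟩
  | succ N ih =>
    intro E hb hE
    have hne : E.Nonempty := by
      by_contra h
      rw [not_nonempty_iff_eq_empty] at h
      simp [h] at hE
    obtain ⟨y, hy, hy2⟩ := exists_lt_of_csInf_lt hne (lt_add_of_pos_right (sInf E) hg)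
    have hsub : E ⊆ (E ∩ Ici (y + g)) ∪ Icc (sInf E) (y + g) := by
      intro z hz
      rcases le_total (y + g) z with h | h
      · exact Or.inl ⟨hz, h⟩
      · exact Or.inr ⟨csInf_le hb hz, h⟩
    have hvol : ENNReal.ofReal (2 * g * N) < volume (E ∩ Ici (y + g)) := by
      by_contra! hcon
      have h1 : volume E ≤ ENNReal.ofReal (2 * g * N) + ENNReal.ofReal (2 * g) := by
        refine (measure_mono hsub).trans ((measure_union_le _ _).trans ?_)
        rw [Real.volume_Icc]
        exact add_le_add hcon (ENNReal.ofReal_le_ofReal (by linarith))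
      rw [← ENNReal.ofReal_add (by positivity) (by positivity)] at h1
      refine absurd (hE.trans_le h1) (not_lt.2 (ENNReal.ofReal_le_ofReal ?_))
      push_cast
      linarith
    obtain ⟨x, hx1, hx2⟩ := ih _ (hb.mono inter_subset_left) hvol
    refine ⟨fun l => Nat.casesOn l y x, ?_, ?_⟩
    · rintro (_ | l) hl
      · exact hy
      · exact (hx1 l (by omega)).1
    · rintro (_ | l) hl
      · exact (hx1 0 (by omega)).2
      · exact hx2 l (by omega)

theorem exists_small_iterated_deriv {p q g : ℝ} (hg : 0 < g) (j : ℕ) :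
    ∀ (D : ℕ → ℝ → ℝ) (x : ℕ → ℝ) (ε : ℝ), 0 ≤ ε →
    (∀ i ≤ j, ContinuousOn (D i) (Icc p q)) →
    (∀ i < j, ∀ y ∈ Ioo p q, HasDerivAt (D i) (D (i + 1) y) y) →
    (∀ l < 2 ^ j, x l ∈ Icc p q ∧ |D 0 (x l)| ≤ ε) →
    (∀ l, l + 1 < 2 ^ j → x l + g ≤ x (l + 1)) →
    ∀ i ≤ j, ∃ ξ ∈ Icc p q, |D i ξ| ≤ (2 / g) ^ i * ε := by
  induction j with
  | zero =>
    intro D x ε _ _ _ hx _ i hi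
    obtain rfl : i = 0 := by omega
    exact ⟨x 0, (hx 0 (by simp)).1, by simpa using (hx 0 (by simp)).2⟩
  | succ j ih =>
    intro D x ε hε hc hd hx hgap i hi
    rcases i with _ | i
    · exact ⟨x 0, (hx 0 (by positivity)).1, by simpa using (hx 0 (by positivity)).2⟩
    have key : ∀ l, ∃ y, l < 2 ^ j → (x (2 * l) < y ∧ y < x (2 * l + 1) ∧ |D 1 y| ≤ 2 / g * ε) := by
      intro l
      by_cases hl : l < 2 ^ j
      · have h1 : 2 * l + 1 < 2 ^ (j + 1) := by rw [pow_succ]; omega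
        have hlt : x (2 * l) < x (2 * l + 1) := by linarith [hgap (2 * l) h1]
        have ha := hx (2 * l) (by omega)
        have hb := hx (2 * l + 1) h1
        obtain ⟨y, hy, hyd⟩ := exists_hasDerivAt_eq_slope (D 0) (D 1) hlt
          ((hc 0 (by omega)).mono (Icc_subset_Icc ha.1.1 hb.1.2))
          (fun y hy => hd 0 (by omega) y ⟨ha.1.1.trans_lt hy.1, hy.2.trans_le hb.1.2⟩)
        refine ⟨y, fun _ => ⟨hy.1, hy.2, ?_⟩⟩
        have hgap' := hgap _ h1
        rw [hyd, abs_div, abs_of_pos (sub_pos.2 hlt), div_mul_eq_mul_div]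
        have h2 : |D 0 (x (2 * l + 1)) - D 0 (x (2 * l))| ≤ 2 * ε :=
          (abs_sub _ _).trans (by linarith [ha.2, hb.2])
        exact div_le_div₀ (by positivity) h2 hg (by linarith)
      · exact ⟨0, fun h => absurd h hl⟩
    choose y hy using key
    obtain ⟨ξ, hξ, hξ2⟩ := ih (fun i => D (i + 1)) y (2 / g * ε) (by positivity)
      (fun i hi => hc _ (by omega)) (fun i hi => hd _ (by omega))
      (fun l hl => by
        have h1 : 2 * l + 1 < 2 ^ (j + 1) := by rw [pow_succ]; omega
        have ha := hx (2 * l) (by omega)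
        have hb := hx (2 * l + 1) h1
        exact ⟨⟨ha.1.1.trans (hy l hl).1.le, (hy l hl).2.1.le.trans hb.1.2⟩, (hy l hl).2.2⟩)
      (fun l hl => by
        have h1 : 2 * l + 1 + 1 < 2 ^ (j + 1) := by rw [pow_succ]; omega
        have ha := hgap _ h1
        have h2 := (hy l (by omega)).2.1
        have h3 := (hy (l + 1) hl).1
        have h4 : 2 * (l + 1) = 2 * l + 1 + 1 := by ring
        rw [h4] at h3
        linarith)
      i (by omega)
    exact ⟨ξ, hξ, by rw [pow_succ, mul_assoc]; exact hξ2⟩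

theorem abs_le_of_iterated_deriv {p q M ε K : ℝ} (hpq : 1 ≤ M * (q - p)) (hM : 0 < M)
    (hε : 0 ≤ ε) (j : ℕ) (D : ℕ → ℝ → ℝ)
    (hc : ∀ i ≤ j, ContinuousOn (D i) (Icc p q))
    (hd : ∀ i < j, ∀ y ∈ Ioo p q, HasDerivAt (D i) (D (i + 1) y) y)
    (hξ : ∀ i ≤ j, ∃ ξ ∈ Icc p q, |D i ξ| ≤ M ^ i * ε)
    (hK : ∀ x ∈ Icc p q, |D j x| ≤ K * M ^ j * ε) :
    ∀ x ∈ Icc p q, |D 0 x| ≤ (K + j) * (M * (q - p)) ^ j * ε := by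
  have hlen : 0 < q - p := by
    by_contra! h
    nlinarith
  have main : ∀ i ≤ j, ∀ x ∈ Icc p q,
      |D (j - i) x| ≤ (K + i) * (M ^ j * (q - p) ^ i) * ε := by
    intro i
    induction i with
    | zero => intro _ x hx; simpa using hK x hx
    | succ i ih =>
      intro hi x hx
      obtain ⟨ξ, hξ1, hξ2⟩ := hξ (j - (i + 1)) (by omega)
      have hs : j - (i + 1) + 1 = j - i := by omega
      have hmv : |D (j - (i + 1)) x - D (j - (i + 1)) ξ| ≤
          (K + i) * (M ^ j * (q - p) ^ i) * ε * (q - p) := by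
        have hB : ∀ y ∈ Icc p q, |D (j - i) y| ≤ (K + i) * (M ^ j * (q - p) ^ i) * ε :=
          ih (by omega)
        have hB0 := (abs_nonneg _).trans (hB x hx)
        have gen : ∀ u ∈ Icc p q, ∀ v ∈ Icc p q, u < v →
            |D (j - (i + 1)) v - D (j - (i + 1)) u| ≤
              (K + i) * (M ^ j * (q - p) ^ i) * ε * (q - p) := by
          intro u hu v hv huv
          obtain ⟨y, hy, hyd⟩ := exists_hasDerivAt_eq_slope (D (j - (i + 1))) (D (j - i)) huv
            ((hc _ (by omega)).mono (Icc_subset_Icc hu.1 hv.2))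
            (fun y hy => hs ▸ hd (j - (i + 1)) (by omega) y
              ⟨hu.1.trans_lt hy.1, hy.2.trans_le hv.2⟩)
          rw [eq_div_iff (sub_pos.2 huv).ne'] at hyd
          rw [← hyd, abs_mul, abs_of_pos (sub_pos.2 huv)]
          exact mul_le_mul (hB y ⟨hu.1.trans hy.1.le, hy.2.le.trans hv.2⟩)
            (by linarith [hu.1, hv.2]) (sub_pos.2 huv).le hB0
        rcases lt_trichotomy x ξ with h | h | h
        · rw [abs_sub_comm]; exact gen x hx ξ hξ1 h
        · rw [h, sub_self, abs_zero]; positivity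
        · exact gen ξ hξ1 x hx h
      have hpow : M ^ (j - (i + 1)) ≤ M ^ j * (q - p) ^ (i + 1) := by
        have : M ^ j = M ^ (j - (i + 1)) * M ^ (i + 1) := by rw [← pow_add]; congr 1; omega
        rw [this, mul_assoc, ← mul_pow]
        exact le_mul_of_one_le_right (by positivity) (one_le_pow₀ hpq)
      have h3 : |D (j - (i + 1)) x| ≤ |D (j - (i + 1)) x - D (j - (i + 1)) ξ|
          + |D (j - (i + 1)) ξ| := by
        simpa using abs_add_le (D (j - (i + 1)) x - D (j - (i + 1)) ξ) (D (j - (i + 1)) ξ)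
      have h4 := mul_le_mul_of_nonneg_right hpow hε
      calc _ ≤ (K + i) * (M ^ j * (q - p) ^ i) * ε * (q - p)
            + M ^ j * (q - p) ^ (i + 1) * ε := by linarith
        _ = _ := by push_cast; ring
  intro x hx
  have := main j le_rfl x hx
  rwa [Nat.sub_self, ← mul_pow] at this

theorem volume_sublevel_le {p q G K A ε : ℝ} (hpq : p < q) (hG : 0 < G) (hA : 0 < A)
    (hε : 0 < ε) (j : ℕ) (D : ℕ → ℝ → ℝ)
    (hc : ∀ i ≤ j, ContinuousOn (D i) (Icc p q))
    (hd : ∀ i < j, ∀ y ∈ Ioo p q, HasDerivAt (D i) (D (i + 1) y) y)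
    (hlow : ∀ x ∈ Icc p q, A ≤ |D j x|) (hup : ∀ x ∈ Icc p q, |D j x| ≤ K * A)
    (hsmall : (K + j) * (2 ^ (j + 2) / G) ^ j * ε < 1)
    (hbig : ∃ y ∈ Icc p q, 1 ≤ |D 0 y|) :
    volume {x ∈ Icc p q | |D 0 x| < ε} ≤ ENNReal.ofReal (G * (q - p)) := by
  by_contra! hcon
  have hl : 0 < q - p := sub_pos.2 hpq
  set g := G * (q - p) / 2 ^ (j + 1) with hgdef
  have hg : 0 < g := by positivity
  have hK : 0 ≤ K := by
    have h1 := hlow p ⟨le_rfl, hpq.le⟩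
    have h2 := hup p ⟨le_rfl, hpq.le⟩
    by_contra! h
    nlinarith
  have hgG : 2 * g * 2 ^ j = G * (q - p) := by
    rw [hgdef, pow_succ]; field_simp
  have hG1 : G ≤ 1 := by
    by_contra! h
    have h1 : volume {x ∈ Icc p q | |D 0 x| < ε} ≤ ENNReal.ofReal (q - p) := by
      rw [← Real.volume_Icc]; exact measure_mono (sep_subset _ _)
    refine absurd (hcon.trans_le h1) (not_lt.2 (ENNReal.ofReal_le_ofReal ?_))
    nlinarith
  obtain ⟨x, hx1, hx2⟩ := exists_separated_seq hg (2 ^ j - 1) {x ∈ Icc p q | |D 0 x| < ε}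
    ⟨p, fun x hx => hx.1.1⟩ (lt_of_le_of_lt (ENNReal.ofReal_le_ofReal (by
      rw [← hgG]
      gcongr
      rw [Nat.cast_sub Nat.one_le_two_pow]; push_cast; linarith)) hcon)
  have hξ := exists_small_iterated_deriv hg j D x ε hε.le hc hd
    (fun l hl => ⟨(hx1 l (by omega)).1, (hx1 l (by omega)).2.le⟩)
    (fun l hl => hx2 l (by omega))
  obtain ⟨ξ, hξ1, hξ2⟩ := hξ j le_rfl
  have hA2 := (hlow ξ hξ1).trans hξ2
  have hM : 2 / g * (q - p) = 2 ^ (j + 2) / G := by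
    rw [hgdef]; field_simp; ring
  obtain ⟨y, hy1, hy2⟩ := hbig
  have := abs_le_of_iterated_deriv (M := 2 / g) (K := K) (by
    rw [hM, le_div_iff₀ hG]
    have : (1 : ℝ) ≤ 2 ^ (j + 2) := one_le_pow₀ (by norm_num)
    linarith) (by positivity) hε.le j D hc hd hξ
    (fun x hx => (hup x hx).trans (by rw [mul_assoc]; gcongr)) y hy1
  rw [hM] at this
  linarith

theorem half_le_volume_Icc_inter_closedBall {p q y r : ℝ} (hy : y ∈ Icc p q) (hr : 0 ≤ r)
    (hr2 : r ≤ q - p) :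
    ENNReal.ofReal r ≤ volume (Icc p q ∩ Metric.closedBall y r) := by
  rw [Real.closedBall_eq_Icc, Icc_inter_Icc, Real.volume_Icc]
  refine ENNReal.ofReal_le_ofReal ?_
  rcases le_total p (y - r) with h1 | h1 <;> rcases le_total q (y + r) with h2 | h2 <;>
    simp only [h1, h2, sup_of_le_left, sup_of_le_right, inf_of_le_left, inf_of_le_right] <;>
    linarith [hy.1, hy.2]

theorem volume_le_of_vitali {p q c : ℝ} (hc : 0 ≤ c) (T : Set ℝ) (hT : T ⊆ Icc p q) (r : ℝ → ℝ)
    (hr : ∀ x ∈ T, 0 < r x ∧ r x ≤ q - p)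
    (hloc : ∀ x ∈ T, volume (T ∩ Metric.closedBall x (r x)) ≤ ENNReal.ofReal (c * r x)) :
    volume T ≤ ENNReal.ofReal (5 * c * (q - p)) := by
  obtain ⟨U, hUT, hdisj, hcov⟩ := Vitali.exists_disjoint_subfamily_covering_enlargement_closedBall
    T (fun x => x) (fun x => r x / 5) ((q - p) / 5)
    (fun x hx => by linarith [(hr x hx).2]) 5 (by norm_num)
  have hdisj' : U.PairwiseDisjoint fun y => Icc p q ∩ Metric.closedBall y (r y / 5) :=
    hdisj.mono fun y => inter_subset_right
  have hcount : U.Countable := by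
    refine hdisj.countable_of_nonempty_interior fun y hy => ?_
    refine ⟨y, interior_mono Metric.ball_subset_closedBall ?_⟩
    rw [Metric.isOpen_ball.interior_eq]
    exact Metric.mem_ball_self (by linarith [(hr y (hUT hy)).1])
  have hsub : T ⊆ ⋃ y ∈ U, T ∩ Metric.closedBall y (r y) := by
    intro x hx
    obtain ⟨y, hy, hxy⟩ := hcov x hx
    refine mem_biUnion hy ⟨hx, ?_⟩
    have := hxy (Metric.mem_closedBall_self (by linarith [(hr x hx).1]))
    simpa [mul_div_cancel₀] using this
  calc volume T ≤ volume (⋃ y ∈ U, T ∩ Metric.closedBall y (r y)) := measure_mono hsub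
    _ ≤ ∑' y : U, volume (T ∩ Metric.closedBall (y : ℝ) (r y)) := measure_biUnion_le _ hcount _
    _ ≤ ∑' y : U, ENNReal.ofReal (5 * c) *
          volume (Icc p q ∩ Metric.closedBall (y : ℝ) (r y / 5)) := by
        refine ENNReal.tsum_le_tsum fun y => ?_
        have hy := hr y (hUT y.2)
        refine (hloc y (hUT y.2)).trans ?_
        calc ENNReal.ofReal (c * r y) = ENNReal.ofReal (5 * c) * ENNReal.ofReal (r y / 5) := by
              rw [← ENNReal.ofReal_mul (by positivity)]; congr 1; ring
          _ ≤ _ := by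
              gcongr
              exact half_le_volume_Icc_inter_closedBall (hT (hUT y.2)) (by linarith) (by linarith)
    _ = ENNReal.ofReal (5 * c) *
          volume (⋃ y ∈ U, Icc p q ∩ Metric.closedBall y (r y / 5)) := by
        rw [ENNReal.tsum_mul_left, measure_biUnion hcount hdisj'
          (fun y _ => measurableSet_Icc.inter Metric.isClosed_closedBall.measurableSet)]
    _ ≤ ENNReal.ofReal (5 * c) * volume (Icc p q) := by
        gcongr
        exact iUnion₂_subset fun y _ => inter_subset_left
    _ = _ := by
        rw [Real.volume_Icc, ← ENNReal.ofReal_mul (by positivity)]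

/-- The constant in `volume_short_vectors_le`. -/
def nondivergenceConst : ℕ → ℝ
  | 0 => 0
  | k + 1 => 20 * (1 + nondivergenceConst k)

theorem nondivergenceConst_nonneg (k : ℕ) : 0 ≤ nondivergenceConst k := by
  induction k with
  | zero => exact le_rfl
  | succ k ih => rw [nondivergenceConst]; linarith

theorem exists_maximal_radius {S : Type*} (C : S → Prop) (ψ : S → ℝ → ℝ) {p q x : ℝ}
    (hx : x ∈ Icc p q) (hcont : ∀ s, C s → ContinuousOn (ψ s) (Icc p q))
    (hbig : ∀ s, C s → ∃ y ∈ Icc p q, 1 ≤ ψ s y) (hsmall : ∃ s, C s ∧ ψ s x < 1) :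
    ∃ r, 0 < r ∧ r ≤ q - p ∧ (∃ s, C s ∧ ∀ y ∈ Icc p q ∩ Metric.closedBall x r, ψ s y < 1) ∧
      ∀ s, C s → ∃ y ∈ Icc p q ∩ Metric.closedBall x (2 * r), 1 ≤ ψ s y := by
  set R : ℝ → Prop := fun r =>
    ∃ s, C s ∧ ∀ y ∈ Icc p q ∩ Metric.closedBall x r, ψ s y < 1 with hR
  have hbd : ∀ r, R r → r ≤ q - p := by
    rintro r ⟨s, hs, h⟩
    by_contra! hr
    obtain ⟨y, hy, hy1⟩ := hbig s hs
    refine absurd (h y ⟨hy, ?_⟩) (not_lt.2 hy1)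
    rw [Metric.mem_closedBall, Real.dist_eq, abs_le]
    constructor <;> linarith [hx.1, hx.2, hy.1, hy.2]
  obtain ⟨r0, hr0, hRr0⟩ : ∃ r, 0 < r ∧ R r := by
    obtain ⟨s, hs, hsx⟩ := hsmall
    have := (hcont s hs x hx).eventually (gt_mem_nhds hsx)
    rw [Filter.Eventually, Metric.mem_nhdsWithin_iff] at this
    obtain ⟨e, he, hsub⟩ := this
    refine ⟨e / 2, by linarith, s, hs, fun y hy => hsub ⟨?_, hy.1⟩⟩
    exact Metric.closedBall_subset_ball (by linarith) hy.2
  have hex : ∃ k : ℕ, ¬ R (2 ^ k * r0) := by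
    obtain ⟨k, hk⟩ := pow_unbounded_of_one_lt ((q - p) / r0) (by norm_num : (1 : ℝ) < 2)
    refine ⟨k, fun h => absurd (hbd _ h) (not_le.2 ?_)⟩
    rwa [div_lt_iff₀ hr0] at hk
  classical
  have h0 : Nat.find hex ≠ 0 := by
    intro h
    have := Nat.find_spec hex
    rw [h] at this
    simp [hRr0] at this
  obtain ⟨k, hk⟩ := Nat.exists_eq_succ_of_ne_zero h0
  have h1 : R (2 ^ k * r0) := by
    by_contra h
    have := Nat.find_min' hex h
    omega
  have h2 : ¬ R (2 ^ (k + 1) * r0) := by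
    have := Nat.find_spec hex
    rwa [hk] at this
  refine ⟨2 ^ k * r0, by positivity, hbd _ h1, h1, fun s hs => ?_⟩
  by_contra! hcon
  refine h2 ⟨s, hs, fun y hy => hcon y ⟨hy.1, ?_⟩⟩
  rw [pow_succ', mul_assoc] at hy
  exact hy.2

/-- Quantitative nondivergence for a family of functions indexed by a poset of finite height. -/
theorem volume_short_vectors_le {S : Type*} [PartialOrder S] (L : ℕ) (rk : S → ℕ)
    (hrk : StrictMono rk) (hrkL : ∀ s, rk s < L) (ψ : S → ℝ → ℝ) {u v ε G : ℝ} (hG : 0 ≤ G)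
    (hcont : ∀ s, ContinuousOn (ψ s) (Icc u v))
    (hgood : ∀ s p q, u ≤ p → q ≤ v → p < q → (∃ y ∈ Icc p q, 1 ≤ ψ s y) →
      volume {x ∈ Icc p q | ψ s x < ε} ≤ ENNReal.ofReal (G * (q - p)))
    (X : Set ℝ)
    (hleaf : ∀ x ∈ Icc u v, ∀ F : Finset S, (∀ s ∈ F, ∀ t ∈ F, s ≤ t ∨ t ≤ s) →
      (∀ s ∈ F, ε ≤ ψ s x ∧ ψ s x ≤ 1) →
      (∀ t, t ∉ F → (∀ s ∈ F, s ≤ t ∨ t ≤ s) → 1 ≤ ψ t x) → x ∉ X)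
    (hbig : ∀ s, ∃ y ∈ Icc u v, 1 ≤ ψ s y) :
    volume (X ∩ Icc u v) ≤ ENNReal.ofReal (nondivergenceConst L * G * (v - u)) := by
  classical
  have main : ∀ k : ℕ, ∀ F : Finset S, (∀ s ∈ F, ∀ t ∈ F, s ≤ t ∨ t ≤ s) → L ≤ F.card + k →
      ∀ p q, u ≤ p → q ≤ v →
      (∀ t, t ∉ F → (∀ s ∈ F, s ≤ t ∨ t ≤ s) → ∃ y ∈ Icc p q, 1 ≤ ψ t y) →
      volume {x ∈ Icc p q | x ∈ X ∧ ∀ s ∈ F, ε ≤ ψ s x ∧ ψ s x ≤ 1} ≤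
        ENNReal.ofReal (nondivergenceConst k * G * (q - p)) := by
    intro k
    induction k with
    | zero =>
      intro F hF hcard p q hp hq hb
      refine le_of_eq_of_le ?_ zero_le
      convert measure_empty (μ := volume)
      rw [eq_empty_iff_forall_notMem]
      rintro x ⟨hx, hxX, hxF⟩
      refine hleaf x ⟨hp.trans hx.1, hx.2.trans hq⟩ F hF hxF (fun t ht hcomp => ?_) hxX
      exfalso
      have hinj : Set.InjOn rk (insert t F : Finset S) := by
        have hch : ∀ s ∈ insert t F, ∀ s' ∈ insert t F, s ≤ s' ∨ s' ≤ s := by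
          intro s hs s' hs'
          rw [Finset.mem_insert] at hs hs'
          rcases hs with rfl | hs <;> rcases hs' with rfl | hs'
          · exact Or.inl le_rfl
          · exact (hcomp s' hs').symm
          · exact hcomp s hs
          · exact hF s hs s' hs'
        intro s hs s' hs' h
        rcases hch s hs s' hs' with h1 | h1
        · exact (h1.eq_or_lt).resolve_right fun h2 => (hrk h2).ne h
        · exact ((h1.eq_or_lt).resolve_right fun h2 => (hrk h2).ne' h).symm
      have h1 := Finset.card_image_of_injOn hinj
      have h2 : (insert t F).image rk ⊆ Finset.range L := by
        intro m hm
        obtain ⟨s, _, rfl⟩ := Finset.mem_image.1 hm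
        exact Finset.mem_range.2 (hrkL s)
      have h3 := Finset.card_le_card h2
      rw [h1, Finset.card_insert_of_notMem ht, Finset.card_range] at h3
      omega
    | succ k ih =>
      intro F hF hcard p q hp hq hb
      set T := {x ∈ Icc p q | x ∈ X ∧ ∀ s ∈ F, ε ≤ ψ s x ∧ ψ s x ≤ 1} with hT
      set C : S → Prop := fun t => t ∉ F ∧ ∀ s ∈ F, s ≤ t ∨ t ≤ s with hC
      have hrad : ∀ x, ∃ r, x ∈ T → 0 < r ∧ r ≤ q - p ∧
          (∃ s, C s ∧ ∀ y ∈ Icc p q ∩ Metric.closedBall x r, ψ s y < 1) ∧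
          ∀ s, C s → ∃ y ∈ Icc p q ∩ Metric.closedBall x (2 * r), 1 ≤ ψ s y := by
        intro x
        by_cases hx : x ∈ T
        · obtain ⟨r, hr⟩ := exists_maximal_radius C ψ hx.1
            (fun s _ => (hcont s).mono (Icc_subset_Icc hp hq)) (fun s hs => hb s hs.1 hs.2) (by
              by_contra! hcon
              exact hleaf x ⟨hp.trans hx.1.1, hx.1.2.trans hq⟩ F hF hx.2.2
                (fun t ht hc => hcon t ⟨ht, hc⟩) hx.2.1)
          exact ⟨r, fun _ => hr⟩
        · exact ⟨0, fun h => absurd h hx⟩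
      choose r hr using hrad
      have hK := nondivergenceConst_nonneg k
      have := volume_le_of_vitali (p := p) (q := q) (c := 4 * (1 + nondivergenceConst k) * G)
        (by positivity) T (fun x hx => hx.1) r (fun x hx => ⟨(hr x hx).1, (hr x hx).2.1⟩) ?_
      · refine this.trans (ENNReal.ofReal_le_ofReal (le_of_eq ?_))
        rw [nondivergenceConst]; ring
      intro x hx
      obtain ⟨hr0, hr1, ⟨t, ⟨htF, htc⟩, ht⟩, hall⟩ := hr x hx
      set p' := max p (x - 2 * r x)
      set q' := min q (x + 2 * r x)
      have hIcc : Icc p q ∩ Metric.closedBall x (2 * r x) = Icc p' q' := by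
        rw [Real.closedBall_eq_Icc, Icc_inter_Icc]
      have hpq' : p' < q' := by
        have h1 := hx.1.1
        have h2 := hx.1.2
        refine max_lt (lt_min (by linarith) (by linarith)) (lt_min (by linarith) (by linarith))
      have hlen : q' - p' ≤ 4 * r x := by
        have h1 : x - 2 * r x ≤ p' := le_max_right _ _
        have h2 : q' ≤ x + 2 * r x := min_le_right _ _
        linarith
      have hup : u ≤ p' := hp.trans (le_max_left _ _)
      have hqv : q' ≤ v := (min_le_left _ _).trans hq
      have hsub : T ∩ Metric.closedBall x (r x) ⊆ {y ∈ Icc p' q' | ψ t y < ε} ∪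
          {y ∈ Icc p' q' | y ∈ X ∧ ∀ s ∈ insert t F, ε ≤ ψ s y ∧ ψ s y ≤ 1} := by
        rintro y ⟨hy, hyb⟩
        have hy' : y ∈ Icc p' q' := by
          rw [← hIcc]
          exact ⟨hy.1, Metric.closedBall_subset_closedBall (by linarith) hyb⟩
        rcases lt_or_ge (ψ t y) ε with h | h
        · exact Or.inl ⟨hy', h⟩
        · refine Or.inr ⟨hy', hy.2.1, fun s hs => ?_⟩
          rcases Finset.mem_insert.1 hs with rfl | hs
          · exact ⟨h, (ht y ⟨hy.1, hyb⟩).le⟩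
          · exact hy.2.2 s hs
      have h1 := hgood t p' q' hup hqv hpq' (hIcc ▸ hall t ⟨htF, htc⟩)
      have h2 := ih (insert t F) (by
          intro s hs s' hs'
          rw [Finset.mem_insert] at hs hs'
          rcases hs with rfl | hs <;> rcases hs' with rfl | hs'
          · exact Or.inl le_rfl
          · exact (htc s' hs').symm
          · exact htc s hs
          · exact hF s hs s' hs')
        (by rw [Finset.card_insert_of_notMem htF]; omega) p' q' hup hqv
        (fun s hs hsc => hIcc ▸ hall s ⟨fun h => hs (Finset.mem_insert_of_mem h),
          fun s' hs' => hsc s' (Finset.mem_insert_of_mem hs')⟩)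
      refine (measure_mono hsub).trans ((measure_union_le _ _).trans ((add_le_add h1 h2).trans ?_))
      have hl0 : 0 ≤ q' - p' := by linarith
      rw [← ENNReal.ofReal_add (by positivity) (by positivity)]
      refine ENNReal.ofReal_le_ofReal ?_
      have : 0 ≤ (1 + nondivergenceConst k) * G := by positivity
      nlinarith [mul_le_mul_of_nonneg_left hlen this]
  have := main L ∅ (by simp) (by simp) u v le_rfl le_rfl (fun t _ _ => hbig t)
  refine le_trans (measure_mono ?_) this
  rintro x ⟨hx, hxI⟩
  exact ⟨hxI, hx, by simp⟩

theorem exists_minor_ne_zero {K : Type*} [Field K] {k d : ℕ} (A : Matrix (Fin k) (Fin d) K)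
    (hA : LinearIndependent K A.row) :
    ∃ e : Fin k → Fin d, (A.submatrix id e).det ≠ 0 := by
  have hr : Module.finrank K (Submodule.span K (range A.col)) = k := by
    rw [← Matrix.rank_eq_finrank_span_cols, hA.rank_matrix, Fintype.card_fin]
  obtain ⟨f, hf1, -, hf3⟩ := Submodule.exists_fun_fin_finrank_span_eq K (range A.col)
  generalize Module.finrank K (Submodule.span K (range A.col)) = m at hr f
  subst hr
  choose e he using hf1
  refine ⟨e, ?_⟩
  have hcol : (A.submatrix id e).col = f := by
    ext i j
    rw [← he]; rfl
  rw [← hcol] at hf3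
  exact ((Matrix.isUnit_iff_isUnit_det _).1
    (Matrix.linearIndependent_cols_iff_isUnit.1 hf3)).ne_zero

/-- The matrix sending an integer vector `(b, a)` to `(Qⁿ (b + a · f(x)), a / Q)`, where `φ` is
`(1, f(x))`. -/
noncomputable def flowMatrix {n : ℕ} (Q : ℝ) (φ : Fin (n + 1) → ℝ) :
    Matrix (Fin (n + 1)) (Fin (n + 1)) ℝ :=
  Matrix.of fun r c => if r = 0 then Q ^ n * φ c else if r = c then Q⁻¹ else 0

theorem flowMatrix_mulVec_zero {n : ℕ} (Q : ℝ) (φ v : Fin (n + 1) → ℝ) :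
    (flowMatrix Q φ).mulVec v 0 = Q ^ n * ∑ c, φ c * v c := by
  simp [Matrix.mulVec, dotProduct, flowMatrix, Finset.mul_sum, mul_assoc]

theorem flowMatrix_mulVec_ne_zero {n : ℕ} (Q : ℝ) (φ v : Fin (n + 1) → ℝ) {r : Fin (n + 1)}
    (hr : r ≠ 0) : (flowMatrix Q φ).mulVec v r = Q⁻¹ * v r := by
  simp [Matrix.mulVec, dotProduct, flowMatrix, hr]

/-- Minor of the images under `flowMatrix` of the rows of `W`. -/
noncomputable def flowMinor {n k : ℕ} (Q : ℝ) (φ : Fin (n + 1) → ℝ)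
    (W : Matrix (Fin k) (Fin (n + 1)) ℝ) (e : Fin k → Fin (n + 1)) : ℝ :=
  ((W * (flowMatrix Q φ).transpose).submatrix id e).det

/-- Largest minor of the images under `flowMatrix` of the rows of `W`. -/
noncomputable def flowNorm {n k : ℕ} (Q : ℝ) (φ : Fin (n + 1) → ℝ)
    (W : Matrix (Fin k) (Fin (n + 1)) ℝ) : ℝ :=
  ‖fun e => flowMinor Q φ W e‖

theorem mul_flowMatrix_transpose {n k : ℕ} (Q : ℝ) (φ : Fin (n + 1) → ℝ)
    (W : Matrix (Fin k) (Fin (n + 1)) ℝ) (i : Fin k) :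
    (W * (flowMatrix Q φ).transpose) i = (flowMatrix Q φ).mulVec (W i) := by
  ext r
  simp [Matrix.mul_apply, Matrix.mulVec, dotProduct, mul_comm]

theorem flowMinor_mul {n k : ℕ} (Q : ℝ) (φ : Fin (n + 1) → ℝ) (T : Matrix (Fin k) (Fin k) ℝ)
    (W : Matrix (Fin k) (Fin (n + 1)) ℝ) (e : Fin k → Fin (n + 1)) :
    flowMinor Q φ (T * W) e = T.det * flowMinor Q φ W e := by
  rw [flowMinor, flowMinor, Matrix.mul_assoc, ← Matrix.det_mul]
  rfl

theorem flowNorm_mul {n k : ℕ} (Q : ℝ) (φ : Fin (n + 1) → ℝ) (T : Matrix (Fin k) (Fin k) ℝ)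
    (W : Matrix (Fin k) (Fin (n + 1)) ℝ) :
    flowNorm Q φ (T * W) = |T.det| * flowNorm Q φ W := by
  have : (fun e => flowMinor Q φ (T * W) e) = T.det • fun e => flowMinor Q φ W e :=
    funext fun e => flowMinor_mul Q φ T W e
  rw [flowNorm, this, norm_smul, Real.norm_eq_abs, flowNorm]

theorem flowNorm_fin_zero {n : ℕ} (Q : ℝ) (φ : Fin (n + 1) → ℝ)
    (W : Matrix (Fin 0) (Fin (n + 1)) ℝ) : flowNorm Q φ W = 1 := by
  simp [flowNorm, flowMinor]

theorem flowNorm_cons_le {n k : ℕ} (Q : ℝ) (φ : Fin (n + 1) → ℝ)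
    (W : Matrix (Fin k) (Fin (n + 1)) ℝ) (v : Fin (n + 1) → ℝ) :
    flowNorm Q φ (Matrix.of (Matrix.vecCons v W)) ≤
      (k + 1) * (flowNorm Q φ W * ‖(flowMatrix Q φ).mulVec v‖) := by
  have h0 : 0 ≤ flowNorm Q φ W := norm_nonneg _
  rw [flowNorm, pi_norm_le_iff_of_nonneg (by positivity)]
  intro e
  rw [flowMinor, Matrix.det_succ_row_zero]
  refine (norm_sum_le _ _).trans ?_
  have : ∀ j : Fin (k + 1), ‖(-1 : ℝ) ^ (j : ℕ) *
      (Matrix.of (Matrix.vecCons v W) * (flowMatrix Q φ).transpose).submatrix id e 0 j *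
      (((Matrix.of (Matrix.vecCons v W) * (flowMatrix Q φ).transpose).submatrix id e).submatrix
        Fin.succ j.succAbove).det‖ ≤ flowNorm Q φ W * ‖(flowMatrix Q φ).mulVec v‖ := by
    intro j
    rw [norm_mul, norm_mul, norm_pow, norm_neg, norm_one, one_pow, one_mul, mul_comm]
    refine mul_le_mul ?_ ?_ (norm_nonneg _) h0
    · exact norm_le_pi_norm (fun e => flowMinor Q φ W e) (fun i => e (j.succAbove i))
    · rw [Matrix.submatrix_apply, id, mul_flowMatrix_transpose]
      exact norm_le_pi_norm ((flowMatrix Q φ).mulVec v) (e j)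
  refine (Finset.sum_le_sum fun j _ => this j).trans ?_
  simp

theorem flowMinor_eq_zero {n k : ℕ} (Q : ℝ) (φ : Fin (n + 1) → ℝ)
    (W : Matrix (Fin k) (Fin (n + 1)) ℝ) (e : Fin k → Fin (n + 1))
    (he : ¬ Function.Injective e) : flowMinor Q φ W e = 0 := by
  rw [Function.not_injective_iff] at he
  obtain ⟨i, j, hij, hne⟩ := he
  exact Matrix.det_zero_of_column_eq hne fun r => by simp [hij]

theorem flowMinor_of_ne_zero {n k : ℕ} (Q : ℝ) (φ : Fin (n + 1) → ℝ)
    (W : Matrix (Fin k) (Fin (n + 1)) ℝ) (e : Fin k → Fin (n + 1)) (he : ∀ j, e j ≠ 0) :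
    flowMinor Q φ W e = Q⁻¹ ^ k * (W.submatrix id e).det := by
  have : (W * (flowMatrix Q φ).transpose).submatrix id e = Q⁻¹ • W.submatrix id e := by
    ext i j
    rw [Matrix.submatrix_apply, id, mul_flowMatrix_transpose,
      flowMatrix_mulVec_ne_zero _ _ _ (he j)]
    rfl
  rw [flowMinor, this, Matrix.det_smul, Fintype.card_fin]

theorem flowMinor_of_eq_zero {n k : ℕ} (Q : ℝ) (φ : Fin (n + 1) → ℝ)
    (W : Matrix (Fin k) (Fin (n + 1)) ℝ) (e : Fin k → Fin (n + 1)) (he : Function.Injective e)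
    (j₀ : Fin k) (h0 : e j₀ = 0) :
    flowMinor Q φ W e = Q ^ n * Q⁻¹ ^ (k - 1) *
      ∑ c, φ c * (W.submatrix id (Function.update e j₀ c)).det := by
  have h1 : (W * (flowMatrix Q φ).transpose).submatrix id e =
      Matrix.of fun i j => (if j = j₀ then Q ^ n else Q⁻¹) *
        (W.submatrix id e).updateCol j₀ (∑ c, φ c • W.col c) i j := by
    ext i j
    rw [Matrix.submatrix_apply, id, mul_flowMatrix_transpose, Matrix.of_apply]
    by_cases hj : j = j₀
    · subst hj
      rw [h0, flowMatrix_mulVec_zero, if_pos rfl, Matrix.updateCol_self]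
      simp
    · have : e j ≠ 0 := fun h => hj (he (h.trans h0.symm))
      rw [flowMatrix_mulVec_ne_zero _ _ _ this, if_neg hj, Matrix.updateCol_ne hj]
      rfl
  rw [flowMinor, h1, Matrix.det_mul_row]
  congr 1
  · rw [Finset.prod_ite, Finset.prod_const, Finset.prod_const, Finset.filter_eq' Finset.univ j₀,
      Finset.filter_ne' Finset.univ j₀]
    simp
  · rw [← Matrix.cramer_apply, map_sum, Finset.sum_apply]
    refine Finset.sum_congr rfl fun c _ => ?_
    rw [map_smul, Pi.smul_apply, smul_eq_mul, Matrix.cramer_apply]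
    congr 2
    ext i j
    by_cases hj : j = j₀
    · subst hj; simp
    · simp [Matrix.updateCol_ne hj, Function.update_of_ne hj]

theorem exists_flowMinor_eq_sum {n k : ℕ} (Q : ℝ) (W : Matrix (Fin k) (Fin (n + 1)) ℝ)
    (e : Fin k → Fin (n + 1)) :
    ∃ c : Fin (n + 1) → ℝ, ∀ φ : Fin (n + 1) → ℝ, φ 0 = 1 →
      flowMinor Q φ W e = ∑ i, c i * φ i := by
  by_cases he : Function.Injective e
  · by_cases h : ∃ j₀, e j₀ = 0
    · obtain ⟨j₀, hj⟩ := h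
      refine ⟨fun c => Q ^ n * Q⁻¹ ^ (k - 1) *
        (W.submatrix id (Function.update e j₀ c)).det, fun φ _ => ?_⟩
      rw [flowMinor_of_eq_zero Q φ W e he j₀ hj, Finset.mul_sum]
      exact Finset.sum_congr rfl fun c _ => by ring
    · push Not at h
      refine ⟨Pi.single 0 (Q⁻¹ ^ k * (W.submatrix id e).det), fun φ hφ => ?_⟩
      rw [flowMinor_of_ne_zero Q φ W e h]
      simp [Pi.single_apply, hφ]
  · exact ⟨0, fun φ _ => by simp [flowMinor_eq_zero Q φ W e he]⟩

/-- The minors of a tuple of linearly independent integer vectors control an integral linear form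
with a gain of a power of `Q`, unless the tuple spans everything. -/
theorem exists_flowMinor_integral {n k : ℕ} (hk : 0 < k) {Q : ℝ} (hQ : 0 < Q)
    (w : Matrix (Fin k) (Fin (n + 1)) ℤ)
    (hw : LinearIndependent ℚ (w.map (Int.cast : ℤ → ℚ)).row) :
    (∃ e : Fin k → Fin (n + 1), ∃ m : Fin (n + 1) → ℤ, m ≠ 0 ∧ ∃ p : ℕ, 1 ≤ p ∧
      ∀ φ : Fin (n + 1) → ℝ, flowMinor Q φ (w.map (Int.cast : ℤ → ℝ)) e =
        Q ^ p * ∑ i, m i * φ i) ∨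
    ∃ e : Fin k → Fin (n + 1), ∃ m : ℤ, m ≠ 0 ∧
      ∀ φ : Fin (n + 1) → ℝ, flowMinor Q φ (w.map (Int.cast : ℤ → ℝ)) e = m * φ 0 := by
  obtain ⟨e, he⟩ := exists_minor_ne_zero _ hw
  have hcastQ : ∀ e : Fin k → Fin (n + 1), ((w.map (Int.cast : ℤ → ℚ)).submatrix id e).det =
      ((w.submatrix id e).det : ℤ) := fun e => ((Int.castRingHom ℚ).map_det _).symm
  have hcastR : ∀ e : Fin k → Fin (n + 1), ((w.map (Int.cast : ℤ → ℝ)).submatrix id e).det =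
      ((w.submatrix id e).det : ℤ) := fun e => ((Int.castRingHom ℝ).map_det _).symm
  have hz : ∀ e : Fin k → Fin (n + 1), ¬ Function.Injective e → (w.submatrix id e).det = 0 := by
    intro e he
    rw [Function.not_injective_iff] at he
    obtain ⟨i, j, hij, hne⟩ := he
    exact Matrix.det_zero_of_column_eq hne fun r => by simp [hij]
  have he' : (w.submatrix id e).det ≠ 0 := by
    rw [hcastQ] at he; exact_mod_cast he
  have hinj : Function.Injective e := by
    by_contra h; exact he' (hz e h)
  have hkn : k ≤ n + 1 := by simpa using Fintype.card_le_of_injective e hinj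
  have hpow : ∀ p : ℕ, p ≤ n → Q ^ n * Q⁻¹ ^ p = Q ^ (n - p) := by
    intro p hp
    rw [inv_pow, pow_sub₀ _ hQ.ne' hp]
  rcases hkn.lt_or_eq with hlt | rfl
  · left
    obtain ⟨e₁, he₁, j₀, hj₀, c, hc⟩ : ∃ e₁ : Fin k → Fin (n + 1), Function.Injective e₁ ∧
        ∃ j₀, e₁ j₀ = 0 ∧ ∃ c, (w.submatrix id (Function.update e₁ j₀ c)).det ≠ 0 := by
      by_cases h : ∃ j₀, e j₀ = 0
      · obtain ⟨j₀, hj⟩ := h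
        exact ⟨e, hinj, j₀, hj, e j₀, by rwa [Function.update_eq_self]⟩
      · push Not at h
        refine ⟨Function.update e ⟨0, hk⟩ 0, ?_, ⟨0, hk⟩, by simp, e ⟨0, hk⟩, ?_⟩
        · intro i j hij
          by_cases hi : i = ⟨0, hk⟩ <;> by_cases hj : j = ⟨0, hk⟩
          · rw [hi, hj]
          · subst hi
            rw [Function.update_self, Function.update_of_ne hj] at hij
            exact absurd hij.symm (h j)
          · subst hj
            rw [Function.update_self, Function.update_of_ne hi] at hij
            exact absurd hij (h i)
          · rw [Function.update_of_ne hi, Function.update_of_ne hj] at hij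
            exact hinj hij
        · rwa [Function.update_idem, Function.update_eq_self]
    refine ⟨e₁, fun c => (w.submatrix id (Function.update e₁ j₀ c)).det,
      fun h => hc (congrFun h c), n - (k - 1), by omega, fun φ => ?_⟩
    rw [flowMinor_of_eq_zero Q φ _ e₁ he₁ j₀ hj₀, hpow _ (by omega)]
    congr 1
    exact Finset.sum_congr rfl fun c _ => by rw [hcastR, mul_comm]
  · right
    have hsurj := (Finite.injective_iff_surjective.1 hinj)
    obtain ⟨j₀, hj₀⟩ := hsurj 0
    refine ⟨e, (w.submatrix id e).det, he', fun φ => ?_⟩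
    rw [flowMinor_of_eq_zero Q φ _ e hinj j₀ hj₀, hpow _ (by omega), Nat.add_sub_cancel,
      Nat.sub_self, pow_zero, one_mul, Finset.sum_eq_single 0]
    · rw [hcastR, ← hj₀, Function.update_eq_self, mul_comm]
    · intro c _ hc
      obtain ⟨j, rfl⟩ := hsurj c
      rw [hcastR, hz, Int.cast_zero, mul_zero]
      intro h
      have hne : j ≠ j₀ := fun h => hc (h ▸ hj₀)
      exact hne (h (by simp [Function.update_of_ne hne]))
    · simp

theorem exists_int_tuple {d : ℕ} (V : Submodule ℚ (Fin d → ℚ)) :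
    ∃ w : Matrix (Fin (Module.finrank ℚ V)) (Fin d) ℤ,
      LinearIndependent ℚ (w.map (Int.cast : ℤ → ℚ)).row ∧
        ∀ i, (w.map (Int.cast : ℤ → ℚ)).row i ∈ V := by
  have B := Module.finBasis ℚ V
  have h1 := fun i => IsLocalization.exist_integer_multiples_of_finite (nonZeroDivisors ℤ)
    ((B i : Fin d → ℚ))
  choose N hN using h1
  choose z hz using hN
  have hrow : (Matrix.map (Matrix.of z) (Int.cast : ℤ → ℚ)).row =
      fun i => ((N i : ℤ) : ℚ) • (B i : Fin d → ℚ) := by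
    funext i
    ext j
    have := hz i j
    simp only [algebraMap_int_eq, eq_intCast] at this
    simp [Matrix.row, this]
  have hN0 : ∀ i, ((N i : ℤ) : ℚ) ≠ 0 := fun i =>
    Int.cast_ne_zero.2 (nonZeroDivisors.coe_ne_zero (N i))
  refine ⟨Matrix.of z, ?_, fun i => ?_⟩
  · rw [hrow]
    have hB : LinearIndependent ℚ fun i => (B i : Fin d → ℚ) :=
      B.linearIndependent.map' V.subtype (Submodule.ker_subtype V)
    exact hB.units_smul fun i => Units.mk0 _ (hN0 i)
  · rw [hrow]
    exact V.smul_mem _ (B i).2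

theorem exists_min_int_tuple {n : ℕ} (V : Submodule ℚ (Fin (n + 1) → ℚ)) :
    ∃ w : Matrix (Fin (Module.finrank ℚ V)) (Fin (n + 1)) ℤ,
      LinearIndependent ℚ (w.map (Int.cast : ℤ → ℚ)).row ∧
      (∀ i, (w.map (Int.cast : ℤ → ℚ)).row i ∈ V) ∧
      ∀ w' : Matrix (Fin (Module.finrank ℚ V)) (Fin (n + 1)) ℤ,
        LinearIndependent ℚ (w'.map (Int.cast : ℤ → ℚ)).row →
        (∀ i, (w'.map (Int.cast : ℤ → ℚ)).row i ∈ V) →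
        ∀ (Q : ℝ) (φ : Fin (n + 1) → ℝ), flowNorm Q φ (w.map (Int.cast : ℤ → ℝ)) ≤
          flowNorm Q φ (w'.map (Int.cast : ℤ → ℝ)) := by
  let H : Matrix (Fin (Module.finrank ℚ V)) (Fin (n + 1)) ℤ → ℕ := fun w =>
    ∑ e : Fin (Module.finrank ℚ V) → Fin (n + 1), (w.submatrix id e).det.natAbs
  obtain ⟨w₀, hw₀⟩ := exists_int_tuple V
  obtain ⟨w, ⟨hw1, hw2⟩, hmin⟩ := exists_minimalFor_of_wellFoundedLT
    (fun w : Matrix (Fin (Module.finrank ℚ V)) (Fin (n + 1)) ℤ =>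
      LinearIndependent ℚ (w.map (Int.cast : ℤ → ℚ)).row ∧
        ∀ i, (w.map (Int.cast : ℤ → ℚ)).row i ∈ V) H ⟨w₀, hw₀⟩
  refine ⟨w, hw1, hw2, fun w' hw'1 hw'2 Q φ => ?_⟩
  have hspan : Submodule.span ℚ (range (w.map (Int.cast : ℤ → ℚ)).row) = V := by
    refine Submodule.eq_of_le_of_finrank_eq (Submodule.span_le.2 ?_) ?_
    · rintro _ ⟨i, rfl⟩; exact hw2 i
    · rw [finrank_span_eq_card hw1, Fintype.card_fin]
  have hT : ∀ i, ∃ c : Fin (Module.finrank ℚ V) → ℚ,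
      ∑ j, c j • (w.map (Int.cast : ℤ → ℚ)).row j = (w'.map (Int.cast : ℤ → ℚ)).row i := by
    intro i
    rw [← Submodule.mem_span_range_iff_exists_fun, hspan]
    exact hw'2 i
  choose T hT using hT
  have hTQ : w'.map (Int.cast : ℤ → ℚ) = Matrix.of T * w.map (Int.cast : ℤ → ℚ) := by
    ext i j
    have := congrFun (hT i) j
    simp only [Finset.sum_apply, Pi.smul_apply, smul_eq_mul, Matrix.row] at this
    rw [Matrix.mul_apply, ← this]
    rfl
  have hTR : w'.map (Int.cast : ℤ → ℝ) =
      (Matrix.of T).map (Rat.cast : ℚ → ℝ) * w.map (Int.cast : ℤ → ℝ) := by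
    have := congrArg (fun M => Matrix.map M (Rat.castHom ℝ)) hTQ
    simp only [Matrix.map_mul, Matrix.map_map] at this
    convert this using 2 <;> ext <;> simp
  have hcastQ : ∀ (w : Matrix (Fin (Module.finrank ℚ V)) (Fin (n + 1)) ℤ)
      (e : Fin (Module.finrank ℚ V) → Fin (n + 1)),
      ((w.map (Int.cast : ℤ → ℚ)).submatrix id e).det =
      ((w.submatrix id e).det : ℤ) := fun w e => ((Int.castRingHom ℚ).map_det _).symm
  have hminor : ∀ e : Fin (Module.finrank ℚ V) → Fin (n + 1),
      (((w'.submatrix id e).det.natAbs : ℕ) : ℚ) =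
        |(Matrix.of T).det| * ((w.submatrix id e).det.natAbs : ℕ) := by
    intro e
    rw [Nat.cast_natAbs, Nat.cast_natAbs, Int.cast_abs, Int.cast_abs, ← hcastQ, ← hcastQ, hTQ,
      ← abs_mul, ← Matrix.det_mul]
    rfl
  have hH : (H w' : ℚ) = |(Matrix.of T).det| * H w := by
    simp only [H, Nat.cast_sum, hminor, Finset.mul_sum]
  have hpos : (0 : ℚ) < H w := by
    obtain ⟨e, he⟩ := exists_minor_ne_zero _ hw1
    rw [hcastQ, Int.cast_ne_zero] at he
    have : 0 < H w := Finset.sum_pos' (fun _ _ => Nat.zero_le _)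
      ⟨e, Finset.mem_univ _, Int.natAbs_pos.2 he⟩
    exact_mod_cast this
  have hle : H w ≤ H w' := by
    by_contra h
    push Not at h
    exact absurd (hmin ⟨hw'1, hw'2⟩ h.le) (not_le.2 h)
  have hdet : 1 ≤ |(Matrix.of T).det| := by
    have : (H w : ℚ) ≤ |(Matrix.of T).det| * H w := by
      rw [← hH]; exact_mod_cast hle
    by_contra h
    push Not at h
    nlinarith
  rw [hTR, flowNorm_mul]
  have h2 : ((Matrix.of T).map (Rat.cast : ℚ → ℝ)).det = ((Matrix.of T).det : ℚ) :=
    ((Rat.castHom ℝ).map_det _).symm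
  have h3 : (1 : ℝ) ≤ |((Matrix.of T).map (Rat.cast : ℚ → ℝ)).det| := by
    rw [h2]; exact_mod_cast hdet
  exact le_mul_of_one_le_left (norm_nonneg _) h3

/-- A tuple of integer vectors spanning `V`, of minimal covolume. -/
noncomputable def minTuple {n : ℕ} (V : Submodule ℚ (Fin (n + 1) → ℚ)) :
    Matrix (Fin (Module.finrank ℚ V)) (Fin (n + 1)) ℤ :=
  (exists_min_int_tuple V).choose

/-- Covolume (in the maximum norm) of the image under `flowMatrix` of the integer points of `V`. -/
noncomputable def covolume {n : ℕ} (Q : ℝ) (φ : Fin (n + 1) → ℝ)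
    (V : Submodule ℚ (Fin (n + 1) → ℚ)) : ℝ :=
  flowNorm Q φ ((minTuple V).map (Int.cast : ℤ → ℝ))

theorem linearIndependent_minTuple {n : ℕ} (V : Submodule ℚ (Fin (n + 1) → ℚ)) :
    LinearIndependent ℚ ((minTuple V).map (Int.cast : ℤ → ℚ)).row :=
  (exists_min_int_tuple V).choose_spec.1

theorem span_minTuple {n : ℕ} (V : Submodule ℚ (Fin (n + 1) → ℚ)) :
    Submodule.span ℚ (range ((minTuple V).map (Int.cast : ℤ → ℚ)).row) = V := by
  refine Submodule.eq_of_le_of_finrank_eq (Submodule.span_le.2 ?_) ?_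
  · rintro _ ⟨i, rfl⟩; exact (exists_min_int_tuple V).choose_spec.2.1 i
  · rw [finrank_span_eq_card (linearIndependent_minTuple V), Fintype.card_fin]

theorem covolume_le {n k : ℕ} (Q : ℝ) (φ : Fin (n + 1) → ℝ)
    (w : Matrix (Fin k) (Fin (n + 1)) ℤ)
    (hw : LinearIndependent ℚ (w.map (Int.cast : ℤ → ℚ)).row) :
    covolume Q φ (Submodule.span ℚ (range (w.map (Int.cast : ℤ → ℚ)).row)) ≤
      flowNorm Q φ (w.map (Int.cast : ℤ → ℝ)) := by
  have hk : Module.finrank ℚ (Submodule.span ℚ (range (w.map (Int.cast : ℤ → ℚ)).row)) = k := by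
    rw [finrank_span_eq_card hw, Fintype.card_fin]
  have hV : ∀ i, (w.map (Int.cast : ℤ → ℚ)).row i ∈
      Submodule.span ℚ (range (w.map (Int.cast : ℤ → ℚ)).row) :=
    fun i => Submodule.subset_span ⟨i, rfl⟩
  generalize Submodule.span ℚ (range (w.map (Int.cast : ℤ → ℚ)).row) = V at hk hV
  subst hk
  exact (exists_min_int_tuple V).choose_spec.2.2 w hw hV Q φ

theorem covolume_bot {n : ℕ} (Q : ℝ) (φ : Fin (n + 1) → ℝ) : covolume Q φ ⊥ ≤ 1 := by
  have h := covolume_le Q φ (k := 0) 0 linearIndependent_empty_type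
  rw [flowNorm_fin_zero] at h
  simpa using h

theorem covolume_sup_le {n : ℕ} (Q : ℝ) (φ : Fin (n + 1) → ℝ)
    (V : Submodule ℚ (Fin (n + 1) → ℚ)) (v : Fin (n + 1) → ℤ) (hv : (fun i => (v i : ℚ)) ∉ V) :
    covolume Q φ (Submodule.span ℚ {fun i => (v i : ℚ)} ⊔ V) ≤
      (n + 1) * (covolume Q φ V * ‖(flowMatrix Q φ).mulVec fun i => (v i : ℝ)‖) := by
  let w : Matrix (Fin (Module.finrank ℚ V + 1)) (Fin (n + 1)) ℤ :=
    Matrix.of (Matrix.vecCons v (minTuple V))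
  have hwQ : (w.map (Int.cast : ℤ → ℚ)).row =
      Fin.cons (fun i => (v i : ℚ)) ((minTuple V).map (Int.cast : ℤ → ℚ)).row := by
    funext i
    refine Fin.cases rfl (fun i => rfl) i
  have hwR : w.map (Int.cast : ℤ → ℝ) = Matrix.of (Matrix.vecCons (fun i => (v i : ℝ))
      ((minTuple V).map (Int.cast : ℤ → ℝ))) := by
    ext i j
    refine Fin.cases rfl (fun i => rfl) i
  have hlin : LinearIndependent ℚ (w.map (Int.cast : ℤ → ℚ)).row := by
    rw [hwQ, linearIndependent_finCons, span_minTuple]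
    exact ⟨linearIndependent_minTuple V, hv⟩
  have h := covolume_le Q φ w hlin
  have hspan : Submodule.span ℚ (range (w.map (Int.cast : ℤ → ℚ)).row) =
      Submodule.span ℚ {fun i => (v i : ℚ)} ⊔ V := by
    rw [hwQ, Fin.range_cons, Submodule.span_insert, span_minTuple]
  have hcard : Module.finrank ℚ V + 1 ≤ n + 1 := by
    simpa using hlin.fintype_card_le_finrank
  rw [hspan, hwR] at h
  refine h.trans ((flowNorm_cons_le Q φ _ _).trans ?_)
  refine mul_le_mul_of_nonneg_right ?_ (mul_nonneg (norm_nonneg _) (norm_nonneg _))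
  exact_mod_cast hcard

theorem le_norm_mulVec_of_flag {n : ℕ} {Q ε : ℝ} (φ : Fin (n + 1) → ℝ) (hε1 : ε ≤ 1)
    (F : Finset {V : Submodule ℚ (Fin (n + 1) → ℚ) // V ≠ ⊥})
    (hchain : ∀ s ∈ F, ∀ t ∈ F, s ≤ t ∨ t ≤ s)
    (hF : ∀ s ∈ F, ε ≤ covolume Q φ s.1 ∧ covolume Q φ s.1 ≤ 1)
    (hother : ∀ t, t ∉ F → (∀ s ∈ F, s ≤ t ∨ t ≤ s) → 1 ≤ covolume Q φ t.1)
    (v : Fin (n + 1) → ℤ) (hv : v ≠ 0) :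
    ε ≤ (n + 1) * ‖(flowMatrix Q φ).mulVec fun i => (v i : ℝ)‖ := by
  classical
  set q : Fin (n + 1) → ℚ := fun i => (v i : ℚ) with hq
  have hq0 : q ≠ 0 := fun h => hv (funext fun i => by simpa [hq] using congrFun h i)
  obtain ⟨Γ, hΓF, hΓq, hΓmax⟩ : ∃ Γ : Submodule ℚ (Fin (n + 1) → ℚ),
      (Γ = ⊥ ∨ ∃ s ∈ F, s.1 = Γ) ∧ q ∉ Γ ∧ ∀ s ∈ F, q ∉ s.1 → s.1 ≤ Γ := by
    rcases (F.filter fun s => q ∉ s.1).eq_empty_or_nonempty with he | hne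
    · refine ⟨⊥, Or.inl rfl, by simpa using hq0, fun s hs hqs => ?_⟩
      have : s ∈ F.filter fun s => q ∉ s.1 := Finset.mem_filter.2 ⟨hs, hqs⟩
      rw [he] at this
      exact absurd this (Finset.notMem_empty _)
    · obtain ⟨Γ, hΓ⟩ := Finset.exists_maximal hne
      have hΓ1 := Finset.mem_filter.1 hΓ.1
      refine ⟨Γ.1, Or.inr ⟨Γ, hΓ1.1, rfl⟩, hΓ1.2, fun s hs hqs => ?_⟩
      rcases hchain s hs Γ hΓ1.1 with h | h
      · exact h
      · exact hΓ.2 (Finset.mem_filter.2 ⟨hs, hqs⟩) h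
  have hΓ1 : covolume Q φ Γ ≤ 1 := by
    rcases hΓF with rfl | ⟨s, hs, rfl⟩
    · exact covolume_bot Q φ
    · exact (hF s hs).2
  have hqΔ : q ∈ Submodule.span ℚ {q} ⊔ Γ :=
    Submodule.mem_sup_left (Submodule.mem_span_singleton_self q)
  let Δ : {V : Submodule ℚ (Fin (n + 1) → ℚ) // V ≠ ⊥} :=
    ⟨Submodule.span ℚ {q} ⊔ Γ, fun h => hq0 (by simpa [h] using hqΔ)⟩
  have hcomp : ∀ s ∈ F, s ≤ Δ ∨ Δ ≤ s := by
    intro s hs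
    by_cases hqs : q ∈ s.1
    · right
      refine sup_le ((Submodule.span_singleton_le_iff_mem _ _).2 hqs) ?_
      rcases hΓF with rfl | ⟨t, ht, rfl⟩
      · exact bot_le
      · rcases hchain s hs t ht with h | h
        · exact absurd (h hqs) hΓq
        · exact h
    · exact Or.inl ((hΓmax s hs hqs).trans le_sup_right)
  have hΔ : ε ≤ covolume Q φ Δ.1 := by
    by_cases h : Δ ∈ F
    · exact (hF Δ h).1
    · exact hε1.trans (hother Δ h hcomp)
  have := covolume_sup_le Q φ Γ v hΓq
  refine hΔ.trans (this.trans ?_)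
  refine mul_le_mul_of_nonneg_left ?_ (by positivity)
  exact mul_le_of_le_one_left (norm_nonneg _) hΓ1

theorem hasDerivWithinAt_iteratedDerivWithin {n j : ℕ} {a b : ℝ} (hab : a < b) {g : ℝ → ℝ}
    (hg : ContDiffOn ℝ n g (Icc a b)) (hj : j < n) {x : ℝ} (hx : x ∈ Icc a b) :
    HasDerivWithinAt (iteratedDerivWithin j g (Icc a b))
      (iteratedDerivWithin (j + 1) g (Icc a b) x) (Icc a b) x := by
  rw [iteratedDerivWithin_succ]
  exact (hg.differentiableOn_iteratedDerivWithin (by exact_mod_cast hj) (uniqueDiffOn_Icc hab)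
    x hx).hasDerivWithinAt

/-- The derivatives of the function `c₀ + ∑ i, c i * f i` on `[a, b]`. -/
noncomputable def formDeriv {n : ℕ} (f : Fin n → ℝ → ℝ) (a b c₀ : ℝ) (c : Fin n → ℝ) (j : ℕ)
    (x : ℝ) : ℝ :=
  (if j = 0 then c₀ else 0) + ∑ i, c i * iteratedDerivWithin j (f i) (Icc a b) x

theorem formDeriv_zero {n : ℕ} (f : Fin n → ℝ → ℝ) (a b c₀ : ℝ) (c : Fin n → ℝ) (x : ℝ) :
    formDeriv f a b c₀ c 0 x = c₀ + ∑ i, c i * f i x := by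
  simp [formDeriv]

theorem continuousOn_formDeriv {n j : ℕ} {a b : ℝ} (hab : a < b) {f : Fin n → ℝ → ℝ}
    (hf : ∀ i, ContDiffOn ℝ n (f i) (Icc a b)) (hj : j ≤ n) (c₀ : ℝ) (c : Fin n → ℝ) :
    ContinuousOn (formDeriv f a b c₀ c j) (Icc a b) := by
  refine continuousOn_const.add (continuousOn_finsetSum _ fun i _ => continuousOn_const.mul ?_)
  exact (hf i).continuousOn_iteratedDerivWithin (by exact_mod_cast hj) (uniqueDiffOn_Icc hab)

theorem hasDerivAt_formDeriv {n j : ℕ} {a b : ℝ} (hab : a < b) {f : Fin n → ℝ → ℝ}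
    (hf : ∀ i, ContDiffOn ℝ n (f i) (Icc a b)) (hj : j < n) (c₀ : ℝ) (c : Fin n → ℝ) {x : ℝ}
    (hx : x ∈ Ioo a b) :
    HasDerivAt (formDeriv f a b c₀ c j) (formDeriv f a b c₀ c (j + 1) x) x := by
  simp only [formDeriv, Nat.add_eq_zero_iff, one_ne_zero, and_false, if_false]
  refine (hasDerivAt_const x _).add (HasDerivAt.fun_sum fun i _ => HasDerivAt.const_mul (c i) ?_)
  exact (hasDerivWithinAt_iteratedDerivWithin hab (hf i) hj (Ioo_subset_Icc_self hx)).hasDerivAt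
    (Icc_mem_nhds hx.1 hx.2)

theorem exists_formDeriv_bounds {n : ℕ} (hn : 1 ≤ n) {a b : ℝ} (hab : a < b) {f : Fin n → ℝ → ℝ}
    (hf : ∀ i, ContDiffOn ℝ n (f i) (Icc a b))
    (hW : ∀ x ∈ Icc a b, (Matrix.of fun i j : Fin n =>
      iteratedDerivWithin ((j : ℕ) + 1) (f i) (Icc a b) x).det ≠ 0) :
    ∃ κ > 0, ∃ M, 1 ≤ M ∧ ∃ τ > 0, ∀ (c₀ : ℝ) (c : Fin n → ℝ) (p q : ℝ), a ≤ p → p ≤ q → q ≤ b →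
      q - p ≤ τ → ∃ j, 1 ≤ j ∧ j ≤ n ∧ ∀ x ∈ Icc p q,
        κ * ‖c‖ ≤ |formDeriv f a b c₀ c j x| ∧ |formDeriv f a b c₀ c j x| ≤ M * (κ * ‖c‖) := by
  have : Nonempty (Fin n) := ⟨⟨0, hn⟩⟩
  let h : ℝ → Fin n → Fin n → ℝ := fun x j i => iteratedDerivWithin ((j : ℕ) + 1) (f i) (Icc a b) x
  have hh : ContinuousOn h (Icc a b) := by
    refine continuousOn_pi.2 fun j => continuousOn_pi.2 fun i => ?_
    exact (hf i).continuousOn_iteratedDerivWithin (by exact_mod_cast j.2) (uniqueDiffOn_Icc hab)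
  let g : (Fin n → ℝ) × ℝ → ℝ := fun y => ‖fun j => ∑ i, y.1 i * h y.2 j i‖
  have hg : ContinuousOn g (Metric.sphere 0 1 ×ˢ Icc a b) := by
    refine ContinuousOn.norm (continuousOn_pi.2 fun j => continuousOn_finsetSum _ fun i _ => ?_)
    refine ContinuousOn.mul ?_ ?_
    · exact ((continuous_apply i).comp continuous_fst).continuousOn
    · exact (continuousOn_pi.1 (continuousOn_pi.1 hh j) i).comp continuousOn_snd fun y hy => hy.2
  have hcomp : IsCompact ((Metric.sphere (0 : Fin n → ℝ) 1) ×ˢ Icc a b) :=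
    (isCompact_sphere _ _).prod isCompact_Icc
  have hne : ((Metric.sphere (0 : Fin n → ℝ) 1) ×ˢ Icc a b).Nonempty :=
    ⟨(fun _ => 1, a), by simp [pi_norm_const, hab.le]⟩
  obtain ⟨y₀, hy₀, hmin⟩ := hcomp.exists_isMinOn hne hg
  have hpos : 0 < g y₀ := by
    refine norm_pos_iff.2 fun h0 => ?_
    have hdet := hW y₀.2 hy₀.2
    have := Matrix.eq_zero_of_vecMul_eq_zero hdet (v := y₀.1) (by
      ext j
      simpa [Matrix.vecMul, dotProduct] using congrFun h0 j)
    have h1 : ‖y₀.1‖ = 1 := by simpa using hy₀.1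
    rw [this, norm_zero] at h1
    exact zero_ne_one h1
  set κ := g y₀ / 2 with hκ
  have hκ0 : 0 < κ := by positivity
  have hunif := isCompact_Icc.uniformContinuousOn_of_continuous hh
  rw [Metric.uniformContinuousOn_iff_le] at hunif
  have hn0 : (0 : ℝ) < n := by exact_mod_cast hn
  obtain ⟨τ, hτ, hmod⟩ := hunif (κ / n) (by positivity)
  obtain ⟨M, hM⟩ := isCompact_Icc.exists_bound_of_continuousOn hh
  refine ⟨κ, hκ0, n * |M| / κ + 1, by simp only [le_add_iff_nonneg_left]; positivity, τ, hτ, ?_⟩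
  intro c₀ c p q hap hpq hqb hτ'
  have hform : ∀ (j : Fin n) x, formDeriv f a b c₀ c (j + 1) x = ∑ i, c i * h x j i := by
    intro j x
    simp [formDeriv, h]
  have hpI : p ∈ Icc a b := ⟨hap, hpq.trans hqb⟩
  have key : ∃ j : Fin n, 2 * κ * ‖c‖ ≤ |∑ i, c i * h p j i| := by
    rcases eq_or_ne c 0 with rfl | hc
    · exact ⟨⟨0, hn⟩, by simp⟩
    · have hc' : 0 < ‖c‖ := norm_pos_iff.2 hc
      have h1 : g y₀ ≤ g (‖c‖⁻¹ • c, p) :=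
        hmin (a := (‖c‖⁻¹ • c, p)) ⟨by simp [norm_smul, hc'.ne'], hpI⟩
      have h2 : g (‖c‖⁻¹ • c, p) = ‖c‖⁻¹ * ‖fun j => ∑ i, c i * h p j i‖ := by
        have : (fun j => ∑ i, (‖c‖⁻¹ • c) i * h p j i) =
            ‖c‖⁻¹ • fun j => ∑ i, c i * h p j i := by
          ext j
          simp [Finset.mul_sum, mul_assoc]
        simp only [g]
        rw [this, norm_smul, norm_inv, norm_norm]
      obtain ⟨j, hj⟩ := Finite.exists_max fun j => ‖∑ i, c i * h p j i‖
      refine ⟨j, ?_⟩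
      have h3 : ‖fun j => ∑ i, c i * h p j i‖ ≤ ‖∑ i, c i * h p j i‖ :=
        (pi_norm_le_iff_of_nonneg (norm_nonneg _)).2 hj
      rw [h2, inv_mul_eq_div, le_div_iff₀ hc'] at h1
      rw [← Real.norm_eq_abs]
      calc 2 * κ * ‖c‖ = g y₀ * ‖c‖ := by rw [hκ]; ring
        _ ≤ _ := h1.trans h3
  obtain ⟨j, hj⟩ := key
  refine ⟨j + 1, by omega, j.2, fun x hx => ?_⟩
  have hxI : x ∈ Icc a b := ⟨hap.trans hx.1, hx.2.trans hqb⟩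
  rw [hform]
  constructor
  · have hd : ∀ i, |h x j i - h p j i| ≤ κ / n := by
      intro i
      have := hmod x hxI p hpI (by
        rw [Real.dist_eq, abs_of_nonneg (by linarith [hx.1])]; linarith [hx.2])
      rw [dist_eq_norm] at this
      exact ((norm_le_pi_norm ((h x - h p) j) i).trans (norm_le_pi_norm (h x - h p) j)).trans this
    have hdiff : |∑ i, c i * h p j i - ∑ i, c i * h x j i| ≤ κ * ‖c‖ := by
      rw [← Finset.sum_sub_distrib]
      refine (Finset.abs_sum_le_sum_abs _ _).trans ?_
      calc ∑ i, |c i * h p j i - c i * h x j i| ≤ ∑ _i : Fin n, ‖c‖ * (κ / n) := by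
            refine Finset.sum_le_sum fun i _ => ?_
            rw [← mul_sub, abs_mul, abs_sub_comm]
            exact mul_le_mul (norm_le_pi_norm c i) (hd i) (abs_nonneg _) (norm_nonneg _)
        _ = κ * ‖c‖ := by
            rw [Finset.sum_const, Finset.card_univ, Fintype.card_fin, nsmul_eq_mul]
            field_simp
    have := abs_sub_abs_le_abs_sub (∑ i, c i * h p j i) (∑ i, c i * h x j i)
    linarith
  · calc |∑ i, c i * h x j i| ≤ ∑ i, |c i * h x j i| := Finset.abs_sum_le_sum_abs _ _
      _ ≤ ∑ _i : Fin n, ‖c‖ * |M| := by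
          refine Finset.sum_le_sum fun i _ => ?_
          rw [abs_mul]
          refine mul_le_mul (norm_le_pi_norm c i) ?_ (abs_nonneg _) (norm_nonneg _)
          exact (((norm_le_pi_norm (h x j) i).trans (norm_le_pi_norm (h x) j)).trans
            (hM x hxI)).trans (le_abs_self M)
      _ = n * |M| / κ * (κ * ‖c‖) := by
          rw [Finset.sum_const, Finset.card_univ, Fintype.card_fin, nsmul_eq_mul]
          field_simp
      _ ≤ _ := by
          refine mul_le_mul_of_nonneg_right (by linarith) (by positivity)

/-- Non-degenerate linear forms are good on short intervals, and integral ones are not uniformly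
small. -/
theorem exists_good_forms {n : ℕ} (hn : 1 ≤ n) {a b : ℝ} (hab : a < b) {f : Fin n → ℝ → ℝ}
    (hf : ∀ i, ContDiffOn ℝ n (f i) (Icc a b))
    (hW : ∀ x ∈ Icc a b, (Matrix.of fun i j : Fin n =>
      iteratedDerivWithin ((j : ℕ) + 1) (f i) (Icc a b) x).det ≠ 0) :
    ∃ τ > 0,
      (∀ G > 0, ∃ ε > 0, ε ≤ 1 ∧ ∀ (c₀ : ℝ) (c : Fin n → ℝ) (p q : ℝ), a ≤ p → p < q → q ≤ b →
        q - p ≤ τ → (∃ y ∈ Icc p q, 1 ≤ |c₀ + ∑ i, c i * f i y|) →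
        volume {x ∈ Icc p q | |c₀ + ∑ i, c i * f i x| < ε} ≤ ENNReal.ofReal (G * (q - p))) ∧
      ∀ p q : ℝ, a ≤ p → p < q → q ≤ b → ∃ η > 0, ∀ (c₀ : ℤ) (c : Fin n → ℤ),
        (c₀ ≠ 0 ∨ c ≠ 0) → ∃ y ∈ Icc p q, η ≤ |c₀ + ∑ i, c i * f i y| := by
  obtain ⟨κ, hκ, M, hM, τ, hτ, H⟩ := exists_formDeriv_bounds hn hab hf hW
  refine ⟨τ, hτ, fun G hG => ?_, fun p q hap hpq hqb => ?_⟩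
  · set B : ℝ := 2 ^ (n + 2) / G + 1 with hB
    have hB1 : 1 ≤ B := by rw [hB, le_add_iff_nonneg_left]; positivity
    have hMn : (1 : ℝ) ≤ M + n := by have := Nat.cast_nonneg (α := ℝ) n; linarith
    have hprod : 1 ≤ (M + n) * B ^ n := one_le_mul_of_one_le_of_one_le hMn (one_le_pow₀ hB1)
    set ε : ℝ := 1 / (2 * ((M + n) * B ^ n)) with hε
    have hε0 : 0 < ε := by positivity
    refine ⟨ε, hε0, ?_, fun c₀ c p q hap hpq hqb hτ' hbig => ?_⟩
    · rw [hε, div_le_one (by positivity)]; linarith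
    rcases eq_or_ne c 0 with rfl | hc
    · obtain ⟨y, -, hy⟩ := hbig
      have : {x ∈ Icc p q | |c₀ + ∑ i, (0 : Fin n → ℝ) i * f i x| < ε} = ∅ := by
        rw [eq_empty_iff_forall_notMem]
        rintro x ⟨-, hx⟩
        simp only [Pi.zero_apply, zero_mul, Finset.sum_const_zero, add_zero] at hx hy
        have : ε ≤ 1 := by rw [hε, div_le_one (by positivity)]; linarith
        linarith
      rw [this, measure_empty]
      exact zero_le
    · obtain ⟨j, hj1, hjn, hj⟩ := H c₀ c p q hap hpq.le hqb hτ'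
      have hsub : Icc p q ⊆ Icc a b := Icc_subset_Icc hap hqb
      have := volume_sublevel_le hpq hG (A := κ * ‖c‖) (K := M)
        (mul_pos hκ (norm_pos_iff.2 hc)) hε0 j (formDeriv f a b c₀ c)
        (fun i hi => (continuousOn_formDeriv hab hf (hi.trans hjn) c₀ c).mono hsub)
        (fun i hi y hy => hasDerivAt_formDeriv hab hf (hi.trans_le hjn) c₀ c
          (Ioo_subset_Ioo hap hqb hy)) (fun x hx => (hj x hx).1) (fun x hx => (hj x hx).2) ?_ ?_
      · simpa only [formDeriv_zero] using this
      · have h1 : (2 : ℝ) ^ (j + 2) / G ≤ B := by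
          rw [hB]
          have : (2 : ℝ) ^ (j + 2) / G ≤ 2 ^ (n + 2) / G := by gcongr; norm_num
          linarith
        have h2 : (2 ^ (j + 2) / G) ^ j ≤ B ^ n :=
          (pow_le_pow_left₀ (by positivity) h1 j).trans (pow_le_pow_right₀ hB1 hjn)
        have h3 : (M + j) * (2 ^ (j + 2) / G) ^ j ≤ (M + n) * B ^ n := by
          refine mul_le_mul ?_ h2 (by positivity) (by positivity)
          have : (j : ℝ) ≤ n := by exact_mod_cast hjn
          linarith
        calc (M + j) * (2 ^ (j + 2) / G) ^ j * ε ≤ (M + n) * B ^ n * ε := by gcongr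
          _ = 1 / 2 := by rw [hε]; field_simp
          _ < 1 := by norm_num
      · simpa only [formDeriv_zero] using hbig
  · set q' := min q (p + τ) with hq'
    have hpq' : p < q' := lt_min hpq (by linarith)
    set g := (q' - p) / 2 ^ n with hg
    have hg0 : 0 < g := by have := sub_pos.2 hpq'; positivity
    set B := 2 / g + 1 with hB
    have hB1 : 1 ≤ B := by rw [hB, le_add_iff_nonneg_left]; positivity
    refine ⟨min 1 (κ / (2 * B ^ n)), lt_min one_pos (by positivity), fun c₀ c hc => ?_⟩
    by_cases hc0 : c = 0
    · refine ⟨p, ⟨le_rfl, hpq.le⟩, (min_le_left _ _).trans ?_⟩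
      have : c₀ ≠ 0 := hc.resolve_right (not_not.2 hc0)
      simp only [hc0, Pi.zero_apply, Int.cast_zero, zero_mul, Finset.sum_const_zero, add_zero]
      exact_mod_cast Int.one_le_abs this
    by_contra! hsmall
    set cR : Fin n → ℝ := fun i => (c i : ℝ) with hcR
    have hnorm : 1 ≤ ‖cR‖ := by
      obtain ⟨i, hi⟩ := Function.ne_iff.1 hc0
      refine le_trans ?_ (norm_le_pi_norm cR i)
      change (1 : ℝ) ≤ |(c i : ℝ)|
      exact_mod_cast Int.one_le_abs hi
    have hq'q : q' ≤ q := min_le_left _ _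
    obtain ⟨j, hj1, hjn, hj⟩ := H c₀ cR p q' hap hpq'.le (hq'q.trans hqb)
      (by linarith [min_le_right q (p + τ)])
    have hsub : Icc p q' ⊆ Icc a b := Icc_subset_Icc hap (hq'q.trans hqb)
    obtain ⟨ξ, hξ, hξj⟩ := exists_small_iterated_deriv hg0 j (formDeriv f a b c₀ cR)
      (fun l => p + l * g) (κ / (2 * B ^ n)) (by positivity)
      (fun i hi => (continuousOn_formDeriv hab hf (hi.trans hjn) c₀ cR).mono hsub)
      (fun i hi y hy => hasDerivAt_formDeriv hab hf (hi.trans_le hjn) c₀ cR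
        (Ioo_subset_Ioo hap (hq'q.trans hqb) hy)) (fun l hl => by
          have hmem : p + l * g ∈ Icc p q' := by
            refine ⟨by have : 0 ≤ l * g := by positivity
                       linarith, ?_⟩
            have h1 : (l : ℝ) ≤ 2 ^ n := by
              exact_mod_cast hl.le.trans (Nat.pow_le_pow_right (by norm_num) hjn)
            have h2 : l * g ≤ 2 ^ n * g := by gcongr
            have h3 : 2 ^ n * g = q' - p := by rw [hg]; field_simp
            linarith
          refine ⟨hmem, ?_⟩
          rw [formDeriv_zero]
          exact ((hsmall _ ⟨hmem.1, hmem.2.trans hq'q⟩).trans_le (min_le_right _ _)).le)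
      (fun l _ => by push_cast; linarith) j le_rfl
    have h1 : κ ≤ |formDeriv f a b c₀ cR j ξ| :=
      le_trans (le_mul_of_one_le_right hκ.le hnorm) (hj ξ hξ).1
    have h2 : (2 / g) ^ j ≤ B ^ n :=
      (pow_le_pow_left₀ (by positivity) (by rw [hB]; linarith) j).trans (pow_le_pow_right₀ hB1 hjn)
    have h3 : (2 / g) ^ j * (κ / (2 * B ^ n)) ≤ κ / 2 := by
      calc (2 / g) ^ j * (κ / (2 * B ^ n)) ≤ B ^ n * (κ / (2 * B ^ n)) := by gcongr
        _ = κ / 2 := by field_simp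
    linarith

/-- The vector `(1, f(x))`. -/
def homogenize {n : ℕ} (f : Fin n → ℝ → ℝ) (x : ℝ) : Fin (n + 1) → ℝ :=
  Fin.cons 1 fun i => f i x

theorem exists_flowMinor_homogenize {n k : ℕ} (f : Fin n → ℝ → ℝ) (Q : ℝ)
    (W : Matrix (Fin k) (Fin (n + 1)) ℝ) (e : Fin k → Fin (n + 1)) :
    ∃ (c₀ : ℝ) (c : Fin n → ℝ), ∀ x,
      flowMinor Q (homogenize f x) W e = c₀ + ∑ i, c i * f i x := by
  obtain ⟨c, hc⟩ := exists_flowMinor_eq_sum Q W e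
  refine ⟨c 0, fun i => c i.succ, fun x => ?_⟩
  rw [hc _ rfl, Fin.sum_univ_succ]
  simp [homogenize]

/-- Quantitative non-divergence: for most `x`, all nonzero vectors of the lattice attached to `x`
are bounded below. -/
theorem exists_volume_short_vectors_le {n : ℕ} (hn : 1 ≤ n) {a b : ℝ} (hab : a < b)
    {f : Fin n → ℝ → ℝ} (hf : ∀ i, ContDiffOn ℝ n (f i) (Icc a b))
    (hW : ∀ x ∈ Icc a b, (Matrix.of fun i j : Fin n =>
      iteratedDerivWithin ((j : ℕ) + 1) (f i) (Icc a b) x).det ≠ 0) :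
    ∃ δ > 0, ∃ τ > 0, ∀ u v, a ≤ u → u < v → v ≤ b → v - u ≤ τ → ∃ Q₀ : ℝ, 1 ≤ Q₀ ∧ ∀ Q ≥ Q₀,
      volume ({x | ∃ w : Fin (n + 1) → ℤ, w ≠ 0 ∧
        ‖(flowMatrix Q (homogenize f x)).mulVec fun i => (w i : ℝ)‖ < δ} ∩ Icc u v) ≤
        ENNReal.ofReal ((v - u) / 4) := by
  obtain ⟨τ, hτ, hgood, hbig⟩ := exists_good_forms hn hab hf hW
  set C := nondivergenceConst (n + 2) with hC
  have hC0 : 0 ≤ C := nondivergenceConst_nonneg _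
  set G : ℝ := 1 / (4 * (C + 1)) with hG
  have hG0 : 0 < G := by positivity
  obtain ⟨ε, hε, hε1, hsub⟩ := hgood G hG0
  refine ⟨ε / (n + 1), by positivity, τ, hτ, fun u v hau huv hvb hvτ => ?_⟩
  obtain ⟨η, hη, hform⟩ := hbig u v hau huv hvb
  refine ⟨max 1 η⁻¹, le_max_left _ _, fun Q hQ => ?_⟩
  have hQ1 : 1 ≤ Q := (le_max_left _ _).trans hQ
  have hQη : 1 ≤ Q * η := by
    have := (le_max_right _ _).trans hQ
    rwa [inv_le_iff_one_le_mul₀ hη] at this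
  have huvI : Icc u v ⊆ Icc a b := Icc_subset_Icc hau hvb
  have hcov := volume_short_vectors_le (S := {V : Submodule ℚ (Fin (n + 1) → ℚ) // V ≠ ⊥}) (n + 2)
    (fun V => Module.finrank ℚ V.1) (fun V W h => Submodule.finrank_lt_finrank_of_lt h)
    (fun V => by
      have := Submodule.finrank_le V.1
      rw [Module.finrank_fin_fun] at this
      omega)
    (fun V x => covolume Q (homogenize f x) V.1) (u := u) (v := v) (ε := ε) hG0.le
    (fun V => by
      refine ContinuousOn.norm (continuousOn_pi.2 fun e => ?_)
      obtain ⟨c₀, c, hc⟩ := exists_flowMinor_homogenize f Q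
        ((minTuple V.1).map (Int.cast : ℤ → ℝ)) e
      simp only [hc]
      exact continuousOn_const.add (continuousOn_finsetSum _ fun i _ =>
        continuousOn_const.mul ((hf i).continuousOn.mono huvI)))
    (fun V p q hup hqv hpq hy => by
      obtain ⟨y, hy, hy1⟩ := hy
      obtain ⟨e, he⟩ : ∃ e, 1 ≤ ‖flowMinor Q (homogenize f y)
          ((minTuple V.1).map (Int.cast : ℤ → ℝ)) e‖ := by
        by_contra! h
        refine absurd hy1 (not_le.2 ?_)
        exact (pi_norm_lt_iff one_pos).2 h
      obtain ⟨c₀, c, hc⟩ := exists_flowMinor_homogenize f Q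
        ((minTuple V.1).map (Int.cast : ℤ → ℝ)) e
      refine le_trans (measure_mono ?_) (hsub c₀ c p q (hau.trans hup) hpq (hqv.trans hvb)
        (by linarith) ⟨y, hy, by rwa [← hc]⟩)
      rintro x ⟨hx, hxε⟩
      refine ⟨hx, ?_⟩
      rw [← hc]
      exact (norm_le_pi_norm (fun e => flowMinor Q (homogenize f x)
        ((minTuple V.1).map (Int.cast : ℤ → ℝ)) e) e).trans_lt hxε)
    {x | ∃ w : Fin (n + 1) → ℤ, w ≠ 0 ∧
        ‖(flowMatrix Q (homogenize f x)).mulVec fun i => (w i : ℝ)‖ < ε / (n + 1)}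
    (fun x _ F h1 h2 h3 => by
      rintro ⟨w, hw, hw'⟩
      have := le_norm_mulVec_of_flag (homogenize f x) hε1 F h1 h2 h3 w hw
      rw [lt_div_iff₀ (by positivity)] at hw'
      linarith)
    (fun V => by
      have hk : 0 < Module.finrank ℚ V.1 :=
        Nat.pos_of_ne_zero fun h => V.2 (Submodule.finrank_eq_zero.1 h)
      rcases exists_flowMinor_integral hk (zero_lt_one.trans_le hQ1) _
        (linearIndependent_minTuple V.1) with ⟨e, m, hm, p, hp, hmin⟩ | ⟨e, m, hm, hmin⟩
      · have hm' : m 0 ≠ 0 ∨ (fun i : Fin n => m i.succ) ≠ 0 := by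
          by_contra! h
          refine hm (funext fun i => ?_)
          exact Fin.cases h.1 (fun i => congrFun h.2 i) i
        obtain ⟨y, hy, hyη⟩ := hform (m 0) (fun i => m i.succ) hm'
        refine ⟨y, hy, le_trans ?_ (norm_le_pi_norm _ e)⟩
        rw [hmin, norm_mul, norm_pow, Real.norm_of_nonneg (by linarith), Fin.sum_univ_succ]
        have h1 : Q ≤ Q ^ p := le_self_pow₀ hQ1 (by omega)
        have h2 : Q * η ≤ Q ^ p * η := by gcongr
        refine hQη.trans (h2.trans ?_)
        have hQp : 0 ≤ Q ^ p := by positivity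
        refine mul_le_mul_of_nonneg_left ?_ hQp
        simpa [homogenize] using hyη
      · refine ⟨u, ⟨le_rfl, huv.le⟩, le_trans ?_ (norm_le_pi_norm _ e)⟩
        rw [hmin]
        have : |(m : ℝ)| ≥ 1 := by exact_mod_cast Int.one_le_abs hm
        simpa [homogenize] using this)
  refine hcov.trans (ENNReal.ofReal_le_ofReal ?_)
  have : C * G ≤ 1 / 4 := by
    rw [hG, mul_one_div, div_le_div_iff₀ (by positivity) (by norm_num)]
    linarith
  nlinarith

/-- Blichfeldt's principle for the integer lattice. -/
theorem exists_int_translate_of_one_lt_volume {d : ℕ} {s : Set (Fin d → ℝ)}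
    (hs : MeasurableSet s) (h : 1 < volume s) :
    ∃ w : Fin d → ℤ, w ≠ 0 ∧ ∃ y ∈ s, ∃ z ∈ s, y - z = fun i => (w i : ℝ) := by
  have hvol : volume (ZSpan.fundamentalDomain (Pi.basisFun ℝ (Fin d))) < volume s := by
    have h1 : volume (Set.univ.pi fun _ : Fin d => Ico (0 : ℝ) 1) = 1 := by
      rw [volume_pi, Measure.pi_pi]; simp
    rwa [ZSpan.fundamentalDomain_pi_basisFun, h1]
  have : Countable (Submodule.span ℤ (range (Pi.basisFun ℝ (Fin d)))).toAddSubgroup :=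
    inferInstanceAs (Countable (Submodule.span ℤ (range (Pi.basisFun ℝ (Fin d)))))
  obtain ⟨x, y, hxy, hdisj⟩ := exists_pair_mem_lattice_not_disjoint_vadd
    (ZSpan.isAddFundamentalDomain' (Pi.basisFun ℝ (Fin d)) volume) hs.nullMeasurableSet hvol
  obtain ⟨_, ⟨p, hp, rfl⟩, q, hq, hpq⟩ := Set.not_disjoint_iff.1 hdisj
  have hmem := ((Pi.basisFun ℝ (Fin d)).mem_span_iff_repr_mem ℤ _).1 (y - x).2
  choose w hw using hmem
  have hw' : ∀ i, (w i : ℝ) = (y : Fin d → ℝ) i - (x : Fin d → ℝ) i := fun i => by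
    simpa using hw i
  refine ⟨w, fun h0 => hxy ?_, p, hp, q, hq, ?_⟩
  · ext i
    have := hw' i
    rw [h0] at this
    simp only [Pi.zero_apply, Int.cast_zero] at this
    linarith
  · ext i
    rw [hw']
    have := congrFun hpq i
    simp only [AddSubgroup.vadd_def, vadd_eq_add, Pi.add_apply] at this
    rw [Pi.sub_apply]
    linarith

/-- A unimodular lattice without short vectors has bounded covering radius. -/
theorem exists_int_near_of_no_short {d N : ℕ} {δ : ℝ} (hδ : 0 < δ) (hN : 1 < (N + 1) * δ ^ d)
    (A : Matrix (Fin d) (Fin d) ℝ) (hA : A.det = 1)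
    (hshort : ∀ w : Fin d → ℤ, w ≠ 0 → δ ≤ ‖A.mulVec fun i => (w i : ℝ)‖) (u : Fin d → ℝ) :
    ∃ w : Fin d → ℤ, ‖A.mulVec (fun i => (w i : ℝ)) - u‖ ≤ δ * N + 1 := by
  by_contra! hcon
  set L : Set (Fin d → ℝ) := range fun w : Fin d → ℤ => A.mulVec fun i => (w i : ℝ) with hL
  have hLne : L.Nonempty := range_nonempty _
  have h0 : Metric.infDist (0 : Fin d → ℝ) L = 0 :=
    Metric.infDist_zero_of_mem ⟨0, by ext; simp [Matrix.mulVec, dotProduct]⟩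
  have hu : δ * N ≤ Metric.infDist u L := by
    refine (Metric.le_infDist hLne).2 ?_
    rintro _ ⟨w, rfl⟩
    rw [dist_comm, dist_eq_norm]
    linarith [hcon w]
  have hinv : ∀ (w : Fin d → ℤ) (x y : Fin d → ℝ),
      Metric.infDist x L ≤ Metric.infDist y L + ‖x - y - A.mulVec fun i => (w i : ℝ)‖ := by
    intro w x y
    have h1 : Metric.infDist x L ≤ Metric.infDist (x - A.mulVec fun i => (w i : ℝ)) L := by
      refine (Metric.le_infDist hLne).2 ?_
      rintro _ ⟨w', rfl⟩
      have hmem : (A.mulVec fun i => ((w + w') i : ℝ)) ∈ L := ⟨w + w', rfl⟩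
      refine (Metric.infDist_le_dist_of_mem hmem).trans_eq ?_
      rw [dist_eq_norm, dist_eq_norm]
      congr 1
      have : (fun i => ((w + w') i : ℝ)) = (fun i => (w i : ℝ)) + fun i => (w' i : ℝ) := by
        ext; simp
      rw [this, Matrix.mulVec_add]
      abel
    refine h1.trans ((Metric.infDist_le_infDist_add_dist (y := y)).trans_eq ?_)
    rw [dist_eq_norm]
    congr 2
    abel
  have hcont : ContinuousOn (fun t : ℝ => Metric.infDist (t • u) L) (Icc 0 1) :=
    ((Metric.continuous_infDist_pt L).comp (by fun_prop)).continuousOn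
  have hpts : ∀ j : Fin (N + 1), ∃ x, Metric.infDist x L = δ * (j : ℕ) := by
    intro j
    have hj : (j : ℝ) ≤ N := by exact_mod_cast Nat.lt_succ_iff.1 j.2
    obtain ⟨t, -, ht⟩ := intermediate_value_Icc zero_le_one hcont
      (show δ * (j : ℕ) ∈ Icc _ _ from by
        simp only [zero_smul, one_smul, h0]
        exact ⟨by positivity, le_trans (by gcongr) hu⟩)
    exact ⟨t • u, ht⟩
  choose x hx using hpts
  have hsep : ∀ i j, i ≠ j → ∀ w : Fin d → ℤ,
      δ ≤ ‖x i - x j - A.mulVec fun i => (w i : ℝ)‖ := by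
    have key : ∀ i j, j < i → ∀ w : Fin d → ℤ,
        δ ≤ ‖x i - x j - A.mulVec fun i => (w i : ℝ)‖ := by
      intro i j hij w
      have := hinv w (x i) (x j)
      rw [hx, hx] at this
      have h1 : ((j : ℕ) : ℝ) + 1 ≤ (i : ℕ) := by exact_mod_cast hij
      nlinarith
    intro i j hij w
    rcases lt_or_gt_of_ne hij with h | h
    · have := key j i h (-w)
      rw [← norm_neg] at this
      have h1 : (fun i => ((-w) i : ℝ)) = -fun i => (w i : ℝ) := by ext; simp
      rwa [h1, Matrix.mulVec_neg, sub_neg_eq_add, neg_add, neg_sub, ← sub_eq_add_neg] at this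
    · exact key i j h w
  let s : Set (Fin d → ℝ) := ⋃ j, Metric.ball (x j) (δ / 2)
  have hvol : 1 < volume s := by
    rw [measure_iUnion _ fun j => Metric.isOpen_ball.measurableSet]
    · simp only [Real.volume_pi_ball _ (half_pos hδ)]
      rw [tsum_fintype, Finset.sum_const, Finset.card_univ, Fintype.card_fin, Fintype.card_fin,
        nsmul_eq_mul, ← ENNReal.ofReal_natCast, ← ENNReal.ofReal_mul (by positivity),
        ← ENNReal.ofReal_one, ENNReal.ofReal_lt_ofReal_iff (by positivity)]
      rw [show 2 * (δ / 2) = δ by ring]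
      exact_mod_cast hN
    · intro i j hij
      refine Metric.ball_disjoint_ball ?_
      have := hsep i j hij 0
      rw [show (fun i => (((0 : Fin d → ℤ) i : ℤ) : ℝ)) = 0 by ext; simp, Matrix.mulVec_zero,
        sub_zero, ← dist_eq_norm] at this
      linarith
  have hdet : LinearMap.det (Matrix.toLin' A) = 1 := by rw [LinearMap.det_toLin', hA]
  have hcontA : Continuous (Matrix.toLin' A) := LinearMap.continuous_of_finiteDimensional _
  obtain ⟨w, hw, y, ⟨_, ⟨i, rfl⟩, hy⟩, z, ⟨_, ⟨j, rfl⟩, hz⟩, hyz⟩ :=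
    exists_int_translate_of_one_lt_volume (s := Matrix.toLin' A ⁻¹' s)
      (hcontA.measurable (MeasurableSet.iUnion fun j => Metric.isOpen_ball.measurableSet)) (by
        rw [Measure.addHaar_preimage_linearMap _ (by rw [hdet]; exact one_ne_zero), hdet]
        simpa using hvol)
  simp only [Matrix.toLin'_apply, mem_ball_iff_norm] at hy hz
  have hlt : ‖x i - x j - A.mulVec fun i => (w i : ℝ)‖ < δ := by
    rw [← hyz, Matrix.mulVec_sub]
    calc ‖x i - x j - (A.mulVec y - A.mulVec z)‖
        = ‖(A.mulVec z - x j) - (A.mulVec y - x i)‖ := by congr 1; abel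
      _ ≤ ‖A.mulVec z - x j‖ + ‖A.mulVec y - x i‖ := norm_sub_le _ _
      _ < δ := by linarith
  rcases eq_or_ne i j with rfl | hij
  · have := hshort w hw
    rw [sub_self, zero_sub, norm_neg] at hlt
    linarith
  · exact absurd hlt (not_lt.2 (hsep i j hij w))

theorem det_flowMatrix {n : ℕ} {Q : ℝ} (hQ : 0 < Q) (φ : Fin (n + 1) → ℝ) (hφ : φ 0 = 1) :
    (flowMatrix Q φ).det = 1 := by
  rw [Matrix.det_of_isUpperTriangular]
  · rw [Fin.prod_univ_succ]
    simp [flowMatrix, hφ, hQ.ne']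
  · intro i j hij
    have h0 : i ≠ 0 := fun h => by subst h; exact absurd hij (not_lt.2 (Fin.zero_le _))
    simp [flowMatrix, h0, (show i ≠ j from fun h => absurd hij (h ▸ lt_irrefl _))]

theorem exists_zero_near_of_deriv_ge {F F' : ℝ → ℝ} {x ρ M E : ℝ} (hρ : 0 < ρ)
    (hF : ∀ y ∈ Icc (x - ρ) (x + ρ), ContinuousWithinAt F (Icc (x - ρ) (x + ρ)) y)
    (hF' : ∀ y ∈ Ioo (x - ρ) (x + ρ), HasDerivAt F (F' y) y)
    (hM : ∀ y ∈ Icc (x - ρ) (x + ρ), M ≤ F' y) (hx : |F x| ≤ E) (hE : E ≤ M * ρ) :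
    ∃ p ∈ Icc (x - ρ) (x + ρ), F p = 0 := by
  have hc : ContinuousOn F (Icc (x - ρ) (x + ρ)) := hF
  have h1 : Icc x (x + ρ) ⊆ Icc (x - ρ) (x + ρ) := Icc_subset_Icc (by linarith) le_rfl
  have h2 : Icc (x - ρ) x ⊆ Icc (x - ρ) (x + ρ) := Icc_subset_Icc le_rfl (by linarith)
  obtain ⟨y, hy, hy'⟩ := exists_hasDerivAt_eq_slope F F' (show x < x + ρ by linarith)
    (hc.mono h1) fun y hy => hF' y ⟨by linarith [hy.1], hy.2⟩
  obtain ⟨z, hz, hz'⟩ := exists_hasDerivAt_eq_slope F F' (show x - ρ < x by linarith)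
    (hc.mono h2) fun y hy => hF' y ⟨hy.1, by linarith [hy.2]⟩
  have hy1 := hM y (h1 (Ioo_subset_Icc_self hy))
  have hz1 := hM z (h2 (Ioo_subset_Icc_self hz))
  rw [hy', le_div_iff₀ (by linarith)] at hy1
  rw [hz', le_div_iff₀ (by linarith)] at hz1
  have hx' := abs_le.1 hx
  exact intermediate_value_Icc (by linarith) hc
    ⟨by nlinarith, by nlinarith⟩

theorem exists_resonant_point_near {n : ℕ} (hn : 1 ≤ n) {a b : ℝ} (hab : a < b)
    {f : Fin n → ℝ → ℝ} (hf : ∀ i, ContDiffOn ℝ n (f i) (Icc a b))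
    (hW : ∀ x ∈ Icc a b, (Matrix.of fun i j : Fin n =>
      iteratedDerivWithin ((j : ℕ) + 1) (f i) (Icc a b) x).det ≠ 0)
    {lam : ℝ → ℝ} (hlam : ContDiffOn ℝ 2 lam (Icc a b)) {δ : ℝ} (hδ : 0 < δ) :
    ∃ R > 0, ∃ C > 0, ∃ τ > 0, ∀ (Q x : ℝ), 1 ≤ Q → a ≤ x - R / Q ^ (n + 1) →
      x + R / Q ^ (n + 1) ≤ b → R / Q ^ (n + 1) ≤ τ →
      (∀ w : Fin (n + 1) → ℤ, w ≠ 0 →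
        δ ≤ ‖(flowMatrix Q (homogenize f x)).mulVec fun i => (w i : ℝ)‖) →
      ∃ p ∈ Icc (x - R / Q ^ (n + 1)) (x + R / Q ^ (n + 1)), ∃ (m : ℤ) (c : Fin n → ℤ),
        Q ≤ ‖fun i => (c i : ℝ)‖ ∧ ‖fun i => (c i : ℝ)‖ ≤ C * Q ∧
          ∑ i, (c i : ℝ) * f i p + lam p + m = 0 := by
  have : Nonempty (Fin n) := ⟨⟨0, hn⟩⟩
  have hlam' : ContDiffOn ℝ (2 : ℕ) lam (Icc a b) := by exact_mod_cast hlam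
  set l : ℝ → ℝ := iteratedDerivWithin 1 lam (Icc a b) with hl
  have hlc : ContinuousOn l (Icc a b) :=
    hlam'.continuousOn_iteratedDerivWithin (by norm_num) (uniqueDiffOn_Icc hab)
  set g : ℝ → Fin n → ℝ := fun x i => iteratedDerivWithin 1 (f i) (Icc a b) x with hg
  have hgc : ContinuousOn g (Icc a b) := continuousOn_pi.2 fun i =>
    (hf i).continuousOn_iteratedDerivWithin (by exact_mod_cast hn) (uniqueDiffOn_Icc hab)
  obtain ⟨x₀, hx₀, hmin⟩ := isCompact_Icc.exists_isMinOn (nonempty_Icc.2 hab.le) hgc.norm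
  set c₀ := ‖g x₀‖ with hc₀
  have hc₀pos : 0 < c₀ := by
    refine norm_pos_iff.2 fun h => hW x₀ hx₀ ?_
    refine Matrix.det_eq_zero_of_column_eq_zero ⟨0, hn⟩ fun i => ?_
    exact congrFun h i
  obtain ⟨M, hM⟩ := isCompact_Icc.exists_bound_of_continuousOn hgc
  obtain ⟨L, hL⟩ := isCompact_Icc.exists_bound_of_continuousOn hlc
  have hM0 : 0 < M := hc₀pos.trans_le (hM x₀ hx₀)
  have hL0 : 0 ≤ L := (norm_nonneg _).trans (hL x₀ hx₀)
  obtain ⟨N, hN⟩ := exists_nat_gt (1 / δ ^ (n + 1))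
  set R := δ * N + 1 with hR
  have hR0 : 0 < R := by positivity
  set K := M * (R + 1) + n * R * M + 3 * L + 2 with hK
  have hK0 : 0 < K := by positivity
  set C := R + K / c₀ with hC
  have hC0 : 0 < C := by positivity
  obtain ⟨τ, hτ, hmod⟩ := Metric.uniformContinuousOn_iff_le.1
    (isCompact_Icc.uniformContinuousOn_of_continuous hgc) (1 / (n * C)) (by positivity)
  refine ⟨R, hR0, C, hC0, τ, hτ, fun Q x hQ hax hxb hρτ hshort => ?_⟩
  have hQ0 : 0 < Q := by linarith
  set ρ := R / Q ^ (n + 1) with hρ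
  have hρ0 : 0 < ρ := by positivity
  have hxI : x ∈ Icc a b := ⟨by linarith, by linarith⟩
  obtain ⟨i₀, hi₀⟩ := Finite.exists_max fun i => ‖g x i‖
  have hgi : c₀ ≤ |g x i₀| :=
    (hmin hxI).trans ((pi_norm_le_iff_of_nonneg (norm_nonneg _)).2 hi₀)
  have hgi0 : g x i₀ ≠ 0 := fun h => by rw [h, abs_zero] at hgi; linarith
  obtain ⟨w, hw⟩ := exists_int_near_of_no_short (N := N) hδ (by
      rw [div_lt_iff₀ (by positivity)] at hN
      have : 0 < δ ^ (n + 1) := by positivity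
      linarith) (flowMatrix Q (homogenize f x)) (det_flowMatrix hQ0 _ rfl) hshort
    (Fin.cons (-Q ^ n * lam x) (Pi.single i₀ (K / g x i₀)))
  set c : Fin n → ℤ := fun i => w i.succ with hc
  have hw0 : |Q ^ n * (∑ i, (c i : ℝ) * f i x + lam x + w 0)| ≤ R := by
    refine le_trans (le_of_eq ?_) ((norm_le_pi_norm _ 0).trans hw)
    rw [Pi.sub_apply, flowMatrix_mulVec_zero, Fin.sum_univ_succ, Real.norm_eq_abs]
    simp only [homogenize, Fin.cons_zero, Fin.cons_succ, hc, mul_comm]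
    congr 1
    ring
  set e : Fin n → ℝ := fun i => c i - Q * (Pi.single i₀ (K / g x i₀) : Fin n → ℝ) i with he
  have hwi : ∀ i, |e i| ≤ R * Q := by
    intro i
    have := (norm_le_pi_norm _ i.succ).trans hw
    rw [Pi.sub_apply, flowMatrix_mulVec_ne_zero _ _ _ i.succ_ne_zero, Fin.cons_succ,
      Real.norm_eq_abs] at this
    have h1 : e i = Q * (Q⁻¹ * w i.succ - (Pi.single i₀ (K / g x i₀) : Fin n → ℝ) i) := by
      rw [mul_sub, mul_inv_cancel_left₀ hQ0.ne']
    rw [h1, abs_mul, abs_of_pos hQ0, mul_comm]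
    gcongr
  have hci : ∀ i, (c i : ℝ) = e i + Q * (Pi.single i₀ (K / g x i₀) : Fin n → ℝ) i := by
    intro i; simp only [he]; ring
  have hcup : ‖fun i => (c i : ℝ)‖ ≤ C * Q := by
    refine (pi_norm_le_iff_of_nonneg (by positivity)).2 fun i => ?_
    rw [hci, hC, Real.norm_eq_abs]
    refine (abs_add_le _ _).trans ?_
    have : |(Pi.single i₀ (K / g x i₀) : Fin n → ℝ) i| ≤ K / c₀ := by
      rcases eq_or_ne i i₀ with rfl | hi
      · rw [Pi.single_eq_same, abs_div, abs_of_pos hK0]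
        gcongr
      · rw [Pi.single_eq_of_ne hi, abs_zero]; positivity
    rw [abs_mul, abs_of_pos hQ0]
    have h2 := mul_le_mul_of_nonneg_left this hQ0.le
    linarith [hwi i]
  have hclow : Q ≤ ‖fun i => (c i : ℝ)‖ := by
    refine le_trans ?_ (norm_le_pi_norm _ i₀)
    rw [Real.norm_eq_abs, hci, Pi.single_eq_same]
    have h1 : R + 1 ≤ |K / g x i₀| := by
      rw [abs_div, abs_of_pos hK0, le_div_iff₀ (abs_pos.2 hgi0)]
      have : |g x i₀| ≤ M := (norm_le_pi_norm (g x) i₀).trans (hM x hxI)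
      have h3 : 0 ≤ n * R * M := by positivity
      nlinarith
    have h2 := abs_sub_abs_le_abs_sub (Q * (K / g x i₀)) (-e i₀)
    rw [abs_neg, abs_mul, abs_of_pos hQ0, sub_neg_eq_add, add_comm _ (e i₀)] at h2
    nlinarith [hwi i₀]
  have hsub : Icc (x - ρ) (x + ρ) ⊆ Icc a b := Icc_subset_Icc hax hxb
  suffices h : ∃ p ∈ Icc (x - ρ) (x + ρ),
      formDeriv f a b (w 0) (fun i => (c i : ℝ)) 0 p + lam p = 0 by
    obtain ⟨p, hp, hp0⟩ := h
    refine ⟨p, hp, w 0, c, hclow, hcup, ?_⟩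
    rw [formDeriv_zero] at hp0
    linarith
  refine exists_zero_near_of_deriv_ge (x := x) (ρ := ρ) (M := Q)
    (E := R / Q ^ n)
    (F := fun y => formDeriv f a b (w 0) (fun i => (c i : ℝ)) 0 y + lam y)
    (F' := fun y => formDeriv f a b (w 0) (fun i => (c i : ℝ)) 1 y + l y) hρ0
    ?_ ?_ ?_ ?_ ?_
  · exact (((continuousOn_formDeriv hab hf (Nat.zero_le _) _ _).add hlam.continuousOn).mono hsub)
  · intro y hy
    have hy' : y ∈ Ioo a b := ⟨hax.trans_lt hy.1, hy.2.trans_le hxb⟩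
    refine (hasDerivAt_formDeriv hab hf (by omega) _ _ hy').add ?_
    have := hasDerivWithinAt_iteratedDerivWithin (j := 0) hab hlam' (by norm_num)
      (Ioo_subset_Icc_self hy')
    rw [iteratedDerivWithin_zero] at this
    exact this.hasDerivAt (Icc_mem_nhds hy'.1 hy'.2)
  · intro y hy
    have hyI := hsub hy
    have hform : formDeriv f a b (w 0) (fun i => (c i : ℝ)) 1 y =
        K * Q + ∑ i, e i * g x i + ∑ i, c i * (g y i - g x i) := by
      have h1 : ∑ i, (Q * (Pi.single i₀ (K / g x i₀) : Fin n → ℝ) i) * g x i = K * Q := by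
        rw [Finset.sum_eq_single i₀ (fun i _ hi => by simp [hi]) (by simp), Pi.single_eq_same]
        field_simp
      rw [← h1, ← Finset.sum_add_distrib, ← Finset.sum_add_distrib]
      simp only [formDeriv, one_ne_zero, if_false, zero_add]
      refine Finset.sum_congr rfl fun i _ => ?_
      simp only [he, hg]
      ring
    have h2 : |∑ i, e i * g x i| ≤ n * R * M * Q := by
      refine (Finset.abs_sum_le_sum_abs _ _).trans ?_
      calc ∑ i, |e i * g x i| ≤ ∑ _i : Fin n, R * Q * M := by
            refine Finset.sum_le_sum fun i _ => ?_
            rw [abs_mul]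
            exact mul_le_mul (hwi i) ((norm_le_pi_norm (g x) i).trans (hM x hxI)) (abs_nonneg _)
              (by positivity)
        _ = n * R * M * Q := by
            rw [Finset.sum_const, Finset.card_univ, Fintype.card_fin, nsmul_eq_mul]; ring
    have h3 : |∑ i, c i * (g y i - g x i)| ≤ Q := by
      refine (Finset.abs_sum_le_sum_abs _ _).trans ?_
      have hd := hmod y hyI x hxI (by
        rw [Real.dist_eq, abs_le]
        constructor <;> linarith [hy.1, hy.2])
      rw [dist_eq_norm] at hd
      calc ∑ i, |c i * (g y i - g x i)| ≤ ∑ _i : Fin n, C * Q * (1 / (n * C)) := by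
            refine Finset.sum_le_sum fun i _ => ?_
            rw [abs_mul]
            exact mul_le_mul ((norm_le_pi_norm (fun i => (c i : ℝ)) i).trans hcup)
              ((norm_le_pi_norm (g y - g x) i).trans hd) (abs_nonneg _) (by positivity)
        _ = Q := by
            rw [Finset.sum_const, Finset.card_univ, Fintype.card_fin, nsmul_eq_mul]
            field_simp
    have h4 := hL y hyI
    rw [Real.norm_eq_abs] at h4
    rw [hform]
    have h5 := (abs_le.1 h2).1
    have h6 := (abs_le.1 h3).1
    have h7 := (abs_le.1 h4).1
    have h8 : K * Q = M * (R + 1) * Q + n * R * M * Q + 3 * L * Q + 2 * Q := by rw [hK]; ring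
    have h9 : 0 ≤ M * (R + 1) * Q := by positivity
    have h10 : L ≤ L * Q := le_mul_of_one_le_right hL0 hQ
    nlinarith
  · rw [formDeriv_zero]
    rw [abs_mul, abs_of_pos (by positivity : 0 < Q ^ n), mul_comm] at hw0
    rw [le_div_iff₀ (by positivity)]
    refine le_trans (le_of_eq ?_) hw0
    congr 2
    ring
  · rw [hρ, pow_succ]
    apply le_of_eq
    field_simp

/-- The resonant points of level `Q`: zeros of inhomogeneous forms of height comparable to `Q`. -/
def resonantSet {n : ℕ} (f : Fin n → ℝ → ℝ) (lam : ℝ → ℝ) (C Q : ℝ) : Set ℝ :=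
  {p | ∃ (m : ℤ) (c : Fin n → ℤ), Q ≤ ‖fun i => (c i : ℝ)‖ ∧ ‖fun i => (c i : ℝ)‖ ≤ C * Q ∧
    ∑ i, (c i : ℝ) * f i p + lam p + m = 0}

/-- The resonant points form a ubiquitous system. -/
theorem exists_ubiquity {n : ℕ} (hn : 1 ≤ n) {a b : ℝ} (hab : a < b)
    {f : Fin n → ℝ → ℝ} (hf : ∀ i, ContDiffOn ℝ n (f i) (Icc a b))
    (hW : ∀ x ∈ Icc a b, (Matrix.of fun i j : Fin n =>
      iteratedDerivWithin ((j : ℕ) + 1) (f i) (Icc a b) x).det ≠ 0)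
    {lam : ℝ → ℝ} (hlam : ContDiffOn ℝ 2 lam (Icc a b)) :
    ∃ R > 0, ∃ C > 0, ∃ τ > 0, ∀ u v, a ≤ u → u < v → v ≤ b → v - u ≤ τ → ∃ Q₀ : ℝ, ∀ Q ≥ Q₀,
      ENNReal.ofReal ((v - u) / 2) ≤ volume {x ∈ Icc u v |
        ∃ p ∈ resonantSet f lam C Q ∩ Icc u v, |x - p| ≤ R / Q ^ (n + 1)} := by
  obtain ⟨δ, hδ, τ, hτ, H⟩ := exists_volume_short_vectors_le hn hab hf hW
  obtain ⟨R, hR, C, hC, τ', hτ', H'⟩ := exists_resonant_point_near hn hab hf hW hlam hδ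
  refine ⟨R, hR, C, hC, τ, hτ, fun u v hau huv hvb huvτ => ?_⟩
  obtain ⟨Q₀, hQ₀1, hQ₀⟩ := H u v hau huv hvb huvτ
  set t := min τ' ((v - u) / 16) with ht
  have ht0 : 0 < t := lt_min hτ' (by linarith)
  refine ⟨max Q₀ (R / t), fun Q hQ => ?_⟩
  have hQQ₀ : Q₀ ≤ Q := (le_max_left _ _).trans hQ
  have hQ1 : 1 ≤ Q := hQ₀1.trans hQQ₀
  have hρt : R / Q ^ (n + 1) ≤ t := by
    have h1 := (le_max_right _ _).trans hQ
    rw [div_le_iff₀ ht0] at h1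
    rw [div_le_iff₀ (by positivity)]
    have h2 : Q ≤ Q ^ (n + 1) := le_self_pow₀ hQ1 (by omega)
    nlinarith
  have hρτ : R / Q ^ (n + 1) ≤ τ' := hρt.trans (min_le_left _ _)
  have hρu : R / Q ^ (n + 1) ≤ (v - u) / 16 := hρt.trans (min_le_right _ _)
  have hsub : Icc (u + (v - u) / 16) (v - (v - u) / 16) \
      ({x | ∃ w : Fin (n + 1) → ℤ, w ≠ 0 ∧
        ‖(flowMatrix Q (homogenize f x)).mulVec fun i => (w i : ℝ)‖ < δ} ∩ Icc u v) ⊆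
      {x ∈ Icc u v | ∃ p ∈ resonantSet f lam C Q ∩ Icc u v, |x - p| ≤ R / Q ^ (n + 1)} := by
    rintro x ⟨hx, hxbad⟩
    have hxI : x ∈ Icc u v := ⟨by linarith [hx.1], by linarith [hx.2]⟩
    obtain ⟨p, hp, m, c, h1, h2, h3⟩ := H' Q x hQ1 (by linarith [hx.1]) (by linarith [hx.2]) hρτ
      fun w hw => by
        by_contra! hlt
        exact hxbad ⟨⟨w, hw, hlt⟩, hxI⟩
    refine ⟨hxI, p, ⟨⟨m, c, h1, h2, h3⟩, ?_⟩, ?_⟩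
    · exact ⟨by linarith [hp.1, hx.1], by linarith [hp.2, hx.2]⟩
    · rw [abs_le]
      constructor <;> linarith [hp.1, hp.2]
  refine le_trans ?_ (measure_mono hsub)
  refine le_trans ?_ le_measure_sdiff
  rw [Real.volume_Icc]
  refine le_trans ?_ (tsub_le_tsub_left (hQ₀ Q hQQ₀) _)
  rw [← ENNReal.ofReal_sub _ (by linarith)]
  exact ENNReal.ofReal_le_ofReal (by linarith)

/-- A finite family of points of `Icc u v` with disjoint `ρ`-neighbourhoods is small. -/
theorem card_mul_le_of_pairwiseDisjoint {u v ρ : ℝ} (huv : u ≤ v) (hρ : 0 < ρ) {Y : Finset ℝ}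
    (hY : (Y : Set ℝ) ⊆ Icc u v)
    (hd : (Y : Set ℝ).PairwiseDisjoint fun y => Metric.closedBall y ρ) :
    Y.card * (2 * ρ) ≤ v - u + 2 * ρ := by
  have h1 : volume.real (⋃ y ∈ Y, Metric.closedBall y ρ) = Y.card * (2 * ρ) := by
    rw [measureReal_biUnion_finset hd (fun _ _ => measurableSet_closedBall)
      (fun _ _ => measure_closedBall_lt_top.ne)]
    rw [Finset.sum_congr rfl fun y _ => by rw [Real.volume_real_closedBall hρ.le], Finset.sum_const,
      nsmul_eq_mul]
  have h2 : (⋃ y ∈ Y, Metric.closedBall y ρ) ⊆ Icc (u - ρ) (v + ρ) := by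
    refine iUnion₂_subset fun y hy => ?_
    rw [Real.closedBall_eq_Icc]
    exact Icc_subset_Icc (by linarith [(hY hy).1]) (by linarith [(hY hy).2])
  rw [← h1]
  refine (measureReal_mono h2 measure_Icc_lt_top.ne).trans ?_
  rw [Real.volume_real_Icc_of_le (by linarith)]
  linarith

/-- Maximal separated finite subsets of bounded subsets of the line. -/
theorem exists_separated_finset {A : Set ℝ} {u v ρ : ℝ} (huv : u ≤ v) (hρ : 0 < ρ)
    (hA : A ⊆ Icc u v) :
    ∃ Y : Finset ℝ, (Y : Set ℝ) ⊆ A ∧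
      (Y : Set ℝ).PairwiseDisjoint (fun y => Metric.closedBall y ρ) ∧
      ∀ x ∈ A, ∃ y ∈ Y, |x - y| ≤ 2 * ρ := by
  by_contra! hcon
  have key : ∀ N : ℕ, ∃ Y : Finset ℝ, (Y : Set ℝ) ⊆ A ∧
      (Y : Set ℝ).PairwiseDisjoint (fun y => Metric.closedBall y ρ) ∧ Y.card = N := by
    intro N
    induction N with
    | zero => exact ⟨∅, by simp, by simp, rfl⟩
    | succ N ih =>
      obtain ⟨Y, hYA, hYd, hYN⟩ := ih
      obtain ⟨x, hxA, hx⟩ := hcon Y hYA hYd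
      have hxY : x ∉ Y := fun h => by
        have := hx x h
        rw [sub_self, abs_zero] at this
        linarith
      refine ⟨insert x Y, ?_, ?_, by rw [Finset.card_insert_of_notMem hxY, hYN]⟩
      · rw [Finset.coe_insert]
        exact insert_subset hxA hYA
      · rw [Finset.coe_insert]
        refine hYd.insert fun y hy _ => ?_
        refine Metric.closedBall_disjoint_closedBall ?_
        rw [Real.dist_eq]
        linarith [hx y hy]
  obtain ⟨N, hN⟩ := exists_nat_gt ((v - u + 2 * ρ) / (2 * ρ))
  obtain ⟨Y, hYA, hYd, rfl⟩ := key N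
  rw [div_lt_iff₀ (by positivity)] at hN
  exact (card_mul_le_of_pairwiseDisjoint huv hρ (hYA.trans hA) hYd).not_gt hN

/-- Thickening a finite union of balls by `2ρ` increases the measure by at most `4ρ` per ball. -/
theorem volume_real_thickened_union_le {T : Finset (ℝ × ℝ)} (hT : ∀ t ∈ T, 0 ≤ t.2) {ρ : ℝ}
    (hρ : 0 ≤ ρ) :
    volume.real (⋃ t ∈ T, Metric.closedBall t.1 (t.2 + 2 * ρ)) ≤
      volume.real (⋃ t ∈ T, Metric.closedBall t.1 t.2) + T.card * (4 * ρ) := by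
  have hfin : ∀ r : ℝ × ℝ → ℝ, volume (⋃ t ∈ T, Metric.closedBall t.1 (r t)) ≠ ⊤ := fun r =>
    ((measure_biUnion_finset_le _ _).trans_lt
      (ENNReal.sum_lt_top.2 fun _ _ => measure_closedBall_lt_top)).ne
  have hfin' : volume (⋃ t ∈ T, (Metric.closedBall t.1 (t.2 + 2 * ρ) \ Metric.closedBall t.1 t.2))
      ≠ ⊤ := measure_ne_top_of_subset (iUnion₂_mono fun _ _ => sdiff_subset) (hfin _)
  have hsub : (⋃ t ∈ T, Metric.closedBall t.1 (t.2 + 2 * ρ)) ⊆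
      (⋃ t ∈ T, Metric.closedBall t.1 t.2) ∪
        ⋃ t ∈ T, (Metric.closedBall t.1 (t.2 + 2 * ρ) \ Metric.closedBall t.1 t.2) := by
    intro x hx
    simp only [mem_iUnion, mem_union] at hx ⊢
    obtain ⟨t, ht, hx⟩ := hx
    by_cases h : x ∈ Metric.closedBall t.1 t.2
    · exact Or.inl ⟨t, ht, h⟩
    · exact Or.inr ⟨t, ht, hx, h⟩
  refine (measureReal_mono hsub (measure_union_ne_top (hfin _) hfin')).trans ?_
  refine (measureReal_union_le _ _).trans ?_
  gcongr
  refine (measureReal_biUnion_finset_le _ _).trans ?_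
  rw [← nsmul_eq_mul]
  refine Finset.sum_le_card_nsmul _ _ _ fun t ht => ?_
  have h0 := hT t ht
  rw [measureReal_sdiff (Metric.closedBall_subset_closedBall (by linarith))
    measurableSet_closedBall measure_closedBall_lt_top.ne, Real.volume_real_closedBall h0,
    Real.volume_real_closedBall (by linarith)]
  linarith

/-- One step of the covering construction. -/
theorem exists_disjoint_balls_of_level {P : Set ℝ} {u v ρ r : ℝ} (huv : u < v) (hρ : 0 < ρ)
    (hρuv : 2 * ρ ≤ v - u) (hr0 : 0 ≤ r) (hr : r ≤ ρ)
    (hP : ENNReal.ofReal ((v - u) / 2) ≤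
      volume {x ∈ Icc u v | ∃ p ∈ P ∩ Icc u v, |x - p| ≤ ρ})
    {T : Finset (ℝ × ℝ)} (hT : ∀ t ∈ T, 0 ≤ t.2) (hTρ : T.card * ρ ≤ (v - u) / 32)
    (hTv : volume.real (⋃ t ∈ T, Metric.closedBall t.1 t.2) ≤ (v - u) / 8) :
    ∃ Y : Finset ℝ, (Y : Set ℝ) ⊆ P ∩ Icc u v ∧ Y.card * ρ ≤ v - u ∧
      volume.real (⋃ t ∈ T, Metric.closedBall t.1 t.2) + (v - u) / 12 * (r / ρ) ≤
        volume.real ((⋃ t ∈ T, Metric.closedBall t.1 t.2) ∪ ⋃ y ∈ Y, Metric.closedBall y r) := by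
  set E := ⋃ t ∈ T, Metric.closedBall t.1 t.2 with hE
  set N := ⋃ t ∈ T, Metric.closedBall t.1 (t.2 + 2 * ρ) with hN
  set G := {x ∈ Icc u v | ∃ p ∈ P ∩ Icc u v, |x - p| ≤ ρ} with hG
  have hEm : MeasurableSet E := T.measurableSet_biUnion fun _ _ => measurableSet_closedBall
  have hEf : volume E ≠ ⊤ := ((measure_biUnion_finset_le _ _).trans_lt
      (ENNReal.sum_lt_top.2 fun _ _ => measure_closedBall_lt_top)).ne
  have hGf : volume G ≠ ⊤ := measure_ne_top_of_subset (sep_subset _ _) measure_Icc_lt_top.ne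
  have hNf : volume N ≠ ⊤ := ((measure_biUnion_finset_le _ _).trans_lt
      (ENNReal.sum_lt_top.2 fun _ _ => measure_closedBall_lt_top)).ne
  have hNv : volume.real N ≤ (v - u) / 4 := by
    have := volume_real_thickened_union_le hT hρ.le
    linarith
  have hGv : (v - u) / 2 ≤ volume.real G := (ENNReal.ofReal_le_iff_le_toReal hGf).1 hP
  set A := {p ∈ P ∩ Icc u v | Disjoint (Metric.closedBall p r) E} with hA
  obtain ⟨Y, hYA, hYd, hYc⟩ := exists_separated_finset huv.le hρ
    (show A ⊆ Icc u v from fun p hp => hp.1.2)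
  have hYJ : (Y : Set ℝ) ⊆ Icc u v := fun p hp => (hYA hp).1.2
  refine ⟨Y, fun p hp => (hYA hp).1, ?_, ?_⟩
  · have := card_mul_le_of_pairwiseDisjoint huv.le hρ hYJ hYd
    linarith
  have hcov : G ⊆ N ∪ ⋃ y ∈ Y, Metric.closedBall y (3 * ρ) := by
    rintro x ⟨hxJ, p, hp, hxp⟩
    by_cases hxN : x ∈ N
    · exact Or.inl hxN
    right
    have hpA : p ∈ A := by
      refine ⟨hp, Set.disjoint_left.2 fun z hz hzE => hxN ?_⟩
      simp only [hE, hN, mem_iUnion, Metric.mem_closedBall, Real.dist_eq] at hzE hz ⊢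
      obtain ⟨t, ht, hzt⟩ := hzE
      refine ⟨t, ht, ?_⟩
      calc |x - t.1| = |(x - p) - (z - p) + (z - t.1)| := by ring_nf
        _ ≤ |x - p| + |z - p| + |z - t.1| := (abs_add_le _ _).trans (by gcongr; exact abs_sub _ _)
        _ ≤ _ := by linarith
    obtain ⟨y, hy, hpy⟩ := hYc p hpA
    simp only [mem_iUnion, Metric.mem_closedBall, Real.dist_eq]
    refine ⟨y, hy, (abs_sub_le x p y).trans (by linarith)⟩
  have hYv : (v - u) / 4 ≤ Y.card * (6 * ρ) := by
    have h1 : volume.real (⋃ y ∈ Y, Metric.closedBall y (3 * ρ)) ≤ Y.card * (6 * ρ) := by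
      refine (measureReal_biUnion_finset_le _ _).trans ?_
      rw [← nsmul_eq_mul]
      refine Finset.sum_le_card_nsmul _ _ _ fun y _ => ?_
      rw [Real.volume_real_closedBall (by positivity)]
      linarith
    have h2 := (measureReal_mono hcov (measure_union_ne_top hNf
      ((measure_biUnion_finset_le _ _).trans_lt
      (ENNReal.sum_lt_top.2 fun _ _ => measure_closedBall_lt_top)).ne)).trans
        (measureReal_union_le _ _)
    linarith
  have hdisj : Disjoint E (⋃ y ∈ Y, Metric.closedBall y r) := by
    simp only [disjoint_iUnion_right]
    exact fun y hy => (hYA hy).2.symm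
  rw [measureReal_union hdisj (Y.measurableSet_biUnion fun _ _ => measurableSet_closedBall) hEf
    ((measure_biUnion_finset_le _ _).trans_lt
      (ENNReal.sum_lt_top.2 fun _ _ => measure_closedBall_lt_top)).ne,
    measureReal_biUnion_finset
      (fun y hy z hz hyz => (hYd hy hz hyz).mono (Metric.closedBall_subset_closedBall hr)
        (Metric.closedBall_subset_closedBall hr)) (fun _ _ => measurableSet_closedBall)
      (fun _ _ => measure_closedBall_lt_top.ne),
    Finset.sum_congr rfl fun y _ => by rw [Real.volume_real_closedBall hr0], Finset.sum_const,
    nsmul_eq_mul]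
  refine add_le_add le_rfl ?_
  rw [mul_div_assoc', div_le_iff₀ hρ]
  nlinarith

/-- A family of balls whose `ρ`-enlargements are locally ubiquitous covers a fixed proportion of
every small interval. -/
theorem volume_diff_balls_le {P : ℕ → Set ℝ} {ρ r : ℕ → ℝ} (hρ : ∀ k, 0 < ρ k)
    (hρ' : ∀ k, ρ (k + 1) ≤ ρ k / 40) (hr0 : ∀ k, 0 ≤ r k) (hr : ∀ k, r k ≤ ρ k)
    (hdiv : ¬ Summable fun k => r k / ρ k) {u v : ℝ} (huv : u < v) {k₀ : ℕ}
    (hP : ∀ k ≥ k₀, ENNReal.ofReal ((v - u) / 2) ≤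
      volume {x ∈ Icc u v | ∃ p ∈ P k ∩ Icc u v, |x - p| ≤ ρ k}) (m : ℕ) :
    volume (Icc u v \ ⋃ k ≥ m, ⋃ p ∈ P k ∩ Icc u v, Metric.closedBall p (r k)) ≤
      ENNReal.ofReal (15 / 16 * (v - u)) := by
  have hρanti : Antitone ρ := antitone_nat_of_succ_le fun k => by linarith [hρ' k, hρ k]
  have hρgeo : ∀ k, ρ k ≤ ρ 0 * (1 / 40) ^ k := by
    intro k
    induction k with
    | zero => simp
    | succ k ih => rw [pow_succ]; linarith [hρ' k]
  have hρlim : Tendsto ρ atTop (nhds 0) := by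
    refine squeeze_zero (fun k => (hρ k).le) hρgeo ?_
    simpa using (tendsto_pow_atTop_nhds_zero_of_lt_one (r := (1 / 40 : ℝ)) (by norm_num)
      (by norm_num)).const_mul (ρ 0)
  obtain ⟨m₀, hm₀⟩ := eventually_atTop.1
    (hρlim.eventually_lt_const (show (0 : ℝ) < (v - u) / 64 by linarith))
  set M := max m (max k₀ m₀) with hM
  have hMm : m ≤ M := le_max_left _ _
  have hMk : k₀ ≤ M := (le_max_left _ _).trans (le_max_right _ _)
  have hρM : ∀ k, ρ (M + k) ≤ (v - u) / 64 := fun k =>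
    (hm₀ _ (((le_max_right _ _).trans (le_max_right _ _)).trans (Nat.le_add_right _ _))).le
  have key : ∀ i : ℕ, ∃ T : Finset (ℝ × ℝ), (∀ t ∈ T, ∃ k ≥ M, t.1 ∈ P k ∩ Icc u v ∧ t.2 = r k) ∧
      T.card * ρ (M + i) ≤ (v - u) / 32 ∧
      min ((v - u) / 8) ((v - u) / 12 * ∑ j ∈ Finset.range i, r (M + j) / ρ (M + j)) ≤
        volume.real (⋃ t ∈ T, Metric.closedBall t.1 t.2) := by
    intro i
    induction i with
    | zero =>
      refine ⟨∅, by simp, by simp; linarith, by simp⟩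
    | succ i ih =>
      obtain ⟨T, hT, hTρ, hTv⟩ := ih
      rcases le_or_gt ((v - u) / 8) (volume.real (⋃ t ∈ T, Metric.closedBall t.1 t.2)) with h | h
      · refine ⟨T, hT, le_trans ?_ hTρ, (min_le_left _ _).trans h⟩
        gcongr
        exact hρanti (by omega)
      · obtain ⟨Y, hYP, hYρ, hYv⟩ := exists_disjoint_balls_of_level huv (hρ (M + i))
          (by linarith [hρM i]) (hr0 _) (hr _) (hP (M + i) (by omega))
          (fun t ht => by obtain ⟨k, -, -, hk⟩ := hT t ht; rw [hk]; exact hr0 k) hTρ h.le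
        refine ⟨T ∪ Y.image fun y => (y, r (M + i)), ?_, ?_, ?_⟩
        · intro t ht
          rcases Finset.mem_union.1 ht with ht | ht
          · exact hT t ht
          · obtain ⟨y, hy, rfl⟩ := Finset.mem_image.1 ht
            exact ⟨M + i, by omega, hYP hy, rfl⟩
        · have h1 : ((T ∪ Y.image fun y => (y, r (M + i))).card : ℝ) ≤ T.card + Y.card := by
            exact_mod_cast (Finset.card_union_le _ _).trans
              (Nat.add_le_add_left Finset.card_image_le _)
          have h2 := hρ' (M + i)
          calc _ ≤ ((T.card : ℝ) + Y.card) * (ρ (M + i) / 40) := by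
                gcongr
                · exact (hρ _).le
                · exact h2
            _ ≤ _ := by linarith
        · refine (min_le_right _ _).trans ?_
          rw [Finset.sum_range_succ, mul_add]
          rw [min_le_iff] at hTv
          rw [Finset.set_biUnion_union, Finset.set_biUnion_finset_image]
          refine le_trans ?_ hYv
          gcongr
          exact hTv.resolve_left (not_le.2 h)
  obtain ⟨i, hi⟩ : ∃ i, 3 / 2 < ∑ j ∈ Finset.range i, r (M + j) / ρ (M + j) := by
    have h1 : ¬ Summable fun j => r (M + j) / ρ (M + j) := by
      intro h
      refine hdiv ((summable_nat_add_iff M).1 ?_)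
      simpa only [add_comm] using h
    have h2 := (not_summable_iff_tendsto_nat_atTop_of_nonneg
      fun j => div_nonneg (hr0 (M + j)) (hρ (M + j)).le).1 h1
    exact (h2.eventually_gt_atTop _).exists
  obtain ⟨T, hT, -, hTv⟩ := key i
  rw [min_eq_left (by nlinarith)] at hTv
  set W := ⋃ t ∈ T, Metric.closedBall t.1 t.2 with hW
  have hWm : MeasurableSet W := T.measurableSet_biUnion fun _ _ => measurableSet_closedBall
  have hWsub : W ⊆ Icc (u - (v - u) / 64) (v + (v - u) / 64) := by
    refine iUnion₂_subset fun t ht => ?_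
    obtain ⟨k, hk, hp, h2⟩ := hT t ht
    rw [Real.closedBall_eq_Icc, h2]
    have h3 := hρM (k - M)
    rw [Nat.add_sub_cancel' hk] at h3
    have := hr k
    exact Icc_subset_Icc (by linarith [hp.2.1]) (by linarith [hp.2.2])
  have hsub : Icc u v \ (⋃ k ≥ m, ⋃ p ∈ P k ∩ Icc u v, Metric.closedBall p (r k)) ⊆
      Icc (u - (v - u) / 64) (v + (v - u) / 64) \ W := by
    rintro x ⟨hx, hxU⟩
    refine ⟨⟨by linarith [hx.1], by linarith [hx.2]⟩, fun hxW => hxU ?_⟩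
    simp only [hW, mem_iUnion] at hxW ⊢
    obtain ⟨t, ht, hxt⟩ := hxW
    obtain ⟨k, hk, hp, h2⟩ := hT t ht
    exact ⟨k, hMm.trans hk, t.1, hp, h2 ▸ hxt⟩
  refine (measure_mono hsub).trans ?_
  rw [ENNReal.le_ofReal_iff_toReal_le (measure_ne_top_of_subset sdiff_subset measure_Icc_lt_top.ne)
    (by linarith)]
  change volume.real _ ≤ _
  rw [measureReal_sdiff hWsub hWm measure_Icc_lt_top.ne, Real.volume_real_Icc_of_le (by linarith)]
  linarith

/-- A locally ubiquitous system of balls with divergent relative radii has full measure. -/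
theorem volume_diff_balls_eq_zero {P : ℕ → Set ℝ} {ρ r : ℕ → ℝ} (hρ : ∀ k, 0 < ρ k)
    (hρ' : ∀ k, ρ (k + 1) ≤ ρ k / 40) (hr0 : ∀ k, 0 ≤ r k) (hr : ∀ k, r k ≤ ρ k)
    (hdiv : ¬ Summable fun k => r k / ρ k) {a b τ : ℝ} (hτ : 0 < τ)
    (hP : ∀ u v, a ≤ u → u < v → v ≤ b → v - u ≤ τ → ∃ k₀, ∀ k ≥ k₀,
      ENNReal.ofReal ((v - u) / 2) ≤
      volume {x ∈ Icc u v | ∃ p ∈ P k ∩ Icc u v, |x - p| ≤ ρ k}) (m : ℕ) :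
    volume (Icc a b \ ⋃ k ≥ m, ⋃ p ∈ P k ∩ Icc a b, Metric.closedBall p (r k)) = 0 := by
  set U := ⋃ k ≥ m, ⋃ p ∈ P k ∩ Icc a b, Metric.closedBall p (r k) with hU
  by_contra hne
  have hne' : volume (Ioo a b \ U) ≠ 0 := by
    refine fun h => hne (measure_mono_null (t := (Ioo a b \ U) ∪ {a, b}) ?_
      (measure_union_null h ((Set.toFinite _).measure_zero _)))
    rintro x ⟨hx, hxU⟩
    by_cases hxa : x = a
    · exact Or.inr (Or.inl hxa)
    by_cases hxb : x = b
    · exact Or.inr (Or.inr hxb)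
    exact Or.inl ⟨⟨lt_of_le_of_ne hx.1 (Ne.symm hxa), lt_of_le_of_ne hx.2 hxb⟩, hxU⟩
  have hdens := Besicovitch.ae_tendsto_measure_inter_div (volume : Measure ℝ) (Ioo a b \ U)
  obtain ⟨x, hxA, hx⟩ : ∃ x ∈ Ioo a b \ U, Tendsto (fun t => volume ((Ioo a b \ U) ∩
      Metric.closedBall x t) / volume (Metric.closedBall x t)) (nhdsWithin 0 (Ioi 0)) (nhds 1) := by
    by_contra! hcon
    refine hne' ?_
    rw [ae_iff] at hdens
    have h1 : volume.restrict (Ioo a b \ U) (Ioo a b \ U) = 0 :=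
      measure_mono_null (fun x hx => hcon x hx) hdens
    rwa [Measure.restrict_apply_self] at h1
  have hlow := hx.eventually_const_lt (show ENNReal.ofReal (15 / 16) < 1 by
    rw [← ENNReal.ofReal_one]
    exact (ENNReal.ofReal_lt_ofReal_iff one_pos).2 (by norm_num))
  have hpos : 0 < min (min (x - a) (b - x)) (τ / 2) :=
    lt_min (lt_min (by linarith [hxA.1.1]) (by linarith [hxA.1.2])) (by linarith)
  obtain ⟨t, ht, ht0, ht1⟩ := (hlow.and (Ioo_mem_nhdsGT hpos)).exists
  have hta : t < x - a := ht1.trans_le ((min_le_left _ _).trans (min_le_left _ _))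
  have htb : t < b - x := ht1.trans_le ((min_le_left _ _).trans (min_le_right _ _))
  have htτ : t < τ / 2 := ht1.trans_le (min_le_right _ _)
  obtain ⟨k₀, hk₀⟩ := hP (x - t) (x + t) (by linarith) (by linarith) (by linarith) (by linarith)
  have hle := volume_diff_balls_le hρ hρ' hr0 hr hdiv (by linarith) hk₀ m
  rw [Real.closedBall_eq_Icc, Real.volume_Icc,
    ENNReal.lt_div_iff_mul_lt (Or.inr (by simp)) (Or.inr (by simp)),
    ← ENNReal.ofReal_mul (by norm_num)] at ht
  refine (ht.trans_le ((measure_mono ?_).trans hle)).false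
  rintro y ⟨⟨-, hyU⟩, hy⟩
  refine ⟨hy, fun h => hyU ?_⟩
  simp only [hU, mem_iUnion] at h ⊢
  obtain ⟨k, hk, p, hp, hyp⟩ := h
  exact ⟨k, hk, p, ⟨hp.1, by linarith [hp.2.1], by linarith [hp.2.2]⟩, hyp⟩

/-- Small radii are negligible compared with their `s`-th powers. -/
theorem exists_pos_mul_le_rpow {s : ℝ} (hs1 : s < 1) {C : ℝ} (hC : 0 < C) :
    ∃ t > 0, ∀ x : ℝ, 0 < x → x ≤ t → C * x ≤ x ^ s := by
  refine ⟨(1 / C) ^ (1 / (1 - s)), by positivity, fun x hx hxt => ?_⟩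
  have h1 : x ^ (1 - s) ≤ 1 / C := by
    refine (Real.rpow_le_rpow hx.le hxt (by linarith)).trans_eq ?_
    rw [← Real.rpow_mul (by positivity), one_div_mul_cancel (by linarith), Real.rpow_one]
  have h2 : x = x ^ s * x ^ (1 - s) := by
    rw [← Real.rpow_add hx, add_sub_cancel, Real.rpow_one]
  have h3 : 0 < x ^ s := Real.rpow_pos_of_pos hx s
  rw [le_div_iff₀ hC] at h1
  calc C * x = x ^ s * (x ^ (1 - s) * C) := by nth_rewrite 1 [h2]; ring
    _ ≤ x ^ s * 1 := by gcongr
    _ = x ^ s := mul_one _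

/-- Finite disjoint families of balls, centred at prescribed points of high level, almost exhaust
open sets. -/
theorem exists_finite_disjoint_balls {P : ℕ → Set ℝ} {R : ℕ → ℝ} (hR0 : ∀ k, 0 < R k)
    (hR : Tendsto R atTop (nhds 0)) {a b : ℝ}
    (hfull : ∀ m, volume (Icc a b \ ⋃ k ≥ m, ⋃ p ∈ P k ∩ Icc a b, Metric.closedBall p (R k)) = 0)
    {O : Set ℝ} (hO : IsOpen O) (hOab : O ⊆ Icc a b) (m : ℕ) {ε : ENNReal} (hε : ε ≠ 0) :
    ∃ F : Finset (ℝ × ℕ),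
      (∀ t ∈ F, m ≤ t.2 ∧ t.1 ∈ P t.2 ∩ Icc a b ∧ Metric.closedBall t.1 (R t.2) ⊆ O) ∧
      (F : Set (ℝ × ℕ)).PairwiseDisjoint (fun t => Metric.closedBall t.1 (R t.2)) ∧
      volume (O \ ⋃ t ∈ F, Metric.closedBall t.1 (R t.2)) ≤ ε := by
  set L : Set ℝ := ⋂ m, ⋃ k ≥ m, ⋃ p ∈ P k ∩ Icc a b, Metric.closedBall p (R k) with hL
  have hOL : volume (O \ L) = 0 := by
    rw [hL, sdiff_iInter]
    exact measure_iUnion_null fun m => measure_mono_null (sdiff_subset_sdiff_left hOab) (hfull m)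
  set I : Set (ℝ × (ℝ × ℕ)) := {t | m ≤ t.2.2 ∧ t.2.1 ∈ P t.2.2 ∩ Icc a b ∧
    Metric.closedBall t.2.1 (R t.2.2) ⊆ O ∧ t.1 ∈ Metric.closedBall t.2.1 (R t.2.2)} with hI
  obtain ⟨u, huI, huc, hud, huv⟩ := Vitali.exists_disjoint_covering_ae volume (O ∩ L) I 6
    (fun t => 2 * R t.2.2) (fun t => t.1) (fun t => Metric.closedBall t.2.1 (R t.2.2))
    (fun t ht y hy => by
      have h1 := ht.2.2.2
      rw [Metric.mem_closedBall] at hy h1 ⊢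
      rw [dist_comm] at h1
      linarith [dist_triangle y t.2.1 t.1])
    (fun t _ => by
      rw [Real.volume_closedBall, Real.volume_closedBall,
        show ((6 : NNReal) : ENNReal) = ENNReal.ofReal 6 by norm_num,
        ← ENNReal.ofReal_mul (by norm_num)]
      exact ENNReal.ofReal_le_ofReal (by linarith))
    (fun t _ => ⟨t.2.1, Metric.ball_subset_interior_closedBall (Metric.mem_ball_self (hR0 _))⟩)
    (fun t _ => Metric.isClosed_closedBall)
    (by
      rintro x ⟨hxO, hxL⟩ e he
      obtain ⟨δ, hδ, hδO⟩ := Metric.isOpen_iff.1 hO x hxO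
      obtain ⟨m₁, hm₁⟩ := eventually_atTop.1
        (hR.eventually_lt_const (show 0 < min (e / 2) (δ / 2) by positivity))
      have h1 := mem_iInter.1 hxL (max m m₁)
      simp only [mem_iUnion] at h1
      obtain ⟨k, hk, p, hp, hxp⟩ := h1
      have h2 := hm₁ k ((le_max_right _ _).trans hk)
      have h3 := h2.trans_le (min_le_left _ _)
      have h4 := h2.trans_le (min_le_right _ _)
      refine ⟨(x, (p, k)), ⟨(le_max_left _ _).trans hk, hp, fun y hy => hδO ?_, hxp⟩,
        by dsimp only; linarith, rfl⟩
      rw [Metric.mem_closedBall] at hy hxp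
      rw [dist_comm] at hxp
      rw [Metric.mem_ball]
      dsimp only at hy
      linarith [dist_triangle y p x])
  have hOf : volume O ≠ ⊤ := measure_ne_top_of_subset hOab measure_Icc_lt_top.ne
  have hOu : volume O ≤ ∑' t : u, volume (Metric.closedBall t.1.2.1 (R t.1.2.2)) := by
    rw [← measure_biUnion huc hud fun _ _ => measurableSet_closedBall]
    refine (measure_mono (t := (⋃ t ∈ u, Metric.closedBall t.2.1 (R t.2.2)) ∪
      ((O \ L) ∪ ((O ∩ L) \ ⋃ t ∈ u, Metric.closedBall t.2.1 (R t.2.2)))) ?_).trans ?_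
    · intro x hx
      by_cases h1 : x ∈ ⋃ t ∈ u, Metric.closedBall t.2.1 (R t.2.2)
      · exact Or.inl h1
      by_cases h2 : x ∈ L
      · exact Or.inr (Or.inr ⟨⟨hx, h2⟩, h1⟩)
      · exact Or.inr (Or.inl ⟨hx, h2⟩)
    · refine (measure_union_le _ _).trans ?_
      rw [measure_union_null hOL huv, add_zero]
  obtain ⟨S, hS⟩ : ∃ S : Finset u,
      volume O ≤ ∑ t ∈ S, volume (Metric.closedBall t.1.2.1 (R t.1.2.2)) + ε := by
    by_contra! hcon
    have h1 : ∑' t : u, volume (Metric.closedBall t.1.2.1 (R t.1.2.2)) + ε ≤ volume O := by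
      rw [ENNReal.tsum_eq_iSup_sum, ENNReal.iSup_add]
      exact iSup_le fun S => (hcon S).le
    exact (ENNReal.lt_add_right hOf hε).not_ge ((add_le_add_left hOu ε).trans h1)
  have hinj : Set.InjOn (fun t : u => t.1.2) (S : Set u) := by
    intro t _ t' _ h
    by_contra hne
    have := hud t.2 t'.2 (fun h' => hne (Subtype.ext h'))
    simp only [Function.onFun] at this
    dsimp only at h
    rw [h, disjoint_self] at this
    exact (Metric.nonempty_closedBall.2 (hR0 t'.1.2.2).le).ne_empty this
  classical
  have hd : ((S.image fun t => t.1.2 : Finset (ℝ × ℕ)) : Set (ℝ × ℕ)).PairwiseDisjoint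
      (fun t => Metric.closedBall t.1 (R t.2)) := by
    rw [Finset.coe_image]
    rintro _ ⟨t, -, rfl⟩ _ ⟨t', -, rfl⟩ hne
    exact hud t.2 t'.2 fun h' => hne (congrArg Prod.snd h')
  refine ⟨S.image fun t => t.1.2, ?_, hd, ?_⟩
  · intro t ht
    obtain ⟨t', -, rfl⟩ := Finset.mem_image.1 ht
    have := huI t'.2
    exact ⟨this.1, this.2.1, this.2.2.1⟩
  · have hsub : (⋃ t ∈ S.image fun t => t.1.2, Metric.closedBall t.1 (R t.2)) ⊆ O := by
      refine iUnion₂_subset fun t ht => ?_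
      obtain ⟨t', -, rfl⟩ := Finset.mem_image.1 ht
      exact (huI t'.2).2.2.1
    rw [measure_sdiff hsub
      (Finset.measurableSet_biUnion _ fun _ _ => measurableSet_closedBall).nullMeasurableSet
      (measure_ne_top_of_subset hsub hOf), measure_biUnion_finset hd
      fun _ _ => measurableSet_closedBall, Finset.sum_image hinj, tsub_le_iff_right, add_comm]
    exact hS

/-- Moving the mass of each ball `closedBall t.1 (R t.2)` uniformly onto `ball t.1 (r t.2)`. -/
noncomputable def concentrate (μ : Measure ℝ) (F : Finset (ℝ × ℕ)) (R r : ℕ → ℝ) : Measure ℝ :=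
  ∑ t ∈ F, (μ (Metric.closedBall t.1 (R t.2)) / volume (Metric.ball t.1 (r t.2))) •
    volume.restrict (Metric.ball t.1 (r t.2))

theorem concentrate_apply (μ : Measure ℝ) (F : Finset (ℝ × ℕ)) (R r : ℕ → ℝ) {A : Set ℝ}
    (hA : MeasurableSet A) :
    concentrate μ F R r A = ∑ t ∈ F, μ (Metric.closedBall t.1 (R t.2)) /
      volume (Metric.ball t.1 (r t.2)) * volume (A ∩ Metric.ball t.1 (r t.2)) := by
  simp [concentrate, Measure.restrict_apply hA]

theorem volume_real_ball_ne_zero {x r : ℝ} (hr : 0 < r) : volume (Metric.ball x r) ≠ 0 :=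
  (Metric.measure_ball_pos volume x hr).ne'

theorem concentrate_term_le (μ : Measure ℝ) {p R r : ℝ} (A : Set ℝ) :
    μ (Metric.closedBall p R) / volume (Metric.ball p r) * volume (A ∩ Metric.ball p r) ≤
      μ (Metric.closedBall p R) := by
  refine (mul_le_mul_right (measure_mono inter_subset_right) _).trans ?_
  exact ENNReal.mul_le_of_le_div le_rfl

/-- A concentrated measure still has bounded density. -/
theorem exists_concentrate_le (μ : Measure ℝ) [IsLocallyFiniteMeasure μ] (F : Finset (ℝ × ℕ))
    (R : ℕ → ℝ) {r : ℕ → ℝ} (hr : ∀ k, 0 < r k) :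
    ∃ D > 0, ∀ A, concentrate μ F R r A ≤ ENNReal.ofReal D * volume A := by
  set c : ENNReal := ∑ t ∈ F, μ (Metric.closedBall t.1 (R t.2)) / volume (Metric.ball t.1 (r t.2))
    with hc
  have hcf : c ≠ ⊤ := (ENNReal.sum_lt_top.2 fun t _ => ENNReal.div_lt_top
    (isCompact_closedBall _ _).measure_lt_top.ne (volume_real_ball_ne_zero (hr _))).ne
  refine ⟨c.toReal + 1, by positivity, fun A => ?_⟩
  have h1 : concentrate μ F R r A ≤ c * volume A := by
    simp only [concentrate, Measure.coe_finsetSum, Finset.sum_apply, Measure.smul_apply,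
      smul_eq_mul, hc, Finset.sum_mul]
    gcongr
    exact Measure.restrict_le_self
  refine h1.trans ?_
  gcongr
  rw [ENNReal.le_ofReal_iff_toReal_le hcf (by positivity)]
  linarith

/-- The mass of the balls is preserved. -/
theorem concentrate_union (μ : Measure ℝ) {F : Finset (ℝ × ℕ)} {R r : ℕ → ℝ}
    (hr : ∀ k, 0 < r k)
    (hd : (F : Set (ℝ × ℕ)).PairwiseDisjoint (fun t => Metric.closedBall t.1 (R t.2))) :
    μ (⋃ t ∈ F, Metric.closedBall t.1 (R t.2)) ≤
      concentrate μ F R r (⋃ t ∈ F, Metric.ball t.1 (r t.2)) := by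
  rw [concentrate_apply _ _ _ _ (F.measurableSet_biUnion fun _ _ => measurableSet_ball),
    measure_biUnion_finset hd fun _ _ => measurableSet_closedBall]
  refine Finset.sum_le_sum fun t ht => ?_
  have hsub : Metric.ball t.1 (r t.2) ⊆ ⋃ t ∈ F, Metric.ball t.1 (r t.2) := fun x hx => by
    simp only [mem_iUnion]
    exact ⟨t, ht, hx⟩
  rw [inter_eq_self_of_subset_right hsub, ENNReal.div_mul_cancel (volume_real_ball_ne_zero (hr _))
    measure_ball_lt_top.ne]

/-- Terms for balls not meeting the test ball vanish, and the others are bounded by the mass of the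
large balls. -/
theorem concentrate_ball_le (μ : Measure ℝ) {F : Finset (ℝ × ℕ)} {R r : ℕ → ℝ}
    (hd : (F : Set (ℝ × ℕ)).PairwiseDisjoint (fun t => Metric.closedBall t.1 (R t.2)))
    {x e : ℝ} {W : Set ℝ} (hW : ∀ t ∈ F, |x - t.1| < e + r t.2 →
      Metric.closedBall t.1 (R t.2) ⊆ W) :
    concentrate μ F R r (Metric.ball x e) ≤ μ W := by
  classical
  rw [concentrate_apply _ _ _ _ measurableSet_ball,
    ← Finset.sum_filter_add_sum_filter_not F fun t => |x - t.1| < e + r t.2]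
  have h0 : ∑ t ∈ F with ¬ |x - t.1| < e + r t.2, μ (Metric.closedBall t.1 (R t.2)) /
      volume (Metric.ball t.1 (r t.2)) *
        volume (Metric.ball x e ∩ Metric.ball t.1 (r t.2)) = 0 := by
    refine Finset.sum_eq_zero fun t ht => ?_
    have h1 := (Finset.mem_filter.1 ht).2
    have h2 : Metric.ball x e ∩ Metric.ball t.1 (r t.2) = ∅ :=
      (Metric.ball_disjoint_ball (by rw [Real.dist_eq]; exact not_lt.1 h1)).inter_eq
    rw [h2, measure_empty, mul_zero]
  rw [h0, add_zero]
  calc _ ≤ ∑ t ∈ F with |x - t.1| < e + r t.2, μ (Metric.closedBall t.1 (R t.2)) :=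
        Finset.sum_le_sum fun t _ => concentrate_term_le μ _
    _ = μ (⋃ t ∈ F.filter fun t => |x - t.1| < e + r t.2, Metric.closedBall t.1 (R t.2)) := by
        rw [measure_biUnion_finset (hd.subset fun t ht => (Finset.mem_filter.1 ht).1)
          fun _ _ => measurableSet_closedBall]
    _ ≤ μ W := measure_mono (iUnion₂_subset fun t ht =>
        hW t (Finset.mem_filter.1 ht).1 (Finset.mem_filter.1 ht).2)

/-- The contribution of a single ball. -/
theorem concentrate_term_le_rpow {μ : Measure ℝ} {D : ℝ} (hD : 0 < D)
    (hμ : ∀ A, μ A ≤ ENNReal.ofReal D * volume A) {s : ℝ} (hs0 : 0 < s) (hs1 : s ≤ 1)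
    {η p r x e : ℝ} (hη : 0 < η) (hr : 0 < r) (he : 0 < e) :
    μ (Metric.closedBall p (η * r ^ s)) / volume (Metric.ball p r) *
      volume (Metric.ball x e ∩ Metric.ball p r) ≤ ENNReal.ofReal (2 * D * η * e ^ s) := by
  have hrs : 0 < r ^ s := Real.rpow_pos_of_pos hr s
  have hes : 0 < e ^ s := Real.rpow_pos_of_pos he s
  have h1 : μ (Metric.closedBall p (η * r ^ s)) ≤ ENNReal.ofReal (D * (2 * (η * r ^ s))) := by
    refine (hμ _).trans_eq ?_
    rw [Real.volume_closedBall, ENNReal.ofReal_mul hD.le]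
  rcases le_total r e with h | h
  · refine (concentrate_term_le μ _).trans (h1.trans (ENNReal.ofReal_le_ofReal ?_))
    have := Real.rpow_le_rpow hr.le h hs0.le
    calc D * (2 * (η * r ^ s)) = 2 * D * η * r ^ s := by ring
      _ ≤ _ := by gcongr
  · calc _ ≤ ENNReal.ofReal (D * (2 * (η * r ^ s))) / ENNReal.ofReal (2 * r) *
          ENNReal.ofReal (2 * e) := by
          rw [← Real.volume_ball x e, ← Real.volume_ball p r]
          gcongr
          exact inter_subset_left
      _ = ENNReal.ofReal (D * (2 * (η * r ^ s)) / (2 * r) * (2 * e)) := by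
          rw [← ENNReal.ofReal_div_of_pos (by positivity), ← ENNReal.ofReal_mul (by positivity)]
      _ ≤ _ := by
          refine ENNReal.ofReal_le_ofReal ?_
          have h2 : (e / r) ^ (1 - s) ≤ 1 :=
            Real.rpow_le_one (by positivity) ((div_le_one hr).2 h) (by linarith)
          have h3 : e / r = (e / r) ^ s * (e / r) ^ (1 - s) := by
            rw [← Real.rpow_add (by positivity), add_sub_cancel, Real.rpow_one]
          rw [Real.div_rpow he.le hr.le s] at h3
          calc D * (2 * (η * r ^ s)) / (2 * r) * (2 * e) = 2 * D * η * r ^ s * (e / r) := by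
                field_simp
            _ = 2 * D * η * e ^ s * (e / r) ^ (1 - s) := by
                nth_rewrite 1 [h3]
                generalize (e / r) ^ (1 - s) = z
                field_simp
            _ ≤ _ := mul_le_of_le_one_right (by positivity) h2

/-- One step of the mass transference construction. -/
theorem exists_mass_transference_step {P : ℕ → Set ℝ} {r : ℕ → ℝ} (hr0 : ∀ k, 0 < r k)
    (hr : Tendsto r atTop (nhds 0)) {s : ℝ} (hs0 : 0 < s) (hs1 : s < 1) {a b : ℝ}
    (hfull : ∀ η > 0, ∀ m, volume (Icc a b \
      ⋃ k ≥ m, ⋃ p ∈ P k ∩ Icc a b, Metric.closedBall p (η * r k ^ s)) = 0)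
    {μ : Measure ℝ} {D : ℝ} (hD : 0 < D) (hμ : ∀ A, μ A ≤ ENNReal.ofReal D * volume A)
    {O : Set ℝ} (hO : IsOpen O) (hOab : O ⊆ Icc a b) {η : ℝ} (hη : 0 < η) (m : ℕ) :
    ∃ (μ' : Measure ℝ) (D' : ℝ) (O' K : Set ℝ), 0 < D' ∧
      (∀ A, μ' A ≤ ENNReal.ofReal D' * volume A) ∧ IsOpen O' ∧ O' ⊆ K ∧ K ⊆ O ∧ IsCompact K ∧
      K ⊆ (⋃ k ≥ m, ⋃ p ∈ P k ∩ Icc a b, Metric.closedBall p (r k)) ∧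
      μ O ≤ μ' O' + ENNReal.ofReal η ∧
      ∀ x e, 0 < e → μ' (Metric.ball x e) ≤ μ (Metric.ball x e) + ENNReal.ofReal (η * e ^ s) := by
  have hloc : IsLocallyFiniteMeasure μ := ⟨fun x => ⟨Metric.ball x 1,
    Metric.ball_mem_nhds x one_pos,
    (hμ _).trans_lt (ENNReal.mul_lt_top ENNReal.ofReal_lt_top measure_ball_lt_top)⟩⟩
  set η' := η / (2 * D) with hη'
  have hη'0 : 0 < η' := by positivity
  obtain ⟨t₀, ht₀, hsmall⟩ := exists_pos_mul_le_rpow hs1 (show 0 < 14 * D / η by positivity)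
  obtain ⟨t₁, ht₁, hsmall'⟩ := exists_pos_mul_le_rpow hs1 (show 0 < 2 / η' by positivity)
  set τ := η * t₀ ^ s / (4 * D) with hτ
  have hτ0 : 0 < τ := by positivity
  have hRlim : Tendsto (fun k => η' * r k ^ s) atTop (nhds 0) := by
    have := (hr.rpow_const (p := s) (Or.inr hs0.le)).const_mul η'
    rwa [Real.zero_rpow hs0.ne', mul_zero] at this
  obtain ⟨m₁, hm₁⟩ := eventually_atTop.1
    ((hRlim.eventually_lt_const hτ0).and (hr.eventually_lt_const ht₁))
  have hR0 : ∀ k, 0 < η' * r k ^ s := fun k => by have := hr0 k; positivity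
  obtain ⟨F, hF, hFd, hFv⟩ := exists_finite_disjoint_balls hR0 hRlim (hfull η' hη'0) hO hOab
    (max m m₁) (ε := ENNReal.ofReal (η / D))
      (by rw [Ne, ENNReal.ofReal_eq_zero]; push Not; positivity)
  have hFτ : ∀ t ∈ F, η' * r t.2 ^ s < τ := fun t ht =>
    (hm₁ _ ((le_max_right _ _).trans (hF t ht).1)).1
  have hFr : ∀ t ∈ F, 2 * r t.2 ≤ η' * r t.2 ^ s := fun t ht => by
    have h1 := hsmall' _ (hr0 t.2) (hm₁ _ ((le_max_right _ _).trans (hF t ht).1)).2.le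
    rwa [div_mul_eq_mul_div, div_le_iff₀ hη'0, mul_comm _ η'] at h1
  obtain ⟨D', hD', hμ'⟩ := exists_concentrate_le μ F (fun k => η' * r k ^ s) hr0
  refine ⟨concentrate μ F (fun k => η' * r k ^ s) r, D', ⋃ t ∈ F, Metric.ball t.1 (r t.2),
    ⋃ t ∈ F, Metric.closedBall t.1 (r t.2), hD', hμ', isOpen_biUnion fun _ _ => Metric.isOpen_ball,
    iUnion₂_mono fun _ _ => Metric.ball_subset_closedBall, ?_,
    F.isCompact_biUnion fun _ _ => isCompact_closedBall _ _, ?_, ?_, ?_⟩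
  · refine iUnion₂_subset fun t ht => Subset.trans (Metric.closedBall_subset_closedBall ?_)
      (hF t ht).2.2
    linarith [hFr t ht, hr0 t.2]
  · refine iUnion₂_subset fun t ht x hx => ?_
    simp only [mem_iUnion]
    exact ⟨t.2, (le_max_left _ _).trans (hF t ht).1, t.1, (hF t ht).2.1, hx⟩
  · refine le_trans ?_ (add_le_add_left (concentrate_union μ hr0 hFd) _)
    refine (measure_mono (t := (⋃ t ∈ F, Metric.closedBall t.1 (η' * r t.2 ^ s)) ∪
      (O \ ⋃ t ∈ F, Metric.closedBall t.1 (η' * r t.2 ^ s))) ?_).trans ?_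
    · rw [union_sdiff_self]
      exact subset_union_right
    · refine (measure_union_le _ _).trans ?_
      gcongr
      refine (hμ _).trans ((mul_le_mul_right hFv _).trans_eq ?_)
      rw [← ENNReal.ofReal_mul hD.le, mul_div_cancel₀ _ hD.ne']
  · intro x e he
    have hes : 0 < e ^ s := Real.rpow_pos_of_pos he s
    rcases le_or_gt t₀ e with hte | hte
    · refine (concentrate_ball_le μ hFd (W := Metric.ball x (e + 2 * τ))
      fun t ht hxt y hy => ?_).trans
        ?_
      · rw [Metric.mem_closedBall] at hy
        rw [Metric.mem_ball]
        have h1 := dist_triangle y t.1 x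
        rw [dist_comm t.1 x, Real.dist_eq x t.1] at h1
        linarith [hFτ t ht, hFr t ht, hr0 t.2]
      · have h1 : Metric.ball x (e + 2 * τ) ⊆
            Metric.ball x e ∪ (Metric.ball x (e + 2 * τ) \ Metric.ball x e) := by
          rw [union_sdiff_self]
          exact subset_union_right
        refine (measure_mono h1).trans ((measure_union_le _ _).trans ?_)
        gcongr
        refine (hμ _).trans ?_
        rw [measure_sdiff (Metric.ball_subset_ball (by linarith))
          measurableSet_ball.nullMeasurableSet
          measure_ball_lt_top.ne, Real.volume_ball, Real.volume_ball,
          ← ENNReal.ofReal_sub _ (by positivity), ← ENNReal.ofReal_mul hD.le]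
        refine ENNReal.ofReal_le_ofReal ?_
        have h2 : t₀ ^ s ≤ e ^ s := Real.rpow_le_rpow ht₀.le hte hs0.le
        calc D * (2 * (e + 2 * τ) - 2 * e) = η * t₀ ^ s := by rw [hτ]; field_simp; ring
          _ ≤ _ := by gcongr
    · by_cases hone : ∃ t₁ ∈ F, ∀ t ∈ F, |x - t.1| < e + r t.2 → t = t₁
      · obtain ⟨t₁, ht₁F, hone⟩ := hone
        rw [concentrate_apply _ _ _ _ measurableSet_ball]
        rw [Finset.sum_eq_single_of_mem t₁ ht₁F]
        · refine (concentrate_term_le_rpow hD hμ hs0 hs1.le hη'0 (hr0 _) he).trans ?_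
          refine le_trans (ENNReal.ofReal_le_ofReal (le_of_eq ?_)) le_add_self
          rw [hη']
          field_simp
        · intro t ht htne
          have h1 : ¬ |x - t.1| < e + r t.2 := fun h => htne (hone t ht h)
          have h2 : Metric.ball x e ∩ Metric.ball t.1 (r t.2) = ∅ :=
            (Metric.ball_disjoint_ball (by rw [Real.dist_eq]; exact not_lt.1 h1)).inter_eq
          rw [h2, measure_empty, mul_zero]
      · push Not at hone
        refine (concentrate_ball_le μ hFd (W := Metric.ball x (7 * e))
          fun t ht hxt y hy => ?_).trans
          ?_
        · obtain ⟨t', ht', hxt', hne⟩ := hone t ht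
          have hdist := (disjoint_closedBall_closedBall_iff (hR0 t.2).le (hR0 t'.2).le).1
            (hFd ht ht' hne.symm)
          rw [Real.dist_eq] at hdist
          have h2 := abs_sub_le t.1 x t'.1
          rw [abs_sub_comm t.1 x] at h2
          rw [Metric.mem_closedBall] at hy
          rw [Metric.mem_ball]
          have h1 := dist_triangle y t.1 x
          rw [dist_comm t.1 x, Real.dist_eq x t.1] at h1
          have h3 := hFr t ht
          have h4 := hFr t' ht'
          have h5 := hR0 t'.2
          linarith
        · refine le_trans ((hμ _).trans ?_) le_add_self
          rw [Real.volume_ball, ← ENNReal.ofReal_mul hD.le]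
          refine ENNReal.ofReal_le_ofReal ?_
          have h1 := hsmall e he hte.le
          rw [div_mul_eq_mul_div, div_le_iff₀ hη, mul_comm _ η] at h1
          linarith

/-- Nested compact sets inside a limsup set, carrying measures with controlled concentration. -/
theorem exists_cantor_measures {P : ℕ → Set ℝ} {r : ℕ → ℝ} (hr0 : ∀ k, 0 < r k)
    (hr : Tendsto r atTop (nhds 0)) {s : ℝ} (hs0 : 0 < s) (hs1 : s < 1) {a b : ℝ}
    (hfull : ∀ η > 0, ∀ m, volume (Icc a b \
      ⋃ k ≥ m, ⋃ p ∈ P k ∩ Icc a b, Metric.closedBall p (η * r k ^ s)) = 0)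
    {D : ℝ} (hD : 0 < D) :
    ∃ (K : ℕ → Set ℝ) (ν : ℕ → Measure ℝ), (∀ j, IsCompact (K j)) ∧ (∀ j, K (j + 1) ⊆ K j) ∧
      (∀ j, K j ⊆ Icc a b) ∧
      (∀ j, K j ⊆ ⋃ k ≥ j, ⋃ p ∈ P k ∩ Icc a b, Metric.closedBall p (r k)) ∧
      (∀ j, ENNReal.ofReal (D * (b - a)) ≤ ν j (K j) + 1) ∧
      ∀ j x e, 0 < e →
        ν j (Metric.ball x e) ≤ ENNReal.ofReal (D * (2 * e)) + ENNReal.ofReal (e ^ s) := by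
  let St := {S : Measure ℝ × ℝ × Set ℝ // 0 < S.2.1 ∧
    (∀ A, S.1 A ≤ ENNReal.ofReal S.2.1 * volume A) ∧ IsOpen S.2.2 ∧ S.2.2 ⊆ Icc a b}
  have step : ∀ (j : ℕ) (S : St), ∃ (S' : St) (K : Set ℝ), S'.1.2.2 ⊆ K ∧ K ⊆ S.1.2.2 ∧
      IsCompact K ∧ K ⊆ (⋃ k ≥ j, ⋃ p ∈ P k ∩ Icc a b, Metric.closedBall p (r k)) ∧
      S.1.1 S.1.2.2 ≤ S'.1.1 S'.1.2.2 + ENNReal.ofReal ((1 / 2) ^ (j + 1)) ∧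
      ∀ x e, 0 < e → S'.1.1 (Metric.ball x e) ≤
        S.1.1 (Metric.ball x e) + ENNReal.ofReal ((1 / 2) ^ (j + 1) * e ^ s) := by
    rintro j ⟨⟨μ, E, O⟩, hE, hμ, hO, hOab⟩
    obtain ⟨μ', D', O', K, h1, h2, h3, h4, h5, h6, h7, h8, h9⟩ :=
      exists_mass_transference_step hr0 hr hs0 hs1 hfull hE hμ hO hOab
        (show (0 : ℝ) < (1 / 2) ^ (j + 1) by positivity) j
    exact ⟨⟨⟨μ', D', O'⟩, h1, h2, h3, (h4.trans h5).trans hOab⟩, K, h4, h5, h6, h7, h8, h9⟩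
  choose next K hnK hKO hKc hKt hmass hball using step
  let S₀ : St := ⟨⟨ENNReal.ofReal D • volume, D, Ioo a b⟩, hD,
    fun A => by simp, isOpen_Ioo, Ioo_subset_Icc_self⟩
  let S : ℕ → St := fun j => Nat.rec S₀ (fun j T => next j T) j
  have hS : ∀ j, S (j + 1) = next j (S j) := fun j => rfl
  have hsum : ∀ j : ℕ, ∑ i ∈ Finset.range j, (1 / 2 : ℝ) ^ (i + 1) = 1 - (1 / 2) ^ j := by
    intro j
    induction j with
    | zero => simp
    | succ j ih => rw [Finset.sum_range_succ, ih]; ring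
  have hmass' : ∀ j, ENNReal.ofReal (D * (b - a)) ≤
      (S j).1.1 (S j).1.2.2 + ENNReal.ofReal (1 - (1 / 2) ^ j) := by
    intro j
    induction j with
    | zero =>
      refine le_trans (le_of_eq ?_) le_self_add
      change _ = (ENNReal.ofReal D • volume) (Ioo a b)
      rw [Measure.smul_apply, Real.volume_Ioo, smul_eq_mul, ENNReal.ofReal_mul hD.le]
    | succ j ih =>
      refine ih.trans ?_
      rw [← hsum (j + 1), Finset.sum_range_succ, hsum j, ENNReal.ofReal_add
        (sub_nonneg.2 (pow_le_one₀ (by norm_num) (by norm_num))) (by positivity),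
        add_comm (ENNReal.ofReal (1 - _)), ← add_assoc]
      gcongr
      exact hmass j (S j)
  have hball' : ∀ j x e, 0 < e → (S j).1.1 (Metric.ball x e) ≤
      ENNReal.ofReal (D * (2 * e)) + ENNReal.ofReal ((1 - (1 / 2) ^ j) * e ^ s) := by
    intro j x e he
    induction j with
    | zero =>
      refine le_trans (le_of_eq ?_) le_self_add
      change (ENNReal.ofReal D • volume) (Metric.ball x e) = _
      rw [Measure.smul_apply, Real.volume_ball, smul_eq_mul, ENNReal.ofReal_mul hD.le]
    | succ j ih =>
      refine (hball j (S j) x e he).trans ?_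
      rw [← hsum (j + 1), Finset.sum_range_succ, hsum j, add_mul, ENNReal.ofReal_add
        (mul_nonneg (sub_nonneg.2 (pow_le_one₀ (by norm_num) (by norm_num))) (by positivity))
        (by positivity), ← add_assoc]
      gcongr
  refine ⟨fun j => K j (S j), fun j => (S (j + 1)).1.1, fun j => hKc _ _, fun j => ?_, fun j => ?_,
    fun j => hKt _ _, fun j => ?_, fun j x e he => ?_⟩
  · exact (hKO (j + 1) (S (j + 1))).trans (hnK j (S j))
  · exact (hKO j (S j)).trans (S j).2.2.2.2
  · refine (hmass' (j + 1)).trans ?_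
    gcongr
    · exact hnK j (S j)
    · rw [← ENNReal.ofReal_one]
      exact ENNReal.ofReal_le_ofReal (sub_le_self _ (by positivity))
  · refine (hball' (j + 1) x e he).trans ?_
    gcongr
    exact mul_le_of_le_one_left (by positivity) (sub_le_self _ (by positivity))

/-- Sets of positive finite diameter are contained in slightly larger balls. -/
theorem exists_ball_superset {s : ℝ} (hs0 : 0 < s) {t : Set ℝ} {δ : ℝ} (hδ : 0 < δ)
    (ht : Metric.ediam t ≤ ENNReal.ofReal (δ / 2)) {ε : ENNReal} (hε : ε ≠ 0) :
    ∃ x e, 0 < e ∧ e ≤ δ ∧ t ⊆ Metric.ball x e ∧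
      ENNReal.ofReal (e ^ s) ≤ (⨆ _ : t.Nonempty, Metric.ediam t ^ s) + ε := by
  have hf : Metric.ediam t ≠ ⊤ := (ht.trans_lt ENNReal.ofReal_lt_top).ne
  have hd : (Metric.ediam t).toReal ≤ δ / 2 :=
    (ENNReal.le_ofReal_iff_toReal_le hf (by positivity)).1 ht
  have hlim : Tendsto (fun e : ℝ => ENNReal.ofReal (e ^ s))
      (nhdsWithin (Metric.ediam t).toReal (Ioi (Metric.ediam t).toReal))
      (nhds (Metric.ediam t ^ s)) := by
    have h1 : Metric.ediam t ^ s = ENNReal.ofReal ((Metric.ediam t).toReal ^ s) := by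
      rw [← ENNReal.ofReal_rpow_of_nonneg ENNReal.toReal_nonneg hs0.le, ENNReal.ofReal_toReal hf]
    rw [h1]
    exact (ENNReal.tendsto_ofReal ((Real.continuousAt_rpow_const _ _
      (Or.inr hs0.le)).tendsto)).mono_left
      nhdsWithin_le_nhds
  have hlt : Metric.ediam t ^ s < Metric.ediam t ^ s + ε :=
    ENNReal.lt_add_right (ENNReal.rpow_ne_top_of_nonneg hs0.le hf) hε
  obtain ⟨e, he, hed⟩ := ((hlim.eventually_lt_const hlt).and (Ioo_mem_nhdsGT
    (show (Metric.ediam t).toReal < δ by linarith))).exists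
  have he0 : 0 < e := ENNReal.toReal_nonneg.trans_lt hed.1
  rcases t.eq_empty_or_nonempty with rfl | ⟨x, hx⟩
  · refine ⟨0, e, he0, hed.2.le, empty_subset _, ?_⟩
    rw [Metric.ediam_empty, ENNReal.zero_rpow_of_pos hs0, zero_add] at he
    exact he.le.trans le_add_self
  · refine ⟨x, e, he0, hed.2.le, fun y hy => ?_, ?_⟩
    · rw [Metric.mem_ball, dist_edist]
      exact (ENNReal.toReal_mono hf (Metric.edist_le_ediam_of_mem hy hx)).trans_lt hed.1
    · rw [iSup_pos ⟨x, hx⟩]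
      exact he.le

/-- The mass transference principle on the line, for dimensions below one. -/
theorem hausdorffMeasure_limsup_eq_top {P : ℕ → Set ℝ} {r : ℕ → ℝ} (hr0 : ∀ k, 0 < r k)
    (hr : Tendsto r atTop (nhds 0)) {s : ℝ} (hs0 : 0 < s) (hs1 : s < 1) {a b : ℝ} (hab : a < b)
    (hfull : ∀ η > 0, ∀ m, volume (Icc a b \
      ⋃ k ≥ m, ⋃ p ∈ P k ∩ Icc a b, Metric.closedBall p (η * r k ^ s)) = 0) :
    μH[s] (Icc a b ∩ ⋂ m : ℕ, ⋃ k ≥ m, ⋃ p ∈ P k ∩ Icc a b, Metric.closedBall p (r k)) = ⊤ := by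
  set L := Icc a b ∩ ⋂ m : ℕ, ⋃ k ≥ m, ⋃ p ∈ P k ∩ Icc a b, Metric.closedBall p (r k) with hL
  by_contra hfin
  set V := (μH[s] L).toReal with hV
  have hV0 : 0 ≤ V := ENNReal.toReal_nonneg
  have hVL : μH[s] L = ENNReal.ofReal V := (ENNReal.ofReal_toReal hfin).symm
  set D := (2 * V + 6) / (b - a) with hD
  have hD0 : 0 < D := div_pos (by positivity) (by linarith)
  obtain ⟨δ, hδ, hsmall⟩ := exists_pos_mul_le_rpow hs1 (show 0 < D * 2 by positivity)
  obtain ⟨K, ν, hKc, hKn, hKab, hKt, hKν, hνb⟩ := exists_cantor_measures hr0 hr hs0 hs1 hfull hD0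
  have hlt : (⨅ (t : ℕ → Set ℝ) (_ : L ⊆ ⋃ n, t n)
      (_ : ∀ n, Metric.ediam (t n) ≤ ENNReal.ofReal (δ / 2)),
      ∑' n, ⨆ _ : (t n).Nonempty, Metric.ediam (t n) ^ s) < ENNReal.ofReal (V + 1) := by
    refine lt_of_le_of_lt ?_ (show μH[s] L < _ by
      rw [hVL]; exact (ENNReal.ofReal_lt_ofReal_iff (by positivity)).2 (by linarith))
    rw [Measure.hausdorffMeasure_apply]
    exact le_iSup₂_of_le (ENNReal.ofReal (δ / 2)) (ENNReal.ofReal_pos.2 (by positivity)) le_rfl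
  simp only [iInf_lt_iff] at hlt
  obtain ⟨t, htL, htd, hts⟩ := hlt
  obtain ⟨ε, hε0, hε⟩ := ENNReal.exists_pos_sum_of_countable' one_ne_zero ℕ
  choose x e he0 heδ hte hes using fun n => exists_ball_superset hs0 hδ (htd n) (hε0 n).ne'
  have hsum : ∑' n, ENNReal.ofReal (e n ^ s) ≤ ENNReal.ofReal (V + 2) := by
    refine (ENNReal.tsum_le_tsum hes).trans ?_
    rw [ENNReal.tsum_add, show V + 2 = V + 1 + 1 by ring,
      ENNReal.ofReal_add (by positivity) zero_le_one, ENNReal.ofReal_one]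
    exact add_le_add hts.le hε.le
  set U := ⋃ n, Metric.ball (x n) (e n) with hU
  have hUo : IsOpen U := isOpen_iUnion fun _ => Metric.isOpen_ball
  have hKanti : Antitone K := antitone_nat_of_succ_le hKn
  obtain ⟨j, hj⟩ := exists_subset_nhds_of_isCompact (U := U) hKanti.directed_ge hKc (by
    intro y hy
    refine hUo.mem_nhds ?_
    have hyL : y ∈ L := ⟨hKab 0 (mem_iInter.1 hy 0),
      mem_iInter.2 fun m => hKt m (mem_iInter.1 hy m)⟩
    obtain ⟨n, hn⟩ := mem_iUnion.1 (htL hyL)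
    exact mem_iUnion.2 ⟨n, hte n hn⟩)
  have h1 : ν j (K j) ≤ ENNReal.ofReal (2 * (V + 2)) := by
    calc ν j (K j) ≤ ∑' n, ν j (Metric.ball (x n) (e n)) :=
          (measure_mono hj).trans (measure_iUnion_le _)
      _ ≤ ∑' n, (ENNReal.ofReal (e n ^ s) + ENNReal.ofReal (e n ^ s)) := by
          refine ENNReal.tsum_le_tsum fun n => (hνb j _ _ (he0 n)).trans ?_
          gcongr
          rw [← mul_assoc]
          exact hsmall _ (he0 n) (heδ n)
      _ = 2 * ∑' n, ENNReal.ofReal (e n ^ s) := by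
          rw [ENNReal.tsum_add, two_mul]
      _ ≤ 2 * ENNReal.ofReal (V + 2) := by gcongr
      _ = _ := by rw [ENNReal.ofReal_mul zero_le_two, ENNReal.ofReal_ofNat]
  have h2 := (hKν j).trans (add_le_add_left h1 1)
  rw [hD, div_mul_cancel₀ _ (by linarith), ← ENNReal.ofReal_one,
    ← ENNReal.ofReal_add (by positivity) zero_le_one,
    ENNReal.ofReal_le_ofReal_iff (by positivity)] at h2
  linarith

/-- A nonnegative series that is bounded on geometric blocks by a summable sequence. -/
theorem summable_of_le_on_blocks {B : ℕ} (hB : 2 ≤ B) {g u : ℕ → ℝ} (hg : ∀ q, 0 ≤ g q)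
    (hu : Summable fun k => (B : ℝ) ^ (k + 1) * u k)
    (hgu : ∀ k q, B ^ k ≤ q → q < B ^ (k + 1) → g q ≤ u k) : Summable g := by
  have hu0 : ∀ k, 0 ≤ u k := fun k =>
    (hg (B ^ k)).trans (hgu k _ le_rfl (Nat.pow_lt_pow_right (by omega) (by omega)))
  have hblock : ∀ N, ∑ q ∈ Finset.range (B ^ N), g q ≤
      g 0 + ∑ k ∈ Finset.range N, (B : ℝ) ^ (k + 1) * u k := by
    intro N
    induction N with
    | zero => simp
    | succ N ih =>
      rw [← Finset.sum_range_add_sum_Ico g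
        (Nat.pow_le_pow_right (show 0 < B by omega) (Nat.le_succ N)), Finset.sum_range_succ]
      have h : ∑ q ∈ Finset.Ico (B ^ N) (B ^ (N + 1)), g q ≤ (B : ℝ) ^ (N + 1) * u N := by
        calc ∑ q ∈ Finset.Ico (B ^ N) (B ^ (N + 1)), g q
            ≤ ∑ q ∈ Finset.Ico (B ^ N) (B ^ (N + 1)), u N := by
              refine Finset.sum_le_sum fun q hq => ?_
              rw [Finset.mem_Ico] at hq
              exact hgu N q hq.1 hq.2
          _ = ((B ^ (N + 1) - B ^ N : ℕ) : ℝ) * u N := by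
              rw [Finset.sum_const, Nat.card_Ico, nsmul_eq_mul]
          _ ≤ (B : ℝ) ^ (N + 1) * u N := by
              refine mul_le_mul_of_nonneg_right ?_ (hu0 N)
              exact_mod_cast Nat.sub_le _ _
      linarith
  refine summable_of_sum_range_le (c := g 0 + ∑' k, (B : ℝ) ^ (k + 1) * u k) hg fun N => ?_
  calc ∑ q ∈ Finset.range N, g q ≤ ∑ q ∈ Finset.range (B ^ N), g q :=
        Finset.sum_le_sum_of_subset_of_nonneg
          (Finset.range_subset_range.2 (Nat.lt_pow_self (by omega)).le) fun q _ _ => hg q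
    _ ≤ _ := hblock N
    _ ≤ _ := by
      have := hu.sum_le_tsum (Finset.range N) fun k _ => mul_nonneg (by positivity) (hu0 k)
      linarith

/-- Cauchy condensation along a geometric sequence. -/
theorem not_summable_condensed {B : ℕ} (hB : 2 ≤ B) {ψ : ℝ → ℝ} (hψpos : ∀ q : ℝ, 0 < q → 0 < ψ q)
    (hψdec : AntitoneOn ψ (Ioi 0)) {s : ℝ} (hs0 : 0 < s) {n : ℕ}
    (hdiv : ¬ Summable fun q : ℕ =>
      (ψ ((q : ℝ) + 1) / ((q : ℝ) + 1)) ^ s * ((q : ℝ) + 1) ^ n) :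
    ¬ Summable fun k : ℕ =>
      (ψ ((B : ℝ) ^ (k + 1)) / (B : ℝ) ^ k) ^ s * ((B : ℝ) ^ k) ^ (n + 1) := by
  intro ht
  refine hdiv ?_
  have hB1 : (1 : ℝ) < B := by exact_mod_cast (show 1 < B by omega)
  have hBp : ∀ k : ℕ, (0 : ℝ) < (B : ℝ) ^ k := fun k => by positivity
  set g : ℕ → ℝ := fun q => if q = 0 then 0 else (ψ q / q) ^ s * (q : ℝ) ^ n with hg
  have hgs : Summable g := by
    refine summable_of_le_on_blocks hB
      (u := fun k => (ψ ((B : ℝ) ^ k) / (B : ℝ) ^ k) ^ s * ((B : ℝ) ^ (k + 1)) ^ n) ?_ ?_ ?_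
    · intro q
      by_cases hq : q = 0
      · simp [hg, hq]
      · have hq' : (0 : ℝ) < q := by exact_mod_cast Nat.pos_of_ne_zero hq
        have := hψpos q hq'
        simp only [hg, hq, if_false]
        positivity
    · rw [← summable_nat_add_iff 1]
      refine Summable.of_nonneg_of_le (fun k => ?_) (fun k => ?_)
        (ht.mul_right (((B : ℝ) ^ 2) ^ (n + 1)))
      · have := hψpos _ (hBp (k + 1))
        positivity
      · have hp := hψpos _ (hBp (k + 1))
        have h1 : (ψ ((B : ℝ) ^ (k + 1)) / (B : ℝ) ^ (k + 1)) ^ s ≤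
            (ψ ((B : ℝ) ^ (k + 1)) / (B : ℝ) ^ k) ^ s := by
          refine Real.rpow_le_rpow (by positivity) ?_ hs0.le
          exact div_le_div_of_nonneg_left hp.le (hBp k) (pow_le_pow_right₀ hB1.le (by omega))
        calc (B : ℝ) ^ (k + 1 + 1) * ((ψ ((B : ℝ) ^ (k + 1)) / (B : ℝ) ^ (k + 1)) ^ s *
              ((B : ℝ) ^ (k + 1 + 1)) ^ n)
            = (ψ ((B : ℝ) ^ (k + 1)) / (B : ℝ) ^ (k + 1)) ^ s *
              (((B : ℝ) ^ k) ^ (n + 1) * ((B : ℝ) ^ 2) ^ (n + 1)) := by ring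
          _ ≤ (ψ ((B : ℝ) ^ (k + 1)) / (B : ℝ) ^ k) ^ s *
              (((B : ℝ) ^ k) ^ (n + 1) * ((B : ℝ) ^ 2) ^ (n + 1)) := by gcongr
          _ = _ := by ring
    · intro k q hq hq'
      have hq0 : q ≠ 0 := by
        have : 0 < B ^ k := by positivity
        omega
      have hqR : (B : ℝ) ^ k ≤ q := by exact_mod_cast hq
      have hqR' : (q : ℝ) ≤ (B : ℝ) ^ (k + 1) := by exact_mod_cast hq'.le
      have hq0' : (0 : ℝ) < q := (hBp k).trans_le hqR
      have hp := hψpos _ hq0'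
      have hp' := hψpos _ (hBp k)
      have hle : ψ q ≤ ψ ((B : ℝ) ^ k) := hψdec (hBp k) hq0' hqR
      simp only [hg, hq0, if_false]
      gcongr
  have := (summable_nat_add_iff 1).2 hgs
  refine this.congr fun q => ?_
  simp [hg]

/-- Truncating a divergent nonnegative series keeps it divergent. -/
theorem not_summable_min {t : ℕ → ℝ} (h : ¬ Summable t) {c : ℝ} (hc : 0 < c) :
    ¬ Summable fun k => min (t k) c := by
  intro hs
  have hev := hs.tendsto_atTop_zero.eventually (gt_mem_nhds hc)
  refine h (hs.congr_atTop ?_)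
  filter_upwards [hev] with k hk
  rcases min_lt_iff.1 hk with hk | hk
  · exact min_eq_left hk.le
  · exact absurd hk (lt_irrefl _)

theorem nearestIntDist_le (x : ℝ) (m : ℤ) : nearestIntDist x ≤ |x - m| := round_le x m

/-- Points close to a resonant point are well approximable. -/
theorem exists_approximation_of_near_resonant {n : ℕ} {a b : ℝ} {f : Fin n → ℝ → ℝ} {lam : ℝ → ℝ}
    {M L : ℝ} (hM : ∀ i, ∀ x ∈ Icc a b, ∀ y ∈ Icc a b, |f i x - f i y| ≤ M * |x - y|)
    (hL : ∀ x ∈ Icc a b, ∀ y ∈ Icc a b, |lam x - lam y| ≤ L * |x - y|) (hM0 : 0 ≤ M)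
    (hL0 : 0 ≤ L) {ψ : ℝ → ℝ} (hψdec : AntitoneOn ψ (Ioi 0)) {C Q T x p : ℝ} (hQ : 1 ≤ Q)
    (hT : C * Q ≤ T) (hψT : 0 < ψ T) (hp : p ∈ resonantSet f lam C Q) (hpI : p ∈ Icc a b)
    (hx : x ∈ Icc a b) (hC : 0 ≤ C)
    (hxp : |x - p| ≤ 1 / (2 * (n * C * M + L + 1)) * (ψ T / Q)) :
    ∃ c : Fin n → ℤ, Q ≤ ‖fun i => (c i : ℝ)‖ ∧ c ≠ 0 ∧
      nearestIntDist ((∑ i, (c i : ℝ) * f i x) + lam x) <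
        ψ ((Finset.univ.sup fun i => (c i).natAbs : ℕ) : ℝ) := by
  obtain ⟨m, c, hc1, hc2, hc⟩ := hp
  have hc0 : c ≠ 0 := by
    rintro rfl
    have : (fun i : Fin n => (((0 : Fin n → ℤ) i : ℤ) : ℝ)) = 0 := by ext; simp
    rw [this, norm_zero] at hc1
    linarith
  have hci : ∀ i, |(c i : ℝ)| ≤ C * Q := fun i =>
    (norm_le_pi_norm (fun i => (c i : ℝ)) i).trans hc2
  refine ⟨c, hc1, hc0, ?_⟩
  set S := Finset.univ.sup fun i => (c i).natAbs with hS
  have hST : (S : ℝ) ≤ T := by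
    obtain ⟨i₀, hi₀⟩ : ∃ i, c i ≠ 0 := Function.ne_iff.1 hc0
    obtain ⟨i, -, hi⟩ := Finset.exists_mem_eq_sup Finset.univ ⟨i₀, Finset.mem_univ _⟩
      (fun i => (c i).natAbs)
    rw [hS, hi, Nat.cast_natAbs, Int.cast_abs]
    exact (hci i).trans hT
  have hS0 : (0 : ℝ) < S := by
    obtain ⟨i₀, hi₀⟩ : ∃ i, c i ≠ 0 := Function.ne_iff.1 hc0
    have h1 : (c i₀).natAbs ≤ S :=
      Finset.le_sup (f := fun i => (c i).natAbs) (Finset.mem_univ i₀)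
    have h2 := Int.natAbs_pos.2 hi₀
    exact_mod_cast h2.trans_le h1
  have hψS : ψ T ≤ ψ S := hψdec hS0 (hS0.trans_le hST) hST
  refine lt_of_lt_of_le ?_ hψS
  refine (nearestIntDist_le _ (-m)).trans_lt ?_
  have heq : (∑ i, (c i : ℝ) * f i x) + lam x - ((-m : ℤ) : ℝ) =
      (∑ i, (c i : ℝ) * (f i x - f i p)) + (lam x - lam p) := by
    simp only [mul_sub, Finset.sum_sub_distrib]
    push_cast
    linarith
  have hsum : |∑ i, (c i : ℝ) * (f i x - f i p)| ≤ n * (C * Q * (M * |x - p|)) := by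
    refine (Finset.abs_sum_le_sum_abs _ _).trans ?_
    calc ∑ i, |(c i : ℝ) * (f i x - f i p)| ≤ ∑ _i : Fin n, C * Q * (M * |x - p|) := by
          refine Finset.sum_le_sum fun i _ => ?_
          rw [abs_mul]
          exact mul_le_mul (hci i) (hM i x hx p hpI) (abs_nonneg _) (by positivity)
      _ = _ := by simp
  have hlam : |lam x - lam p| ≤ Q * (L * |x - p|) :=
    (hL x hx p hpI).trans (le_mul_of_one_le_left (by positivity) hQ)
  set K := n * C * M + L with hK
  have hK0 : 0 ≤ K := by positivity
  have hQ0 : 0 < Q := by linarith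
  rw [heq]
  calc |(∑ i, (c i : ℝ) * (f i x - f i p)) + (lam x - lam p)|
      ≤ n * (C * Q * (M * |x - p|)) + Q * (L * |x - p|) :=
        (abs_add_le _ _).trans (add_le_add hsum hlam)
    _ = K * Q * |x - p| := by rw [hK]; ring
    _ ≤ K * Q * (1 / (2 * (K + 1)) * (ψ T / Q)) := by gcongr
    _ = K / (2 * (K + 1)) * ψ T := by field_simp
    _ < 1 * ψ T := by
      refine mul_lt_mul_of_pos_right ?_ hψT
      rw [div_lt_one (by positivity)]
      linarith
    _ = ψ T := one_mul _

theorem ContDiffOn.exists_lipschitz_const {a b : ℝ} {g : ℝ → ℝ} {n : ℕ} (hn : n ≠ 0)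
    (hg : ContDiffOn ℝ n g (Icc a b)) :
    ∃ M, 0 ≤ M ∧ ∀ x ∈ Icc a b, ∀ y ∈ Icc a b, |g x - g y| ≤ M * |x - y| := by
  obtain ⟨K, hK⟩ := hg.exists_lipschitzOnWith (by exact_mod_cast hn) (convex_Icc a b) isCompact_Icc
  exact ⟨K, K.2, fun x hx y hy => by simpa [Real.dist_eq] using hK.dist_le_mul x hx y hy⟩

theorem stmt_0 (n : ℕ) (hn : 1 ≤ n) (a b : ℝ) (hab : a < b)
    (f : Fin n → ℝ → ℝ) (hf : ∀ i, ContDiffOn ℝ n (f i) (Icc a b))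
    (hW : ∀ x ∈ Icc a b,
      (Matrix.of fun i j : Fin n =>
        iteratedDerivWithin ((j : ℕ) + 1) (f i) (Icc a b) x).det ≠ 0)
    (ψ : ℝ → ℝ) (hψpos : ∀ q : ℝ, 0 < q → 0 < ψ q)
    (hψdec : AntitoneOn ψ (Ioi 0))
    (lam : ℝ → ℝ) (hlam : ContDiffOn ℝ 2 lam (Icc a b))
    (s : ℝ) (hs0 : 0 < s) (hs1 : s ≤ 1)
    (hdiv : ¬ Summable fun q : ℕ =>
      (ψ ((q : ℝ) + 1) / ((q : ℝ) + 1)) ^ s * ((q : ℝ) + 1) ^ n) :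
    μH[s] {x ∈ Icc a b |
        {c : Fin n → ℤ | c ≠ 0 ∧
          nearestIntDist ((∑ i, (c i : ℝ) * f i x) + lam x) <
            ψ ((Finset.univ.sup fun i => (c i).natAbs : ℕ) : ℝ)}.Infinite} =
      μH[s] (Icc a b) := by
  obtain ⟨R, hR, C, hC, τ, hτ, hub⟩ := exists_ubiquity hn hab hf hW hlam
  obtain ⟨M, hM0, hM⟩ : ∃ M, 0 ≤ M ∧ ∀ i, ∀ x ∈ Icc a b, ∀ y ∈ Icc a b,
      |f i x - f i y| ≤ M * |x - y| := by
    choose M hM0 hM using fun i => (hf i).exists_lipschitz_const (by omega)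
    refine ⟨∑ i, M i, Finset.sum_nonneg fun i _ => hM0 i, fun i x hx y hy =>
      (hM i x hx y hy).trans (mul_le_mul_of_nonneg_right ?_ (abs_nonneg _))⟩
    exact Finset.single_le_sum (fun j _ => hM0 j) (Finset.mem_univ i)
  obtain ⟨L, hL0, hL⟩ := ContDiffOn.exists_lipschitz_const two_ne_zero (by exact_mod_cast hlam)
  set B : ℕ := ⌈C⌉₊ + 64 with hBdef
  have hBC : C ≤ B := by
    rw [hBdef]; push_cast
    linarith [Nat.le_ceil C]
  have hB64 : (64 : ℝ) ≤ B := by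
    rw [hBdef]; push_cast
    linarith [Nat.cast_nonneg (α := ℝ) ⌈C⌉₊]
  have hB1 : (1 : ℝ) < B := by linarith
  have hBp : ∀ k : ℕ, (0 : ℝ) < (B : ℝ) ^ k := fun k => by positivity
  set κ := 1 / (2 * (n * C * M + L + 1)) with hκdef
  have hκ : 0 < κ := by positivity
  set P : ℕ → Set ℝ := fun k => resonantSet f lam C ((B : ℝ) ^ k) with hP
  set ρ : ℕ → ℝ := fun k => R / ((B : ℝ) ^ k) ^ (n + 1) with hρdef
  have hρ : ∀ k, 0 < ρ k := fun k => by positivity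
  have hρ' : ∀ k, ρ (k + 1) ≤ ρ k / 40 := by
    intro k
    simp only [hρdef]
    rw [div_div]
    refine div_le_div_of_nonneg_left hR.le (by positivity) ?_
    calc ((B : ℝ) ^ k) ^ (n + 1) * 40 ≤ ((B : ℝ) ^ k) ^ (n + 1) * (B : ℝ) ^ (n + 1) := by
          gcongr
          have := le_self_pow₀ hB1.le (show n + 1 ≠ 0 by omega)
          linarith
      _ = _ := by ring
  have hρlim : Tendsto ρ atTop (nhds 0) := by
    refine squeeze_zero (fun k => (hρ k).le) (g := fun k => ρ 0 * (1 / 40) ^ k) (fun k => ?_) ?_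
    · induction k with
      | zero => simp
      | succ k ih =>
        have := hρ' k
        rw [pow_succ]
        linarith
    · simpa using (tendsto_pow_atTop_nhds_zero_of_lt_one (r := (1 / 40 : ℝ)) (by norm_num)
        (by norm_num)).const_mul (ρ 0)
  set r₀ : ℕ → ℝ := fun k => κ * (ψ ((B : ℝ) ^ (k + 1)) / (B : ℝ) ^ k) with hr₀def
  have hr₀ : ∀ k, 0 < r₀ k := fun k => mul_pos hκ (div_pos (hψpos _ (hBp _)) (hBp k))
  set r : ℕ → ℝ := fun k => min (r₀ k) (ρ k ^ (1 / s)) with hrdef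
  have hr : ∀ k, 0 < r k := fun k => lt_min (hr₀ k) (Real.rpow_pos_of_pos (hρ k) _)
  have hrlim : Tendsto r atTop (nhds 0) := by
    have h1 : Tendsto (fun k => ρ k ^ (1 / s)) atTop (nhds 0) := by
      have := hρlim.rpow_const (p := 1 / s) (Or.inr (by positivity))
      rwa [Real.zero_rpow (by positivity)] at this
    exact squeeze_zero (fun k => (hr k).le) (fun k => min_le_right _ _) h1
  have hrs : ∀ k, r k ^ s = min (r₀ k ^ s) (ρ k) := by
    intro k
    have h1 : (ρ k ^ (1 / s)) ^ s = ρ k := by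
      rw [← Real.rpow_mul (hρ k).le, one_div_mul_cancel hs0.ne', Real.rpow_one]
    have hmono : MonotoneOn (fun t : ℝ => t ^ s) (Ici 0) :=
      Real.monotoneOn_rpow_Ici_of_exponent_nonneg hs0.le
    rw [← h1]
    exact hmono.map_min (hr₀ k).le (Real.rpow_nonneg (hρ k).le _)
  have hdiv₀ : ¬ Summable fun k => r₀ k ^ s / ρ k := by
    have h1 := not_summable_condensed (show 2 ≤ B by omega) hψpos hψdec hs0 hdiv
    refine fun h => h1 ((h.mul_left (R / κ ^ s)).congr fun k => ?_)
    simp only [hr₀def, hρdef]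
    rw [Real.mul_rpow hκ.le (div_pos (hψpos _ (hBp _)) (hBp k)).le]
    have := Real.rpow_pos_of_pos hκ s
    field_simp
  have hdivr : ¬ Summable fun k => r k ^ s / ρ k := by
    refine fun h => not_summable_min hdiv₀ one_pos (h.congr fun k => ?_)
    rw [hrs, ← min_div_div_right (hρ k).le, div_self (hρ k).ne']
  have hfull : ∀ η > 0, ∀ m, volume (Icc a b \
      ⋃ k ≥ m, ⋃ p ∈ P k ∩ Icc a b, Metric.closedBall p (η * r k ^ s)) = 0 := by
    intro η hη m
    have hη' : 0 < min η 1 := lt_min hη one_pos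
    refine measure_mono_null ?_ (volume_diff_balls_eq_zero (P := P)
      (r := fun k => min η 1 * r k ^ s) hρ hρ' (fun k => ?_) (fun k => ?_) ?_ (a := a) (b := b)
      hτ ?_ m)
    · refine sdiff_subset_sdiff_right (iUnion₂_mono fun k _ => iUnion₂_mono fun p _ =>
        Metric.closedBall_subset_closedBall ?_)
      exact mul_le_mul_of_nonneg_right (min_le_left _ _) (Real.rpow_nonneg (hr k).le _)
    · exact mul_nonneg hη'.le (Real.rpow_nonneg (hr k).le _)
    · refine (mul_le_of_le_one_left (Real.rpow_nonneg (hr k).le _) (min_le_right _ _)).trans ?_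
      rw [hrs]
      exact min_le_right _ _
    · refine fun h => hdivr ((h.mul_left (min η 1)⁻¹).congr fun k => ?_)
      field_simp
    · intro u v hau huv hvb huvτ
      obtain ⟨Q₀, hQ₀⟩ := hub u v hau huv hvb huvτ
      obtain ⟨k₀, hk₀⟩ := eventually_atTop.1
        ((tendsto_pow_atTop_atTop_of_one_lt hB1).eventually_ge_atTop Q₀)
      exact ⟨k₀, fun k hk => hQ₀ _ (hk₀ k hk)⟩
  set E := {x ∈ Icc a b |
        {c : Fin n → ℤ | c ≠ 0 ∧
          nearestIntDist ((∑ i, (c i : ℝ) * f i x) + lam x) <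
            ψ ((Finset.univ.sup fun i => (c i).natAbs : ℕ) : ℝ)}.Infinite} with hE
  set A := Icc a b ∩ ⋂ m : ℕ, ⋃ k ≥ m, ⋃ p ∈ P k ∩ Icc a b, Metric.closedBall p (r k) with hA
  have hAE : A ⊆ E := by
    rintro x ⟨hx, hxA⟩
    refine ⟨hx, fun hfin => ?_⟩
    obtain ⟨D, hD⟩ := (hfin.image fun c : Fin n → ℤ => ‖fun i => (c i : ℝ)‖).bddAbove
    obtain ⟨m, hm⟩ := pow_unbounded_of_one_lt D hB1
    have hxm := mem_iInter.1 hxA m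
    simp only [mem_iUnion, exists_prop] at hxm
    obtain ⟨k, hk, p, ⟨hpP, hpI⟩, hxp⟩ := hxm
    rw [Metric.mem_closedBall, Real.dist_eq] at hxp
    obtain ⟨c, hc1, hc2, hc3⟩ := exists_approximation_of_near_resonant hM hL hM0 hL0 hψdec
      (T := (B : ℝ) ^ (k + 1)) (one_le_pow₀ hB1.le)
      (by rw [pow_succ']; exact mul_le_mul_of_nonneg_right hBC (hBp k).le)
      (hψpos _ (hBp _)) hpP hpI hx hC.le (hxp.trans (min_le_left _ _))
    have h1 := hD (mem_image_of_mem _ (show c ∈ {c : Fin n → ℤ | c ≠ 0 ∧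
          nearestIntDist ((∑ i, (c i : ℝ) * f i x) + lam x) <
            ψ ((Finset.univ.sup fun i => (c i).natAbs : ℕ) : ℝ)} from ⟨hc2, hc3⟩))
    have h2 := pow_le_pow_right₀ hB1.le hk
    linarith
  have hEI : E ⊆ Icc a b := fun x hx => hx.1
  refine le_antisymm (measure_mono hEI) ?_
  rcases hs1.lt_or_eq with hlt | rfl
  · have h1 := hausdorffMeasure_limsup_eq_top hr hrlim hs0 hlt hab hfull
    rw [top_le_iff.1 (h1.symm.le.trans (measure_mono hAE))]
    exact le_top
  · rw [hausdorffMeasure_real]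
    refine (measure_le_inter_add_sdiff volume (Icc a b) A).trans ?_
    have h0 : volume (Icc a b \ A) = 0 := by
      rw [hA, sdiff_self_inter, sdiff_iInter]
      refine measure_iUnion_null fun m => ?_
      simpa only [one_mul, Real.rpow_one] using hfull 1 one_pos m
    rw [h0, add_zero]
    exact measure_mono (inter_subset_right.trans hAE)
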